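/- There is an absolute constant c > 0 such that for all integers D, k, n with k ≤ n^{1/64} and D ≤ 2 log n: if G ~ G(n,k,n^{−2/D}), then with probability tending to 1 as n → ∞, every tree-like semantic cutting planes refutation of the unary block clique formula bclique_u(G,k) has length at least n^{c·D}. -/

import Mathlib

open Finset

abbrev Vtx (k n : ℕ) := Fin k × Fin n
abbrev Tup (k n : ℕ) := Fin k → Fin n

/-- Potential edges: pairs of vertices lying in distinct blocks. -/
def potEdges (k n : ℕ) : Finset (Sym2 (Vtx k n)) :=
  Finset.univ.filter fun e => ¬ (Sym2.map Prod.fst e).IsDiag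

open Classical in
/-- The probability, under the distribution `G(n,k,p)` (each potential edge present
independently with probability `p`), that the sampled graph satisfies `P`. -/
noncomputable def probG (k n : ℕ) (p : ℝ) (P : Finset (Sym2 (Vtx k n)) → Prop) : ℝ :=
  ∑ G ∈ (potEdges k n).powerset,
    if P G then p ^ G.card * (1 - p) ^ ((potEdges k n).card - G.card) else 0

/-- The biased character `χ_E(G) = ∏_{e ∈ E} χ_e(G)`. -/
noncomputable def chiE {k n : ℕ} (p : ℝ) (G E : Finset (Sym2 (Vtx k n))) : ℝ :=
  ∏ e ∈ E, if e ∈ G then (1 - p) / p else -1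

/-- The edge of a tuple `t` joining its vertices in blocks `i` and `j`. -/
def tupEdge {k n : ℕ} (t : Tup k n) (i j : Fin k) : Sym2 (Vtx k n) := s((i, t i), (j, t j))

/-- `t` is a `k`-clique of `G`. -/
def IsClique {k n : ℕ} (G : Finset (Sym2 (Vtx k n))) (t : Tup k n) : Prop :=
  ∀ i j : Fin k, i ≠ j → tupEdge t i j ∈ G

/-- `S` is a vertex cover of the graph `H` on `[k]`. -/
def IsCover {k : ℕ} (H : Finset (Sym2 (Fin k))) (S : Finset (Fin k)) : Prop :=
  ∀ e ∈ H, ∃ v ∈ S, v ∈ e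

/-- Minimum vertex cover size. -/
noncomputable def vc {k : ℕ} (H : Finset (Sym2 (Fin k))) : ℕ :=
  sInf {m | ∃ S : Finset (Fin k), S.card = m ∧ IsCover H S}

/-- The graph `H(t)` on the vertices of the tuple `t` obtained from a graph `H` on `[k]`. -/
def graphOf {k n : ℕ} (H : Finset (Sym2 (Fin k))) (t : Tup k n) : Finset (Sym2 (Vtx k n)) :=
  H.image (Sym2.map fun i => (i, t i))

open Classical in
/-- The pseudo-measure `μ_{G,d}` on a single tuple. -/
noncomputable def mu {k n : ℕ} (p : ℝ) (G : Finset (Sym2 (Vtx k n))) (d : ℝ) (t : Tup k n) : ℝ :=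
  ((n : ℝ) ^ k)⁻¹ *
    ∑ H ∈ Finset.univ.filter
        (fun H : Finset (Sym2 (Fin k)) => (∀ e ∈ H, ¬ e.IsDiag) ∧ (vc H : ℝ) ≤ d),
      chiE p G (graphOf H t)

/-- The pseudo-measure `μ_{G,d}` on a set of tuples. -/
noncomputable def muSet {k n : ℕ} (p : ℝ) (G : Finset (Sym2 (Vtx k n))) (d : ℝ)
    (Q : Finset (Tup k n)) : ℝ :=
  ∑ t ∈ Q, mu p G d t

/-- `Q` is ruled out by a missing edge: some potential edge `e ∉ E(G)` satisfies `e ⊆ t`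
for every `t ∈ Q`. -/
def RuledOut {k n : ℕ} (G : Finset (Sym2 (Vtx k n))) (Q : Finset (Tup k n)) : Prop :=
  ∃ e ∈ potEdges k n, e ∉ G ∧ ∀ t ∈ Q, ∀ u ∈ e, t u.1 = u.2


/-- A Boolean function on `N` variables, viewed as the indicator of the set of
assignments it rules out. -/
abbrev BFunc (N : ℕ) := (Fin N → Bool) → Bool

/-- A clause over `N` Boolean variables: a disjunction of literals over distinct
variables, recorded by the polarity (if any) of each variable. -/
abbrev Clause (N : ℕ) := Fin N → Option Bool

/-- The assignment `α` satisfies the clause `c`. -/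
def clauseSat {N : ℕ} (c : Clause N) (α : Fin N → Bool) : Prop :=
  ∃ i b, c i = some b ∧ α i = b

/-- The indicator of the falsifying assignments of the clause `c`. -/
def falsInd {N : ℕ} (c : Clause N) : BFunc N :=
  fun α => decide (∀ i b, c i = some b → α i ≠ b)

/-- A tree-like semantic proof: a tree each of whose nodes is labelled with a Boolean
function and has at most two children. -/
inductive SemProof (N : ℕ) : Type
  | leaf : BFunc N → SemProof N
  | node1 : BFunc N → SemProof N → SemProof N
  | node2 : BFunc N → SemProof N → SemProof N → SemProof N

namespace SemProof

/-- The function labelling the root. -/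
def root {N : ℕ} : SemProof N → BFunc N
  | leaf f => f
  | node1 f _ => f
  | node2 f _ _ => f

/-- The length of a tree-like proof: its number of lines. -/
def length {N : ℕ} : SemProof N → ℕ
  | leaf _ => 1
  | node1 _ s => s.length + 1
  | node2 _ s t => s.length + t.length + 1

/-- A valid tree-like `sem(F)` derivation from the CNF formula `A`: every line either is
the indicator of the falsifying assignments of a clause of `A`, or belongs to `F` and is
semantically implied by its (at most two) premises. -/
def Valid {N : ℕ} (F : Set (BFunc N)) (A : Finset (Clause N)) : SemProof N → Prop
  | leaf f => ∃ c ∈ A, f = falsInd c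
  | node1 f s => ((∃ c ∈ A, f = falsInd c) ∨
      (f ∈ F ∧ ∀ α, f α = true → s.root α = true)) ∧ Valid F A s
  | node2 f s t => ((∃ c ∈ A, f = falsInd c) ∨
      (f ∈ F ∧ ∀ α, f α = true → s.root α = true ∨ t.root α = true)) ∧
      Valid F A s ∧ Valid F A t

end SemProof

/-- A tree-like `sem(F)` refutation of `A`: a valid derivation whose final line is the
constant-`1` function (ruling out every assignment, i.e. contradiction). -/
def IsRefutation {N : ℕ} (F : Set (BFunc N)) (A : Finset (Clause N)) (π : SemProof N) : Prop :=
  SemProof.Valid F A π ∧ ∀ α, π.root α = true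

/-- A tree-like `sem(F)` derivation of the function `g` from `A`. -/
def IsDerivation {N : ℕ} (F : Set (BFunc N)) (A : Finset (Clause N)) (π : SemProof N)
    (g : BFunc N) : Prop :=
  SemProof.Valid F A π ∧ π.root = g


/-- The variable of the unary block clique formula corresponding to the vertex `v`. -/
def vidx {k n : ℕ} (v : Vtx k n) : Fin (k * n) := finProdFinEquiv v

open Classical in
/-- The unary block clique formula `bclique_u(G,k)`, a CNF formula over the variables
`{x_v : v ∈ V_1 ∪ ⋯ ∪ V_k}`: edge axioms `¬x_u ∨ ¬x_v` for every pair of vertices in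
distinct blocks with `{u,v} ∉ E(G)`, and block axioms `∨_{v ∈ V_i} x_v`. -/
noncomputable def bcliqueU (k n : ℕ) (G : Finset (Sym2 (Vtx k n))) :
    Finset (Clause (k * n)) :=
  ((Finset.univ.filter fun uv : Vtx k n × Vtx k n =>
      uv.1.1 ≠ uv.2.1 ∧ s(uv.1, uv.2) ∉ G).image
    fun uv => (fun w => if w = vidx uv.1 ∨ w = vidx uv.2 then some false else none :
      Clause (k * n))) ∪
  (Finset.univ.image fun i : Fin k =>
    (fun w => if (finProdFinEquiv.symm w).1 = i then some true else none :
      Clause (k * n)))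

/-- The lines of the semantic cutting planes proof system: Boolean functions that are
(indicators of the falsifying assignments of) linear integer inequalities
`Σ aᵢxᵢ ≥ b`. -/
def CPlines (N : ℕ) : Set (BFunc N) :=
  {f | ∃ (a : Fin N → ℤ) (b : ℤ), ∀ α,
    f α = !(decide (b ≤ ∑ i, a i * (if α i then 1 else 0)))}


open Finset

/-! ### Expectation over a random subset -/

namespace BC

section Expectation

variable {α : Type*} [DecidableEq α]
set_option linter.unusedSectionVars false

/-- Expectation of `f G` where `G` is a `p`-random subset of `E`. -/
noncomputable def Ex (E : Finset α) (p : ℝ) (f : Finset α → ℝ) : ℝ :=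
  ∑ G ∈ E.powerset, p ^ G.card * (1 - p) ^ (E.card - G.card) * f G

lemma Ex_add (E : Finset α) (p : ℝ) (f g : Finset α → ℝ) :
    Ex E p (fun G => f G + g G) = Ex E p f + Ex E p g := by
  unfold Ex; rw [← Finset.sum_add_distrib]; exact Finset.sum_congr rfl fun _ _ => by ring

lemma Ex_mul (E : Finset α) (p c : ℝ) (f : Finset α → ℝ) :
    Ex E p (fun G => c * f G) = c * Ex E p f := by
  unfold Ex; rw [Finset.mul_sum]; exact Finset.sum_congr rfl fun _ _ => by ring

lemma Ex_sum {ι : Type*} (E : Finset α) (p : ℝ) (T : Finset ι) (f : ι → Finset α → ℝ) :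
    Ex E p (fun G => ∑ i ∈ T, f i G) = ∑ i ∈ T, Ex E p (f i) := by
  unfold Ex; simp_rw [Finset.mul_sum]; exact Finset.sum_comm

lemma Ex_mono {E : Finset α} {p : ℝ} (h0 : 0 ≤ p) (h1 : p ≤ 1) {f g : Finset α → ℝ}
    (h : ∀ G, G ⊆ E → f G ≤ g G) : Ex E p f ≤ Ex E p g := by
  unfold Ex
  refine Finset.sum_le_sum fun G hG => ?_
  have : 0 ≤ 1 - p := by linarith
  exact mul_le_mul_of_nonneg_left (h G (Finset.mem_powerset.1 hG)) (by positivity)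

lemma Ex_congr {E : Finset α} {p : ℝ} {f g : Finset α → ℝ}
    (h : ∀ G, G ⊆ E → f G = g G) : Ex E p f = Ex E p g :=
  Finset.sum_congr rfl fun G hG => by rw [h G (Finset.mem_powerset.1 hG)]

lemma Ex_nonneg {E : Finset α} {p : ℝ} (h0 : 0 ≤ p) (h1 : p ≤ 1) {f : Finset α → ℝ}
    (h : ∀ G, G ⊆ E → 0 ≤ f G) : 0 ≤ Ex E p f := by
  have := Ex_mono h0 h1 h
  simpa [Ex] using this

lemma Ex_insert {E : Finset α} {e : α} (he : e ∉ E) (p : ℝ) (f : Finset α → ℝ) :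
    Ex (insert e E) p f = (1 - p) * Ex E p f + p * Ex E p (fun G => f (insert e G)) := by
  unfold Ex
  rw [Finset.sum_powerset_insert he, Finset.mul_sum, Finset.mul_sum]
  congr 1
  · refine Finset.sum_congr rfl fun G hG => ?_
    have hc := Finset.card_le_card (Finset.mem_powerset.1 hG)
    rw [Finset.card_insert_of_notMem he, show E.card + 1 - G.card = (E.card - G.card) + 1 by omega]
    ring
  · refine Finset.sum_congr rfl fun G hG => ?_
    have : e ∉ G := fun h => he (Finset.mem_powerset.1 hG h)
    rw [Finset.card_insert_of_notMem he, Finset.card_insert_of_notMem this, Nat.add_sub_add_right]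
    ring

lemma Ex_one (E : Finset α) (p : ℝ) : Ex E p (fun _ => 1) = 1 := by
  induction E using Finset.induction_on with
  | empty => simp [Ex]
  | insert e E he ih => rw [Ex_insert he, ih]; ring

/-- Indicator that `F ⊆ G`. -/
noncomputable def ind (F G : Finset α) : ℝ := if F ⊆ G then 1 else 0

lemma ind_nonneg (F G : Finset α) : 0 ≤ ind F G := by unfold ind; split_ifs <;> norm_num

lemma ind_union (F F' G : Finset α) : ind (F ∪ F') G = ind F G * ind F' G := by
  unfold ind
  by_cases h : F ⊆ G <;> by_cases h' : F' ⊆ G <;> simp [h, h', Finset.union_subset_iff]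

lemma Ex_edge {E : Finset α} {e : α} (he : e ∈ E) (p : ℝ) (h : Finset α → ℝ)
    (hh : ∀ G, h (insert e G) = h G) :
    Ex E p (fun G => ind {e} G * h G) = p * Ex E p h := by
  obtain ⟨E0, he0, rfl⟩ : ∃ E0, e ∉ E0 ∧ E = insert e E0 :=
    ⟨E.erase e, Finset.notMem_erase e E, (Finset.insert_erase he).symm⟩
  rw [Ex_insert he0, Ex_insert he0]
  have h1 : Ex E0 p (fun G => ind {e} G * h G) = 0 := by
    unfold Ex
    refine Finset.sum_eq_zero fun G hG => ?_
    have : e ∉ G := fun h => he0 (Finset.mem_powerset.1 hG h)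
    simp [ind, this]
  rw [h1]
  simp only [hh, ind, Finset.singleton_subset_iff, Finset.mem_insert_self, if_true, one_mul]
  ring

/-- Independence. -/
lemma Ex_ind {E F : Finset α} (hF : F ⊆ E) (p : ℝ) (h : Finset α → ℝ)
    (hh : ∀ e ∈ F, ∀ G, h (insert e G) = h G) :
    Ex E p (fun G => ind F G * h G) = p ^ F.card * Ex E p h := by
  induction F using Finset.induction_on with
  | empty => simp [ind]
  | insert e F he ih =>
    have h1 : Ex E p (fun G => ind (insert e F) G * h G)
        = Ex E p (fun G => ind {e} G * (ind F G * h G)) := by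
      refine Ex_congr fun G _ => ?_
      rw [Finset.insert_eq, ind_union, mul_assoc]
    rw [h1, Ex_edge (hF (Finset.mem_insert_self _ _)), ih, Finset.card_insert_of_notMem he]
    · ring
    · exact fun a ha => hF (Finset.mem_insert_of_mem ha)
    · exact fun a ha => hh a (Finset.mem_insert_of_mem ha)
    · intro G
      rw [hh e (Finset.mem_insert_self _ _)]
      congr 1
      unfold ind
      have : F ⊆ insert e G ↔ F ⊆ G := Finset.subset_insert_iff_of_notMem he
      simp [this]

lemma Ex_ind_one {E F : Finset α} (hF : F ⊆ E) (p : ℝ) :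
    Ex E p (ind F) = p ^ F.card := by
  have := Ex_ind hF p (fun _ => 1) (fun _ _ _ => rfl)
  rw [Ex_one] at this
  simpa using this

lemma Ex_eq_univ [Fintype α] (E : Finset α) (p : ℝ) (f : Finset α → ℝ) :
    Ex E p f = ∑ G, (if G ⊆ E then p ^ G.card * (1 - p) ^ (E.card - G.card) else 0) * f G := by
  unfold Ex
  simp only [ite_mul, zero_mul]
  rw [← Finset.sum_filter]
  refine Finset.sum_congr ?_ fun _ _ => rfl
  ext G; simp

/-- Harris/FKG for increasing functions. -/
lemma harris_mono [Fintype α] {E F : Finset α} {p : ℝ} (h0 : 0 ≤ p) (h1 : p ≤ 1)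
    (f g : Finset α → ℝ) (hf0 : ∀ G, 0 ≤ f G) (hg0 : ∀ G, 0 ≤ g G)
    (hf : Monotone f) (hg : Monotone g) :
    Ex E p (fun G => ind F G * f G) * Ex E p (fun G => ind F G * g G) ≤
      Ex E p (ind F) * Ex E p (fun G => ind F G * (f G * g G)) := by
  have hq : 0 ≤ 1 - p := by linarith
  have := fkg f g (fun G : Finset α =>
    (if G ⊆ E then p ^ G.card * (1 - p) ^ (E.card - G.card) else 0) * ind F G)
    (fun G => by
      refine mul_nonneg ?_ (ind_nonneg _ _)
      split_ifs
      · positivity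
      · exact le_rfl) hf0 hg0 hf hg ?_
  · simp only [Ex_eq_univ]
    simpa only [mul_assoc] using this
  · intro A B
    simp only [Finset.inf_eq_inter, Finset.sup_eq_union, ind]
    by_cases hA : A ⊆ E <;> by_cases hB : B ⊆ E <;> by_cases hA' : F ⊆ A <;>
      by_cases hB' : F ⊆ B <;> simp only [hA, hB, hA', hB', if_true, if_false, mul_zero, zero_mul,
        mul_one] <;> try (refine mul_nonneg (mul_nonneg ?_ ?_) (mul_nonneg ?_ ?_) <;>
          split_ifs <;> positivity)
    have h3 : A ∩ B ⊆ E := Finset.inter_subset_left.trans hA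
    have h4 : A ∪ B ⊆ E := Finset.union_subset hA hB
    have h5 : F ⊆ A ∩ B := Finset.subset_inter hA' hB'
    have h6 : F ⊆ A ∪ B := hA'.trans Finset.subset_union_left
    simp only [h3, h4, h5, h6, if_true, mul_one]
    have hc := Finset.card_inter_add_card_union A B
    have a1 := Finset.card_le_card hA
    have a2 := Finset.card_le_card hB
    have a3 := Finset.card_le_card h3
    have a4 := Finset.card_le_card h4
    apply le_of_eq
    calc _ = p ^ (A.card + B.card) * (1 - p) ^ ((E.card - A.card) + (E.card - B.card)) := by
            rw [pow_add, pow_add]; ring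
      _ = p ^ ((A ∩ B).card + (A ∪ B).card) *
          (1 - p) ^ ((E.card - (A ∩ B).card) + (E.card - (A ∪ B).card)) := by
            congr 2 <;> omega
      _ = _ := by rw [pow_add, pow_add]; ring

/-- Harris/FKG for decreasing functions with values in `[0,1]`. -/
lemma harris_anti [Fintype α] {E F : Finset α} {p : ℝ} (h0 : 0 ≤ p) (h1 : p ≤ 1)
    (f g : Finset α → ℝ) (hf0 : ∀ G, f G ≤ 1) (hg0 : ∀ G, g G ≤ 1)
    (hf : Antitone f) (hg : Antitone g) :
    Ex E p (fun G => ind F G * f G) * Ex E p (fun G => ind F G * g G) ≤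
      Ex E p (ind F) * Ex E p (fun G => ind F G * (f G * g G)) := by
  have := harris_mono (E := E) (F := F) h0 h1 (fun G => 1 - f G) (fun G => 1 - g G)
    (fun G => by linarith [hf0 G]) (fun G => by linarith [hg0 G])
    (fun A B h => by linarith [hf h]) (fun A B h => by linarith [hg h])
  have e1 : ∀ f : Finset α → ℝ, Ex E p (fun G => ind F G * (1 - f G))
      = Ex E p (ind F) - Ex E p (fun G => ind F G * f G) := by
    intro f
    rw [eq_sub_iff_add_eq, ← Ex_add]
    exact Ex_congr fun G _ => by ring
  have e2 : Ex E p (fun G => ind F G * ((1 - f G) * (1 - g G)))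
      = Ex E p (ind F) - Ex E p (fun G => ind F G * f G) - Ex E p (fun G => ind F G * g G)
        + Ex E p (fun G => ind F G * (f G * g G)) := by
    rw [sub_sub, ← Ex_add, ← sub_eq_iff_eq_add, sub_eq_iff_eq_add, eq_comm, sub_add_eq_add_sub,
      sub_eq_iff_eq_add, ← Ex_add, ← Ex_add]
    exact Ex_congr fun G _ => by ring
  rw [e1, e1, e2] at this
  nlinarith [this]

end Expectation

end BC

open Finset

namespace BC

section Janson

variable {α : Type*} [DecidableEq α]
set_option linter.unusedSectionVars false

open Classical in
/-- Probability of an event. -/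
noncomputable def Pr (E : Finset α) (p : ℝ) (P : Finset α → Prop) : ℝ :=
  Ex E p (fun G => if P G then 1 else 0)

lemma Pr_mono {E : Finset α} {p : ℝ} (h0 : 0 ≤ p) (h1 : p ≤ 1) {P Q : Finset α → Prop}
    (h : ∀ G, G ⊆ E → P G → Q G) : Pr E p P ≤ Pr E p Q := by
  refine Ex_mono h0 h1 fun G hG => ?_
  by_cases hP : P G
  · simp [hP, h G hG hP]
  · simp only [hP, if_false]; split_ifs <;> norm_num

lemma Pr_nonneg {E : Finset α} {p : ℝ} (h0 : 0 ≤ p) (h1 : p ≤ 1) (P : Finset α → Prop) :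
    0 ≤ Pr E p P := Ex_nonneg h0 h1 fun G _ => by split_ifs <;> norm_num

lemma Pr_or {E : Finset α} {p : ℝ} (h0 : 0 ≤ p) (h1 : p ≤ 1) (P Q : Finset α → Prop) :
    Pr E p (fun G => P G ∨ Q G) ≤ Pr E p P + Pr E p Q := by
  unfold Pr
  rw [← Ex_add]
  refine Ex_mono h0 h1 fun G _ => ?_
  by_cases hP : P G <;> by_cases hQ : Q G <;> simp [hP, hQ]

lemma Pr_exists {ι : Type*} {E : Finset α} {p : ℝ} (h0 : 0 ≤ p) (h1 : p ≤ 1) (T : Finset ι)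
    (P : ι → Finset α → Prop) {b : ℝ} (hb : ∀ i ∈ T, Pr E p (P i) ≤ b) :
    Pr E p (fun G => ∃ i ∈ T, P i G) ≤ T.card * b := by
  classical
  calc Pr E p (fun G => ∃ i ∈ T, P i G) ≤ ∑ i ∈ T, Pr E p (P i) := by
        unfold Pr
        rw [← Ex_sum]
        refine Ex_mono h0 h1 fun G _ => ?_
        by_cases h : ∃ i ∈ T, P i G
        · obtain ⟨i, hi, hP⟩ := h
          have h' : ∃ i ∈ T, P i G := ⟨i, hi, hP⟩
          simp only [h', if_true]
          have := Finset.single_le_sum (f := fun i => if P i G then (1:ℝ) else 0)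
            (fun j _ => by split_ifs <;> norm_num) hi
          simpa [hP] using this
        · simp only [h, if_false]
          exact Finset.sum_nonneg fun j _ => by split_ifs <;> norm_num
    _ ≤ ∑ i ∈ T, b := Finset.sum_le_sum hb
    _ = T.card * b := by simp

lemma Pr_not (E : Finset α) (p : ℝ) (P : Finset α → Prop) :
    Pr E p (fun G => ¬ P G) = 1 - Pr E p P := by
  unfold Pr
  rw [eq_sub_iff_add_eq, ← Ex_add]
  refine Eq.trans (Ex_congr fun G _ => ?_) (Ex_one E p)
  by_cases h : P G <;> simp [h]

/-- Markov. -/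
lemma Pr_markov {E : Finset α} {p : ℝ} (h0 : 0 ≤ p) (h1 : p ≤ 1) {P : Finset α → Prop}
    {f : Finset α → ℝ} (hf : ∀ G, 0 ≤ f G) {c b : ℝ} (hc : 0 < c)
    (h : ∀ G, G ⊆ E → P G → c ≤ f G)
    (hb : Ex E p f ≤ b) : Pr E p P ≤ b / c := by
  rw [le_div_iff₀ hc, mul_comm]
  refine le_trans ?_ hb
  unfold Pr
  rw [← Ex_mul]
  refine Ex_mono h0 h1 fun G hG => ?_
  by_cases hP : P G
  · simpa [hP] using h G hG hP
  · simpa [hP] using hf G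

variable {ι : Type*}

/-- The normalised weighted count. -/
noncomputable def JX (p : ℝ) (T : Finset ι) (P : ι → ℝ) (Ei : ι → Finset α) (G : Finset α) : ℝ :=
  ∑ i ∈ T, P i * (p ^ (Ei i).card)⁻¹ * ind (Ei i) G

lemma ind_mono {F G G' : Finset α} (h : G ⊆ G') : ind F G ≤ ind F G' := by
  unfold ind
  by_cases h1 : F ⊆ G
  · simp [h1, h1.trans h]
  · simp only [h1, if_false]; split_ifs <;> norm_num

lemma JX_mono {p : ℝ} (h0 : 0 ≤ p) {T : Finset ι} {P : ι → ℝ} (hP : ∀ i ∈ T, 0 ≤ P i)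
    (Ei : ι → Finset α) : Monotone (JX p T P Ei) := by
  intro G G' h
  refine Finset.sum_le_sum fun i hi => ?_
  exact mul_le_mul_of_nonneg_left (ind_mono h) (mul_nonneg (hP i hi) (by positivity))

lemma JX_nonneg {p : ℝ} (h0 : 0 ≤ p) {T : Finset ι} {P : ι → ℝ} (hP : ∀ i ∈ T, 0 ≤ P i)
    (Ei : ι → Finset α) (G : Finset α) : 0 ≤ JX p T P Ei G :=
  Finset.sum_nonneg fun i hi => mul_nonneg (mul_nonneg (hP i hi) (by positivity)) (ind_nonneg _ _)

lemma janson_one [Fintype α] {E : Finset α} {p : ℝ} (h0 : 0 < p) (h1 : p ≤ 1)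
    (T : Finset ι) (P : ι → ℝ) (hP : ∀ i ∈ T, 0 ≤ P i) (Ei : ι → Finset α)
    (hE : ∀ i ∈ T, Ei i ⊆ E) (u : ℝ) (hu : 0 ≤ u) (i : ι) (hi : i ∈ T) :
    p ^ (Ei i).card * (1 - u * ∑ j ∈ T with ¬ Disjoint (Ei i) (Ei j),
        P j * (p ^ (Ei i ∩ Ei j).card)⁻¹) * Ex E p (fun G => Real.exp (-u * JX p T P Ei G)) ≤
      Ex E p (fun G => ind (Ei i) G * Real.exp (-u * JX p T P Ei G)) := by
  set T' := T.filter fun j => ¬ Disjoint (Ei i) (Ei j) with hT'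
  set T'' := T.filter fun j => Disjoint (Ei i) (Ei j) with hT''
  have hP' : ∀ i ∈ T', 0 ≤ P i := fun j hj => hP j (Finset.mem_filter.1 hj).1
  have hP'' : ∀ i ∈ T'', 0 ≤ P i := fun j hj => hP j (Finset.mem_filter.1 hj).1
  have hsplit : ∀ G, JX p T P Ei G = JX p T' P Ei G + JX p T'' P Ei G := by
    intro G
    unfold JX
    rw [add_comm]
    exact (Finset.sum_filter_add_sum_filter_not T _ _).symm
  have hpc : 0 < p ^ (Ei i).card := by positivity
  have harr := harris_anti (E := E) (F := Ei i) h0.le h1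
    (fun G => Real.exp (-u * JX p T' P Ei G)) (fun G => Real.exp (-u * JX p T'' P Ei G))
    (fun G => by
      rw [Real.exp_le_one_iff]; nlinarith [JX_nonneg h0.le hP' Ei G])
    (fun G => by
      rw [Real.exp_le_one_iff]; nlinarith [JX_nonneg h0.le hP'' Ei G])
    (fun A B h => by
      apply Real.exp_le_exp.2; nlinarith [JX_mono h0.le hP' Ei h])
    (fun A B h => by
      apply Real.exp_le_exp.2; nlinarith [JX_mono h0.le hP'' Ei h])
  rw [Ex_ind_one (hE i hi)] at harr
  have e1 : Ex E p (fun G => ind (Ei i) G *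
      (Real.exp (-u * JX p T' P Ei G) * Real.exp (-u * JX p T'' P Ei G)))
      = Ex E p (fun G => ind (Ei i) G * Real.exp (-u * JX p T P Ei G)) := by
    refine Ex_congr fun G _ => ?_
    rw [← Real.exp_add, hsplit G]; ring_nf
  rw [e1] at harr
  have e2 : Ex E p (fun G => ind (Ei i) G * Real.exp (-u * JX p T'' P Ei G))
      = p ^ (Ei i).card * Ex E p (fun G => Real.exp (-u * JX p T'' P Ei G)) := by
    refine Ex_ind (hE i hi) p _ fun e he G => ?_
    congr 2
    unfold JX
    refine Finset.sum_congr rfl fun j hj => ?_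
    congr 1
    unfold ind
    have : e ∉ Ei j := Finset.disjoint_left.1 (Finset.mem_filter.1 hj).2 he
    simp [Finset.subset_insert_iff_of_notMem this]
  have e3 : Ex E p (fun G => Real.exp (-u * JX p T P Ei G)) ≤
      Ex E p (fun G => Real.exp (-u * JX p T'' P Ei G)) := by
    refine Ex_mono h0.le h1 fun G _ => Real.exp_le_exp.2 ?_
    have := JX_nonneg h0.le hP' Ei G
    rw [hsplit G]; nlinarith
  have e4 : p ^ (Ei i).card * (1 - u * ∑ j ∈ T', P j * (p ^ (Ei i ∩ Ei j).card)⁻¹) ≤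
      Ex E p (fun G => ind (Ei i) G * Real.exp (-u * JX p T' P Ei G)) := by
    calc p ^ (Ei i).card * (1 - u * ∑ j ∈ T', P j * (p ^ (Ei i ∩ Ei j).card)⁻¹)
        = Ex E p (fun G => ind (Ei i) G +
            ∑ j ∈ T', (-u * P j * (p ^ (Ei j).card)⁻¹) * ind (Ei i ∪ Ei j) G) := by
          rw [Ex_add, Ex_ind_one (hE i hi), Ex_sum, mul_sub, mul_one, sub_eq_add_neg]
          congr 1
          rw [Finset.mul_sum, Finset.mul_sum, ← Finset.sum_neg_distrib]
          refine Finset.sum_congr rfl fun j hj => ?_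
          have hj' := (Finset.mem_filter.1 hj).1
          rw [Ex_mul, Ex_ind_one (Finset.union_subset (hE i hi) (hE j hj'))]
          have hc := Finset.card_union_add_card_inter (Ei i) (Ei j)
          have : p ^ (Ei i ∪ Ei j).card * p ^ (Ei i ∩ Ei j).card =
              p ^ (Ei i).card * p ^ (Ei j).card := by
            rw [← pow_add, ← pow_add, hc]
          field_simp
          linear_combination (u * P j) * this
      _ ≤ _ := by
          refine Ex_mono h0.le h1 fun G _ => ?_
          have h2 : ind (Ei i) G + ∑ j ∈ T', (-u * P j * (p ^ (Ei j).card)⁻¹) * ind (Ei i ∪ Ei j) G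
              = ind (Ei i) G * (-u * JX p T' P Ei G + 1) := by
            unfold JX
            rw [mul_add, mul_one, add_comm, Finset.mul_sum, Finset.mul_sum]
            congr 1
            refine Finset.sum_congr rfl fun j _ => ?_
            rw [ind_union]; ring
          rw [h2]
          exact mul_le_mul_of_nonneg_left (Real.add_one_le_exp _) (ind_nonneg _ _)
  rw [e2] at harr
  set φ := Ex E p (fun G => Real.exp (-u * JX p T P Ei G))
  have hφ : 0 ≤ φ := Ex_nonneg h0.le h1 fun G _ => (Real.exp_pos _).le
  have ha : 0 ≤ Ex E p (fun G => ind (Ei i) G * Real.exp (-u * JX p T' P Ei G)) :=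
    Ex_nonneg h0.le h1 fun G _ => mul_nonneg (ind_nonneg _ _) (Real.exp_pos _).le
  have h5 := mul_le_mul_of_nonneg_right e4 hφ
  have h6 := mul_le_mul_of_nonneg_left e3 ha
  have h7 : p ^ (Ei i).card * (Ex E p (fun G => ind (Ei i) G * Real.exp (-u * JX p T' P Ei G)) *
      Ex E p (fun G => Real.exp (-u * JX p T'' P Ei G))) ≤
      p ^ (Ei i).card * Ex E p (fun G => ind (Ei i) G * Real.exp (-u * JX p T P Ei G)) := by
    linarith [harr]
  have h8 := le_of_mul_le_mul_left h7 hpc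
  exact h5.trans (h6.trans h8)

/-- Janson's inequality in the form we need. -/
lemma janson [Fintype α] {E : Finset α} {p : ℝ} (h0 : 0 < p) (h1 : p ≤ 1)
    (T : Finset ι) (P : ι → ℝ) (hP : ∀ i ∈ T, 0 ≤ P i) (hPs : ∑ i ∈ T, P i = 1)
    (Ei : ι → Finset α) (hE : ∀ i ∈ T, Ei i ⊆ E) {Δ : ℝ} (hΔ0 : 0 < Δ)
    (hΔ : ∑ i ∈ T, ∑ j ∈ T with ¬ Disjoint (Ei i) (Ei j),
      P i * P j * (p ^ (Ei i ∩ Ei j).card)⁻¹ ≤ Δ) :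
    Pr E p (fun G => JX p T P Ei G ≤ 1 / 2) ≤ Real.exp (-(1 / (8 * Δ))) := by
  set φ : ℝ → ℝ := fun u => Ex E p (fun G => Real.exp (-u * JX p T P Ei G)) with hφ
  have hder : ∀ u, HasDerivAt φ
      (Ex E p (fun G => -JX p T P Ei G * Real.exp (-u * JX p T P Ei G))) u := by
    intro u
    unfold Ex at hφ ⊢
    refine HasDerivAt.fun_sum fun G _ => ?_
    refine HasDerivAt.const_mul _ ?_
    have : HasDerivAt (fun u : ℝ => -u * JX p T P Ei G) (-JX p T P Ei G) u := by
      simpa using ((hasDerivAt_id u).neg.mul_const (JX p T P Ei G))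
    have := this.exp
    rwa [mul_comm] at this
  have hφ0 : ∀ u, 0 ≤ φ u := fun u => Ex_nonneg h0.le h1 fun G _ => (Real.exp_pos _).le
  have hineq : ∀ u, 0 ≤ u → Ex E p (fun G => -JX p T P Ei G * Real.exp (-u * JX p T P Ei G))
      ≤ -(1 - u * Δ) * φ u := by
    intro u hu
    have e1 : Ex E p (fun G => -JX p T P Ei G * Real.exp (-u * JX p T P Ei G))
        = ∑ i ∈ T, -(P i * (p ^ (Ei i).card)⁻¹) *
          Ex E p (fun G => ind (Ei i) G * Real.exp (-u * JX p T P Ei G)) := by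
      simp_rw [← Ex_mul]
      rw [← Ex_sum]
      refine Ex_congr fun G _ => ?_
      have hgen : ∀ c : ℝ, -JX p T P Ei G * c =
          ∑ i ∈ T, -(P i * (p ^ (Ei i).card)⁻¹) * (ind (Ei i) G * c) := by
        intro c
        rw [JX, neg_mul, Finset.sum_mul, ← Finset.sum_neg_distrib]
        exact Finset.sum_congr rfl fun i _ => by ring
      exact hgen _
    have e2 : ∑ i ∈ T, -(P i * (p ^ (Ei i).card)⁻¹) *
          Ex E p (fun G => ind (Ei i) G * Real.exp (-u * JX p T P Ei G)) ≤
        ∑ i ∈ T, -(P i * (1 - u * ∑ j ∈ T with ¬ Disjoint (Ei i) (Ei j),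
          P j * (p ^ (Ei i ∩ Ei j).card)⁻¹) * φ u) := by
      refine Finset.sum_le_sum fun i hi => ?_
      have := janson_one h0 h1 T P hP Ei hE u hu i hi
      have hc : 0 ≤ P i * (p ^ (Ei i).card)⁻¹ := mul_nonneg (hP i hi) (by positivity)
      have h3 := mul_le_mul_of_nonneg_left this hc
      have h4 : P i * (p ^ (Ei i).card)⁻¹ * (p ^ (Ei i).card * (1 - u *
          ∑ j ∈ T with ¬ Disjoint (Ei i) (Ei j), P j * (p ^ (Ei i ∩ Ei j).card)⁻¹) * φ u)
          = P i * (1 - u * ∑ j ∈ T with ¬ Disjoint (Ei i) (Ei j),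
          P j * (p ^ (Ei i ∩ Ei j).card)⁻¹) * φ u := by
        field_simp
      rw [h4] at h3
      linarith
    have e3 : ∑ i ∈ T, -(P i * (1 - u * ∑ j ∈ T with ¬ Disjoint (Ei i) (Ei j),
          P j * (p ^ (Ei i ∩ Ei j).card)⁻¹) * φ u) =
        -(1 - u * ∑ i ∈ T, ∑ j ∈ T with ¬ Disjoint (Ei i) (Ei j),
      P i * P j * (p ^ (Ei i ∩ Ei j).card)⁻¹) * φ u := by
      rw [Finset.sum_neg_distrib, ← Finset.sum_mul]
      simp_rw [mul_sub, mul_one, Finset.sum_sub_distrib, hPs]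
      simp_rw [mul_left_comm (P _) u, ← Finset.mul_sum, Finset.mul_sum, mul_assoc]
      ring
    rw [e1]
    refine e2.trans ?_
    rw [e3]
    have : u * ∑ i ∈ T, ∑ j ∈ T with ¬ Disjoint (Ei i) (Ei j),
      P i * P j * (p ^ (Ei i ∩ Ei j).card)⁻¹ ≤ u * Δ := mul_le_mul_of_nonneg_left hΔ hu
    nlinarith [hφ0 u]
  set ψ : ℝ → ℝ := fun u => φ u * Real.exp (u - u ^ 2 * Δ / 2) with hψ
  have hψd : ∀ u, HasDerivAt ψ
      (Ex E p (fun G => -JX p T P Ei G * Real.exp (-u * JX p T P Ei G)) *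
        Real.exp (u - u ^ 2 * Δ / 2) +
        φ u * (Real.exp (u - u ^ 2 * Δ / 2) * (1 - u * Δ))) u := by
    intro u
    refine (hder u).mul ?_
    refine HasDerivAt.exp ?_
    have := (hasDerivAt_id u).sub ((((hasDerivAt_id u).pow 2).mul_const Δ).div_const 2)
    refine HasDerivAt.congr_deriv (f' := 1 - ((2 : ℕ) : ℝ) * id u ^ (2 - 1) * 1 * Δ / 2) this ?_
    simp only [id, Nat.cast_ofNat]; ring
  have hanti : AntitoneOn ψ (Set.Ici 0) := by
    refine antitoneOn_of_deriv_nonpos (convex_Ici 0)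
      (fun u _ => (hψd u).continuousAt.continuousWithinAt)
      (fun u _ => (hψd u).differentiableAt.differentiableWithinAt) ?_
    intro u hu
    rw [(hψd u).deriv]
    rw [interior_Ici] at hu
    have := hineq u (le_of_lt hu)
    have hexp := Real.exp_pos (u - u ^ 2 * Δ / 2)
    nlinarith [mul_le_mul_of_nonneg_right this hexp.le]
  have hψ0 : ψ 0 = 1 := by
    simp [hψ, hφ, Ex_one]
  set u : ℝ := 1 / (2 * Δ) with hu
  have hu0 : 0 ≤ u := by positivity
  have h2 : ψ u ≤ 1 := by
    rw [← hψ0]; exact hanti (Set.mem_Ici.2 le_rfl) (Set.mem_Ici.2 hu0) hu0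
  have h3 : φ u ≤ Real.exp (-u + u ^ 2 * Δ / 2) := by
    have : Real.exp (-u + u ^ 2 * Δ / 2) = (Real.exp (u - u ^ 2 * Δ / 2))⁻¹ := by
      rw [← Real.exp_neg]; ring_nf
    rw [this, ← one_div, le_div_iff₀ (Real.exp_pos _)]
    exact h2
  have h4 := Pr_markov (E := E) (p := p) h0.le h1
    (P := fun G => JX p T P Ei G ≤ 1 / 2)
    (f := fun G => Real.exp (-u * JX p T P Ei G)) (fun G => (Real.exp_pos _).le)
    (Real.exp_pos (-u * (1 / 2))) (fun G _ hG => Real.exp_le_exp.2 (by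
      have hG' : JX p T P Ei G ≤ 1 / 2 := hG
      nlinarith)) h3
  refine h4.trans ?_
  rw [← Real.exp_sub]
  apply Real.exp_le_exp.2
  rw [hu]
  apply le_of_eq
  field_simp
  ring

end Janson

end BC

open Finset

namespace BC

section Spread

variable {ι β : Type*} [DecidableEq β]
set_option linter.unusedSectionVars false

lemma sum_powerset_pow (X : Finset β) (c : ℝ) :
    ∑ W ∈ X.powerset, c ^ W.card = (1 + c) ^ X.card := by
  have := Finset.prod_one_add (s := X) (f := fun _ : β => c)
  simpa using this.symm

/-- Swap of summations used for all the spread-type estimates. -/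
lemma spread_swap (Q : Finset ι) (P : ι → ℝ) (R : ι → Finset β) (𝒲 : Finset (Finset β))
    (c : ℝ) :
    ∑ i ∈ Q, P i * ∑ W' ∈ 𝒲 with W' ⊆ R i, c ^ W'.card =
      ∑ W' ∈ 𝒲, c ^ W'.card * ∑ i ∈ Q with W' ⊆ R i, P i := by
  simp_rw [Finset.sum_filter, Finset.mul_sum]
  rw [Finset.sum_comm]
  refine Finset.sum_congr rfl fun W _ => Finset.sum_congr rfl fun i _ => ?_
  split_ifs <;> ring

lemma spread_sum {Q : Finset ι} {P : ι → ℝ} (hP : ∀ i ∈ Q, 0 ≤ P i) {R : ι → Finset β}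
    {C θ z : ℝ} (hz : 1 ≤ z)
    (h : ∀ W : Finset β, ∑ i ∈ Q with W ⊆ R i, P i ≤ C * θ ^ W.card)
    (hC : 0 ≤ C) (hθ : 0 ≤ θ) (W U : Finset β) :
    ∑ i ∈ Q with W ⊆ R i, P i * z ^ (R i ∩ U).card ≤
      C * (z * θ) ^ W.card * (1 + z * θ) ^ U.card := by
  have hz0 : 0 ≤ z := by linarith
  calc ∑ i ∈ Q with W ⊆ R i, P i * z ^ (R i ∩ U).card
      ≤ ∑ i ∈ Q with W ⊆ R i, z ^ W.card *
          (P i * ∑ W' ∈ (U \ W).powerset with W' ⊆ R i, z ^ W'.card) := by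
        refine Finset.sum_le_sum fun i hi => ?_
        rw [mul_left_comm]
        refine mul_le_mul_of_nonneg_left ?_ (hP i (Finset.mem_filter.1 hi).1)
        have h1 : (R i ∩ U).card ≤ W.card + (R i ∩ (U \ W)).card := by
          rw [← Nat.sub_le_iff_le_add']
          refine (Finset.le_card_sdiff W (R i ∩ U)).trans (Finset.card_le_card ?_)
          intro y; simp only [Finset.mem_sdiff, Finset.mem_inter]; tauto
        calc z ^ (R i ∩ U).card ≤ z ^ (W.card + (R i ∩ (U \ W)).card) :=
              pow_le_pow_right₀ hz h1
          _ = z ^ W.card * z ^ (R i ∩ (U \ W)).card := pow_add _ _ _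
          _ ≤ _ := by
            refine mul_le_mul_of_nonneg_left ?_ (by positivity)
            refine Finset.single_le_sum (f := fun W' : Finset β => z ^ W'.card)
              (fun _ _ => by positivity) ?_
            simp [Finset.inter_subset_left, Finset.inter_subset_right]
    _ = ∑ W' ∈ (U \ W).powerset, z ^ W.card * (z ^ W'.card *
          ∑ i ∈ (Q.filter fun i => W ⊆ R i) with W' ⊆ R i, P i) := by
        rw [← Finset.mul_sum, spread_swap, ← Finset.mul_sum]
    _ ≤ ∑ W' ∈ (U \ W).powerset, C * (z * θ) ^ W.card * (z * θ) ^ W'.card := by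
        refine Finset.sum_le_sum fun W' hW' => ?_
        have hd : Disjoint W W' := by
          rw [Finset.mem_powerset] at hW'
          exact (Finset.disjoint_sdiff).mono_right hW'
        have h2 := h (W ∪ W')
        rw [Finset.card_union_of_disjoint hd] at h2
        have h3 : ∑ i ∈ (Q.filter fun i => W ⊆ R i) with W' ⊆ R i, P i
            = ∑ i ∈ Q with W ∪ W' ⊆ R i, P i := by
          rw [Finset.filter_filter]
          simp_rw [Finset.union_subset_iff]
        rw [h3]
        calc z ^ W.card * (z ^ W'.card * ∑ i ∈ Q with W ∪ W' ⊆ R i, P i)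
            ≤ z ^ W.card * (z ^ W'.card * (C * θ ^ (W.card + W'.card))) := by gcongr
          _ = _ := by rw [pow_add, mul_pow, mul_pow]; ring
    _ = C * (z * θ) ^ W.card * (1 + z * θ) ^ (U \ W).card := by
        rw [← Finset.mul_sum, sum_powerset_pow]
    _ ≤ _ := by
        refine mul_le_mul_of_nonneg_left ?_ (by positivity)
        refine pow_le_pow_right₀ ?_ (Finset.card_le_card Finset.sdiff_subset)
        nlinarith [mul_nonneg hz0 hθ]

lemma spread_sum_ge {Q : Finset ι} {P : ι → ℝ} (hP : ∀ i ∈ Q, 0 ≤ P i) {R : ι → Finset β}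
    {C θ z : ℝ} (hz : 0 ≤ z)
    (h : ∀ W : Finset β, ∑ i ∈ Q with W ⊆ R i, P i ≤ C * θ ^ W.card)
    (U : Finset β) (m : ℕ) :
    ∑ i ∈ Q with m ≤ (R i ∩ U).card, P i * z ^ (R i ∩ U).card ≤
      C * ∑ W ∈ U.powerset with m ≤ W.card, (z * θ) ^ W.card := by
  calc ∑ i ∈ Q with m ≤ (R i ∩ U).card, P i * z ^ (R i ∩ U).card
      ≤ ∑ i ∈ Q with m ≤ (R i ∩ U).card, (P i * ∑ W' ∈ (U.powerset.filter fun W => m ≤ W.card)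
          with W' ⊆ R i, z ^ W'.card) := by
        refine Finset.sum_le_sum fun i hi => ?_
        refine mul_le_mul_of_nonneg_left ?_ (hP i (Finset.mem_filter.1 hi).1)
        refine Finset.single_le_sum (f := fun W' : Finset β => z ^ W'.card)
              (fun _ _ => by positivity) ?_
        simp [Finset.inter_subset_left, Finset.inter_subset_right, (Finset.mem_filter.1 hi).2]
    _ ≤ ∑ i ∈ Q, (P i * ∑ W' ∈ (U.powerset.filter fun W => m ≤ W.card)
          with W' ⊆ R i, z ^ W'.card) := by
        refine Finset.sum_le_sum_of_subset_of_nonneg (Finset.filter_subset _ _) fun i hi _ => ?_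
        exact mul_nonneg (hP i hi) (Finset.sum_nonneg fun _ _ => by positivity)
    _ = _ := spread_swap _ _ _ _ _
    _ ≤ ∑ W ∈ U.powerset with m ≤ W.card, z ^ W.card * (C * θ ^ W.card) := by
        refine Finset.sum_le_sum fun W _ => ?_
        exact mul_le_mul_of_nonneg_left (h W) (by positivity)
    _ = _ := by
        rw [Finset.mul_sum]
        exact Finset.sum_congr rfl fun W _ => by rw [mul_pow]; ring

lemma one_add_pow_le {x : ℝ} (hx : 0 ≤ x) {m : ℕ} (h : m * x ≤ 1 / 2) :
    (1 + x) ^ m ≤ 1 + 2 * (m * x) := by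
  have h0 : 0 ≤ m * x := by positivity
  have h1 : (1 + x) ^ m ≤ Real.exp (m * x) := by
    rw [Real.exp_nat_mul]
    refine pow_le_pow_left₀ (by linarith) ?_ m
    linarith [Real.add_one_le_exp x]
  have h2 := Real.abs_exp_sub_one_le (x := m * x) (by rw [abs_of_nonneg h0]; linarith)
  rw [abs_of_nonneg h0] at h2
  linarith [le_abs_self (Real.exp (m * x) - 1)]

lemma spread_sum_pos {Q : Finset ι} {P : ι → ℝ} (hP : ∀ i ∈ Q, 0 ≤ P i) {R : ι → Finset β}
    {C θ z : ℝ} (hz : 0 ≤ z) (hC : 0 ≤ C) (hθ : 0 ≤ θ)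
    (h : ∀ W : Finset β, ∑ i ∈ Q with W ⊆ R i, P i ≤ C * θ ^ W.card)
    (U : Finset β) (hU : U.card * (z * θ) ≤ 1 / 2) :
    ∑ i ∈ Q with 1 ≤ (R i ∩ U).card, P i * z ^ (R i ∩ U).card ≤
      C * (2 * (U.card * (z * θ))) := by
  refine (spread_sum_ge hP hz h U 1).trans (mul_le_mul_of_nonneg_left ?_ hC)
  have h1 := one_add_pow_le (mul_nonneg hz hθ) hU
  rw [← sum_powerset_pow] at h1
  have h2 : ∑ W ∈ U.powerset, (z * θ) ^ W.card =
      1 + ∑ W ∈ U.powerset with 1 ≤ W.card, (z * θ) ^ W.card := by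
    rw [← Finset.sum_filter_add_sum_filter_not _ (fun W : Finset β => 1 ≤ W.card), add_comm]
    congr 1
    have : U.powerset.filter (fun W => ¬ 1 ≤ W.card) = {∅} := by
      ext W
      simp only [Finset.mem_filter, Finset.mem_powerset, Finset.mem_singleton, not_le,
        Nat.lt_one_iff, Finset.card_eq_zero]
      exact ⟨fun h => h.2, fun h => by simp [h]⟩
    rw [this]; simp
  linarith

end Spread

section Tuples

variable {k n : ℕ}

/-- The vertices of `t` outside of the blocks `I`. -/
def rs (I : Finset (Fin k)) (t : Tup k n) : Finset (Vtx k n) := Iᶜ.image fun i => (i, t i)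

lemma mem_rs {I : Finset (Fin k)} {t : Tup k n} {y : Vtx k n} :
    y ∈ rs I t ↔ y.1 ∉ I ∧ t y.1 = y.2 := by
  unfold rs
  simp only [Finset.mem_image, Finset.mem_compl]
  constructor
  · rintro ⟨i, hi, rfl⟩; exact ⟨hi, rfl⟩
  · rintro ⟨h1, h2⟩; exact ⟨y.1, h1, by rw [h2]⟩

lemma card_rs (I : Finset (Fin k)) (t : Tup k n) : (rs I t).card = k - I.card := by
  unfold rs
  rw [Finset.card_image_of_injective _ (fun a b h => (Prod.mk.inj h).1), Finset.card_compl,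
    Fintype.card_fin]

/-- Complete bipartite graph between `A` and `R`. -/
def Ed (A R : Finset (Vtx k n)) : Finset (Sym2 (Vtx k n)) :=
  (A ×ˢ R).image fun xy => s(xy.1, xy.2)

lemma mem_Ed {A R : Finset (Vtx k n)} {e : Sym2 (Vtx k n)} :
    e ∈ Ed A R ↔ ∃ x ∈ A, ∃ y ∈ R, s(x, y) = e := by
  unfold Ed
  simp only [Finset.mem_image, Finset.mem_product]
  constructor
  · rintro ⟨⟨x, y⟩, ⟨hx, hy⟩, h⟩; exact ⟨x, hx, y, hy, h⟩
  · rintro ⟨x, hx, y, hy, h⟩; exact ⟨(x, y), ⟨hx, hy⟩, h⟩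

lemma card_Ed_le (A R : Finset (Vtx k n)) : (Ed A R).card ≤ A.card * R.card := by
  unfold Ed
  exact Finset.card_image_le.trans (by rw [Finset.card_product])

lemma card_Ed {A R : Finset (Vtx k n)} (h : Disjoint A R) :
    (Ed A R).card = A.card * R.card := by
  unfold Ed
  rw [Finset.card_image_of_injOn, Finset.card_product]
  rintro ⟨x, y⟩ hx ⟨x', y'⟩ hx' he
  simp only [Finset.coe_product, Set.mem_prod, Finset.mem_coe] at hx hx'
  simp only [Sym2.eq_iff] at he
  rcases he with ⟨rfl, rfl⟩ | ⟨rfl, rfl⟩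
  · rfl
  · exact absurd hx'.2 (Finset.disjoint_left.1 h hx.1)

lemma mem_potEdges {x y : Vtx k n} : s(x, y) ∈ potEdges k n ↔ x.1 ≠ y.1 := by
  simp [potEdges]

lemma Ed_subset_pot {A : Finset (Vtx k n)} {I : Finset (Fin k)} (hA : ∀ x ∈ A, x.1 ∈ I)
    (t : Tup k n) : Ed A (rs I t) ⊆ potEdges k n := by
  intro e he
  obtain ⟨x, hx, y, hy, rfl⟩ := mem_Ed.1 he
  rw [mem_potEdges]
  intro h
  exact (mem_rs.1 hy).1 (h ▸ hA x hx)

lemma disjoint_rs {A : Finset (Vtx k n)} {I : Finset (Fin k)} (hA : ∀ x ∈ A, x.1 ∈ I)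
    (t : Tup k n) : Disjoint A (rs I t) :=
  Finset.disjoint_left.2 fun x hx hx' => (mem_rs.1 hx').1 (hA x hx)

lemma card_Ed_rs {A : Finset (Vtx k n)} {I : Finset (Fin k)} (hA : ∀ x ∈ A, x.1 ∈ I)
    (t : Tup k n) : (Ed A (rs I t)).card = A.card * (k - I.card) := by
  rw [card_Ed (disjoint_rs hA t), card_rs]

/-- `Q` is `θ`-spread outside of the blocks `I`. -/
def Spread (θ : ℝ) (Q : Finset (Tup k n)) (I : Finset (Fin k)) : Prop :=
  ∀ W : Finset (Vtx k n), ((Q.filter fun t => W ⊆ rs I t).card : ℝ) ≤ θ ^ W.card * Q.card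

lemma Spread.weights {θ : ℝ} {Q : Finset (Tup k n)} {I : Finset (Fin k)} (h : Spread θ Q I)
    (hQ : Q.Nonempty) (W : Finset (Vtx k n)) :
    ∑ t ∈ Q with W ⊆ rs I t, ((Q.card : ℝ))⁻¹ ≤ 1 * θ ^ W.card := by
  have hc : (0 : ℝ) < Q.card := by exact_mod_cast hQ.card_pos
  rw [Finset.sum_const, nsmul_eq_mul, one_mul, ← div_eq_mul_inv, div_le_iff₀ hc]
  exact h W

/-- Normalised count of the tuples of `Q` containing `W` and joined to `A`. -/
noncomputable def Xc (p : ℝ) (A : Finset (Vtx k n)) (I : Finset (Fin k)) (Q : Finset (Tup k n))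
    (W : Finset (Vtx k n)) (G : Finset (Sym2 (Vtx k n))) : ℝ :=
  JX p (Q.filter fun t => W ⊆ rs I t) (fun _ => ((Q.card : ℝ))⁻¹) (fun t => Ed A (rs I t)) G

lemma Xc_nonneg {p : ℝ} (h0 : 0 ≤ p) (A : Finset (Vtx k n)) (I : Finset (Fin k))
    (Q : Finset (Tup k n)) (W : Finset (Vtx k n)) (G : Finset (Sym2 (Vtx k n))) :
    0 ≤ Xc p A I Q W G := JX_nonneg h0 (fun _ _ => by positivity) _ _

/-- The vertices joined by `F` to a vertex of `A`. -/
def Ub (A : Finset (Vtx k n)) (F : Finset (Sym2 (Vtx k n))) : Finset (Vtx k n) :=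
  Finset.univ.filter fun y => ∃ x ∈ A, s(x, y) ∈ F

lemma moment_aux {ι : Type*} [DecidableEq ι] {p θ z : ℝ} (hp0 : 0 < p) (hp1 : p ≤ 1)
    (hz : 1 ≤ z) (hθ : 0 ≤ θ) {r : ℕ}
    (A : ι → Finset (Vtx k n)) (I : ι → Finset (Fin k)) (Q : ι → Finset (Tup k n))
    (W : ι → Finset (Vtx k n)) (B : Finset (Vtx k n))
    (hAI : ∀ i, ∀ x ∈ A i, x.1 ∈ I i) (hAd : ∀ i j, i ≠ j → Disjoint (A i) (A j))
    (hAB : ∀ i, A i ⊆ B) (hQ : ∀ i, (Q i).Nonempty) (hS : ∀ i, Spread θ (Q i) (I i))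
    (hzA : ∀ i, (p ^ (A i).card)⁻¹ ≤ z)
    (hsmall : ((B.card + k * r : ℕ) : ℝ) * (z * θ) ≤ 1 / 2)
    (T : Finset (ι × Fin r)) :
    ∀ F : Finset (Sym2 (Vtx k n)), F ⊆ potEdges k n →
      (∀ i, (Ub (A i) F \ B).card + k * (T.filter fun a => a.1 = i).card ≤ k * r) →
      Ex (potEdges k n) p (fun G => ind F G * ∏ a ∈ T, Xc p (A a.1) (I a.1) (Q a.1) (W a.1) G) ≤
        p ^ F.card * ∏ a ∈ T, (2 * (z * θ) ^ (W a.1).card) := by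
  have hz0 : 0 ≤ z := by linarith
  induction T using Finset.induction_on with
  | empty =>
    intro F hF _
    simp [Ex_ind_one hF]
  | insert a T ha ih =>
    intro F hF hU
    obtain ⟨i, l⟩ := a
    set b' := ∏ a ∈ T, (2 * (z * θ) ^ (W a.1).card) with hb'
    have hb0 : 0 ≤ b' := Finset.prod_nonneg fun _ _ => by positivity
    set Ei : Tup k n → Finset (Sym2 (Vtx k n)) := fun t => Ed (A i) (rs (I i) t) with hEi
    have e1 : Ex (potEdges k n) p (fun G => ind F G *
        ∏ a ∈ insert (i, l) T, Xc p (A a.1) (I a.1) (Q a.1) (W a.1) G) =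
        ∑ t ∈ (Q i) with W i ⊆ rs (I i) t, ((Q i).card : ℝ)⁻¹ * (p ^ (Ei t).card)⁻¹ *
          Ex (potEdges k n) p (fun G => ind (F ∪ Ei t) G *
            ∏ a ∈ T, Xc p (A a.1) (I a.1) (Q a.1) (W a.1) G) := by
      simp_rw [← Ex_mul]
      rw [← Ex_sum]
      refine Ex_congr fun G _ => ?_
      rw [Finset.prod_insert ha]
      have hgen : ∀ c : ℝ, ind F G * (Xc p (A i) (I i) (Q i) (W i) G * c) =
          ∑ t ∈ (Q i) with W i ⊆ rs (I i) t, ((Q i).card : ℝ)⁻¹ * (p ^ (Ei t).card)⁻¹ *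
            (ind (F ∪ Ei t) G * c) := by
        intro c
        rw [Xc, JX, Finset.sum_mul, Finset.mul_sum]
        refine Finset.sum_congr rfl fun t _ => ?_
        rw [ind_union]; ring
      exact hgen _
    have hcase : ∀ t : Tup k n, ∀ j, Ub (A j) (F ∪ Ei t) \ B ⊆
        (Ub (A j) F \ B) ∪ (if j = i then rs (I i) t else ∅) := by
      intro t j y hy
      simp only [Ub, Finset.mem_sdiff, Finset.mem_filter, Finset.mem_univ, true_and,
        Finset.mem_union] at hy ⊢
      obtain ⟨⟨x, hx, hxy⟩, hyB⟩ := hy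
      rcases hxy with hxy | hxy
      · exact Or.inl ⟨⟨x, hx, hxy⟩, hyB⟩
      · right
        obtain ⟨x', hx', y', hy', he⟩ := mem_Ed.1 hxy
        rw [Sym2.eq_iff] at he
        rcases he with ⟨rfl, rfl⟩ | ⟨rfl, rfl⟩
        · have hji : j = i := by
            by_contra hne
            exact Finset.disjoint_left.1 (hAd j i hne) hx hx'
          simpa [hji] using hy'
        · exact absurd (hAB i hx') hyB
    have e2 : ∀ t ∈ (Q i).filter (fun t => W i ⊆ rs (I i) t),
        ((Q i).card : ℝ)⁻¹ * (p ^ (Ei t).card)⁻¹ *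
          Ex (potEdges k n) p (fun G => ind (F ∪ Ei t) G *
            ∏ a ∈ T, Xc p (A a.1) (I a.1) (Q a.1) (W a.1) G) ≤
        p ^ F.card * b' * (((Q i).card : ℝ)⁻¹ * z ^ (rs (I i) t ∩ Ub (A i) F).card) := by
      intro t ht
      have hsub : Ei t ⊆ potEdges k n := Ed_subset_pot (hAI i) t
      have h3 := ih (F ∪ Ei t) (Finset.union_subset hF hsub) (by
        intro j
        have h4 := Finset.card_le_card (hcase t j)
        have h5 := hU j
        rw [Finset.filter_insert] at h5
        by_cases hj : j = i
        · subst hj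
          simp only [if_true] at h4 h5
          rw [Finset.card_insert_of_notMem (by simp [ha])] at h5
          have h6 := Finset.card_union_le (Ub (A j) F \ B) (rs (I j) t)
          have h7 : (rs (I j) t).card ≤ k := by rw [card_rs]; omega
          rw [mul_add] at h5
          omega
        · have hj' : ¬ (i = j) := fun h => hj h.symm
          simp only [hj, hj', if_false, Finset.union_empty] at h4 h5
          omega)
      have h8 : (Ei t ∩ F).card ≤ (A i).card * (rs (I i) t ∩ Ub (A i) F).card := by
        refine le_trans (Finset.card_le_card ?_) (card_Ed_le _ _)
        intro e he
        rw [Finset.mem_inter] at he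
        obtain ⟨x, hx, y, hy, rfl⟩ := mem_Ed.1 he.1
        refine mem_Ed.2 ⟨x, hx, y, ?_, rfl⟩
        simp only [Ub, Finset.mem_inter, Finset.mem_filter, Finset.mem_univ, true_and]
        exact ⟨hy, x, hx, he.2⟩
      have h9 : (p ^ (Ei t ∩ F).card)⁻¹ ≤ z ^ (rs (I i) t ∩ Ub (A i) F).card := by
        calc (p ^ (Ei t ∩ F).card)⁻¹ ≤ (p ^ ((A i).card * (rs (I i) t ∩ Ub (A i) F).card))⁻¹ := by
              refine inv_anti₀ (by positivity) (pow_le_pow_of_le_one hp0.le hp1 h8)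
          _ = ((p ^ (A i).card)⁻¹) ^ (rs (I i) t ∩ Ub (A i) F).card := by
              rw [pow_mul, inv_pow]
          _ ≤ _ := pow_le_pow_left₀ (by positivity) (hzA i) _
      have hc := Finset.card_union_add_card_inter F (Ei t)
      rw [Finset.inter_comm] at hc
      have h10 : p ^ (F ∪ Ei t).card = p ^ F.card * p ^ (Ei t).card * (p ^ (Ei t ∩ F).card)⁻¹ := by
        rw [eq_mul_inv_iff_mul_eq₀ (by positivity), ← pow_add, ← pow_add, hc]
      calc ((Q i).card : ℝ)⁻¹ * (p ^ (Ei t).card)⁻¹ *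
          Ex (potEdges k n) p (fun G => ind (F ∪ Ei t) G *
            ∏ a ∈ T, Xc p (A a.1) (I a.1) (Q a.1) (W a.1) G)
          ≤ ((Q i).card : ℝ)⁻¹ * (p ^ (Ei t).card)⁻¹ * (p ^ (F ∪ Ei t).card * b') :=
            mul_le_mul_of_nonneg_left h3 (by positivity)
        _ = p ^ F.card * b' * (((Q i).card : ℝ)⁻¹ * (p ^ (Ei t ∩ F).card)⁻¹) := by
            rw [h10]; field_simp
        _ ≤ _ := by gcongr
    rw [e1]
    refine (Finset.sum_le_sum e2).trans ?_
    rw [← Finset.mul_sum, Finset.prod_insert ha, mul_assoc, mul_comm b']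
    refine mul_le_mul_of_nonneg_left (mul_le_mul_of_nonneg_right ?_ hb0) (by positivity)
    have h11 := spread_sum (Q := Q i) (P := fun _ => ((Q i).card : ℝ)⁻¹)
      (fun _ _ => by positivity) (R := fun t => rs (I i) t) hz ((hS i).weights (hQ i))
      zero_le_one hθ (W i) (Ub (A i) F)
    refine h11.trans ?_
    rw [one_mul, mul_comm]
    refine mul_le_mul_of_nonneg_right ?_ (by positivity)
    have hUc : (Ub (A i) F).card ≤ B.card + k * r := by
      have h12 := hU i
      have h13 : (Ub (A i) F).card ≤ (Ub (A i) F \ B).card + B.card :=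
        Finset.card_le_card_sdiff_add_card
      have : (Ub (A i) F \ B).card ≤ k * r := le_trans (Nat.le_add_right _ _) h12
      omega
    calc (1 + z * θ) ^ (Ub (A i) F).card ≤ (1 + z * θ) ^ (B.card + k * r) :=
          pow_le_pow_right₀ (by nlinarith [mul_nonneg hz0 hθ]) hUc
      _ ≤ 1 + 2 * (((B.card + k * r : ℕ) : ℝ) * (z * θ)) :=
          one_add_pow_le (mul_nonneg hz0 hθ) hsmall
      _ ≤ 2 := by linarith

/-- Moment bound: simultaneous upper deviations of `M` vertex-disjoint bundles. -/
lemma moment_bound {ι : Type*} [DecidableEq ι] [Fintype ι] {p θ z : ℝ} (hp0 : 0 < p)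
    (hp1 : p ≤ 1) (hz : 1 ≤ z) (hθ : 0 < θ) {r : ℕ}
    (A : ι → Finset (Vtx k n)) (I : ι → Finset (Fin k)) (Q : ι → Finset (Tup k n))
    (W : ι → Finset (Vtx k n)) (B : Finset (Vtx k n))
    (hAI : ∀ i, ∀ x ∈ A i, x.1 ∈ I i) (hAd : ∀ i j, i ≠ j → Disjoint (A i) (A j))
    (hAB : ∀ i, A i ⊆ B) (hQ : ∀ i, (Q i).Nonempty) (hS : ∀ i, Spread θ (Q i) (I i))
    (hzA : ∀ i, (p ^ (A i).card)⁻¹ ≤ z)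
    (hsmall : ((B.card + k * r : ℕ) : ℝ) * (z * θ) ≤ 1 / 2) :
    Pr (potEdges k n) p (fun G => ∀ i, 4 * (z * θ) ^ (W i).card < Xc p (A i) (I i) (Q i) (W i) G)
      ≤ (1 / 2) ^ (r * Fintype.card ι) := by
  have hz0 : 0 < z := by linarith
  have h := moment_aux hp0 hp1 hz hθ.le A I Q W B hAI hAd hAB hQ hS hzA hsmall Finset.univ ∅
    (Finset.empty_subset _) (by
      intro i
      have h1 : Ub (A i) ∅ = ∅ := by ext y; simp [Ub]
      have h2 : ((Finset.univ : Finset (ι × Fin r)).filter fun a => a.1 = i).card = r := by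
        have : ((Finset.univ : Finset (ι × Fin r)).filter fun a => a.1 = i)
            = ({i} : Finset ι) ×ˢ (Finset.univ : Finset (Fin r)) := by
          ext ⟨a, b⟩; simp [eq_comm]
        rw [this, Finset.card_product]; simp
      rw [h1, h2]; simp)
  simp only [Finset.card_empty, pow_zero, one_mul] at h
  have hi : ∀ G : Finset (Sym2 (Vtx k n)), ind ∅ G = 1 := fun G => by simp [ind]
  simp only [hi, one_mul] at h
  have hM := Pr_markov (E := potEdges k n) hp0.le hp1
    (P := fun G => ∀ i, 4 * (z * θ) ^ (W i).card < Xc p (A i) (I i) (Q i) (W i) G)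
    (f := fun G => ∏ a : ι × Fin r, Xc p (A a.1) (I a.1) (Q a.1) (W a.1) G)
    (fun G => Finset.prod_nonneg fun a _ => Xc_nonneg hp0.le _ _ _ _ _)
    (c := ∏ a : ι × Fin r, (4 * (z * θ) ^ (W a.1).card))
    (Finset.prod_pos fun a _ => by positivity)
    (fun G _ hG => Finset.prod_le_prod (fun _ _ => by positivity) fun a _ => (hG a.1).le) h
  refine hM.trans (le_of_eq ?_)
  rw [← Finset.prod_div_distrib]
  have : ∀ a : ι × Fin r, 2 * (z * θ) ^ (W a.1).card / (4 * (z * θ) ^ (W a.1).card) = 1 / 2 := by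
    intro a
    have : (z * θ) ^ (W a.1).card ≠ 0 := by positivity
    field_simp; norm_num
  simp only [this, Finset.prod_const, Finset.card_univ, Fintype.card_prod, Fintype.card_fin]
  rw [mul_comm]

end Tuples
end BC

open Finset

namespace BC

section Partition

variable {k n : ℕ}

/-- A decomposition of most of `S` into spread parts. -/
structure IsPart (θ : ℝ) (S : Finset (Tup k n)) (I : Finset (Fin k))
    (𝒬 : Finset (Finset (Tup k n) × Finset (Vtx k n))) : Prop where
  sub : ∀ a ∈ 𝒬, a.1 ⊆ S
  ne : ∀ a ∈ 𝒬, a.1.Nonempty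
  fix : ∀ a ∈ 𝒬, ∀ t ∈ a.1, a.2 ⊆ rs I t
  spread : ∀ a ∈ 𝒬, Spread θ a.1 (I ∪ a.2.image Prod.fst)
  size : ∀ a ∈ 𝒬, θ ^ a.2.card * S.card ≤ 2 * a.1.card
  disj : ∀ a ∈ 𝒬, ∀ b ∈ 𝒬, a ≠ b → Disjoint a.1 b.1
  total : (S.card : ℝ) ≤ 2 * ∑ a ∈ 𝒬, (a.1.card : ℝ)

lemma exists_part_aux {θ : ℝ} (hθ : 0 < θ) (I : Finset (Fin k)) (c : ℝ) (hc : 0 ≤ c) (m : ℕ) :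
    ∀ T : Finset (Tup k n), T.card = m →
    ∃ 𝒬 : Finset (Finset (Tup k n) × Finset (Vtx k n)),
      (∀ a ∈ 𝒬, a.1 ⊆ T) ∧ (∀ a ∈ 𝒬, a.1.Nonempty) ∧ (∀ a ∈ 𝒬, ∀ t ∈ a.1, a.2 ⊆ rs I t) ∧
      (∀ a ∈ 𝒬, Spread θ a.1 (I ∪ a.2.image Prod.fst)) ∧
      (∀ a ∈ 𝒬, θ ^ a.2.card * c ≤ 2 * a.1.card) ∧
      (∀ a ∈ 𝒬, ∀ b ∈ 𝒬, a ≠ b → Disjoint a.1 b.1) ∧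
      2 * (T.card : ℝ) ≤ c + 2 * ∑ a ∈ 𝒬, (a.1.card : ℝ) := by
  induction m using Nat.strong_induction_on with
  | _ m ih =>
  intro T hT
  by_cases hsm : 2 * (T.card : ℝ) ≤ c
  · exact ⟨∅, by simp, by simp, by simp, by simp, by simp, by simp, by simpa using hsm⟩
  push Not at hsm
  have hTpos : (0 : ℝ) < T.card := by linarith
  set tw : Finset (Vtx k n) → Finset (Tup k n) := fun W => T.filter fun t => W ⊆ rs I t with htw
  obtain ⟨W, hW, hmax⟩ := Finset.exists_max_image
    ((Finset.univ : Finset (Finset (Vtx k n))).filter fun W => θ ^ W.card * T.card ≤ (tw W).card)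
    Finset.card ⟨∅, by simp [htw]⟩
  rw [Finset.mem_filter] at hW
  have hWge := hW.2
  have hne : (tw W).Nonempty := by
    rw [← Finset.card_pos]
    have : (0 : ℝ) < (tw W).card := lt_of_lt_of_le (by positivity) hWge
    exact_mod_cast this
  have hlt : (T \ tw W).card < m := by
    rw [← hT]
    exact Finset.card_lt_card (Finset.sdiff_ssubset (Finset.filter_subset _ _) hne)
  obtain ⟨𝒬, h1, h2, h3, h4, h5, h6, h7⟩ := ih _ hlt (T \ tw W) rfl
  have hdis : ∀ a ∈ 𝒬, Disjoint a.1 (tw W) := fun a ha =>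
    (Finset.sdiff_disjoint).mono_left (h1 a ha)
  have hnotin : (tw W, W) ∉ 𝒬 := by
    intro h
    have := hdis _ h
    rw [disjoint_self] at this
    exact hne.ne_empty this
  refine ⟨insert (tw W, W) 𝒬, ?_, ?_, ?_, ?_, ?_, ?_, ?_⟩
  · intro a ha
    rcases Finset.mem_insert.1 ha with rfl | ha
    · exact Finset.filter_subset _ _
    · exact (h1 a ha).trans Finset.sdiff_subset
  · intro a ha
    rcases Finset.mem_insert.1 ha with rfl | ha
    · exact hne
    · exact h2 a ha
  · intro a ha
    rcases Finset.mem_insert.1 ha with rfl | ha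
    · exact fun t ht => (Finset.mem_filter.1 ht).2
    · exact h3 a ha
  · intro a ha
    rcases Finset.mem_insert.1 ha with rfl | ha
    · intro W'
      simp only
      rcases Finset.eq_empty_or_nonempty W' with rfl | hW'
      · simp
      rcases Finset.eq_empty_or_nonempty ((tw W).filter fun t => W' ⊆ rs (I ∪ W.image Prod.fst) t)
        with hemp | ⟨t0, ht0⟩
      · rw [hemp]; simp; positivity
      have hd : Disjoint W W' := by
        rw [Finset.disjoint_left]
        intro x hx hx'
        have := (mem_rs.1 ((Finset.mem_filter.1 ht0).2 hx')).1
        exact this (Finset.mem_union_right _ (Finset.mem_image_of_mem _ hx))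
      have hlt2 : ((tw (W ∪ W')).card : ℝ) < θ ^ (W ∪ W').card * T.card := by
        by_contra hcon
        push Not at hcon
        have := hmax (W ∪ W') (by simp [hcon])
        rw [Finset.card_union_of_disjoint hd] at this
        have := hW'.card_pos
        omega
      have hsub : (tw W).filter (fun t => W' ⊆ rs (I ∪ W.image Prod.fst) t) ⊆ tw (W ∪ W') := by
        intro t ht
        simp only [htw, Finset.mem_filter] at ht ⊢
        refine ⟨ht.1.1, Finset.union_subset ht.1.2 fun y hy => ?_⟩
        have := mem_rs.1 (ht.2 hy)
        exact mem_rs.2 ⟨fun h => this.1 (Finset.mem_union_left _ h), this.2⟩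
      have hcs : (((tw W).filter (fun t => W' ⊆ rs (I ∪ W.image Prod.fst) t)).card : ℝ) ≤
          (tw (W ∪ W')).card := by exact_mod_cast Finset.card_le_card hsub
      rw [Finset.card_union_of_disjoint hd, pow_add] at hlt2
      calc _ ≤ _ := hcs
        _ ≤ θ ^ W'.card * (θ ^ W.card * T.card) := by linarith
        _ ≤ _ := by gcongr
    · exact h4 a ha
  · intro a ha
    rcases Finset.mem_insert.1 ha with rfl | ha
    · simp only
      have : 0 < θ ^ W.card := by positivity
      nlinarith
    · exact h5 a ha
  · intro a ha b hb hab
    rcases Finset.mem_insert.1 ha with rfl | ha <;> rcases Finset.mem_insert.1 hb with rfl | hb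
    · exact absurd rfl hab
    · exact (hdis b hb).symm
    · exact hdis a ha
    · exact h6 a ha b hb hab
  · rw [Finset.sum_insert hnotin]
    have hcard : (T.card : ℝ) = (T \ tw W).card + (tw W).card := by
      have := Finset.card_sdiff_add_card_eq_card (Finset.filter_subset (fun t => W ⊆ rs I t) T)
      exact_mod_cast this.symm
    simp only
    linarith

lemma exists_part {θ : ℝ} (hθ : 0 < θ) (S : Finset (Tup k n)) (I : Finset (Fin k)) :
    ∃ 𝒬, IsPart θ S I 𝒬 := by
  obtain ⟨𝒬, h1, h2, h3, h4, h5, h6, h7⟩ :=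
    exists_part_aux hθ I (S.card : ℝ) (by positivity) S.card S rfl
  exact ⟨𝒬, h1, h2, h3, h4, h5, h6, by linarith⟩

open Classical in
/-- A canonical decomposition. -/
noncomputable def parts (θ : ℝ) (S : Finset (Tup k n)) (I : Finset (Fin k)) :
    Finset (Finset (Tup k n) × Finset (Vtx k n)) :=
  if h : ∃ 𝒬, IsPart θ S I 𝒬 then h.choose else ∅

lemma parts_spec {θ : ℝ} (hθ : 0 < θ) (S : Finset (Tup k n)) (I : Finset (Fin k)) :
    IsPart θ S I (parts θ S I) := by
  unfold parts
  rw [dif_pos (exists_part hθ S I)]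
  exact (exists_part hθ S I).choose_spec

variable {θ : ℝ} {S : Finset (Tup k n)} {I : Finset (Fin k)}
  {𝒬 : Finset (Finset (Tup k n) × Finset (Vtx k n))}

lemma IsPart.sum_filter (h : IsPart θ S I 𝒬) (W : Finset (Vtx k n)) :
    ∑ a ∈ 𝒬 with W ⊆ a.2, (a.1.card : ℝ) ≤ ((S.filter fun t => W ⊆ rs I t).card : ℝ) := by
  have h1 : ((𝒬.filter fun a => W ⊆ a.2).biUnion Prod.fst).card =
      ∑ a ∈ 𝒬 with W ⊆ a.2, a.1.card := by
    refine Finset.card_biUnion ?_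
    intro a ha b hb hab
    exact h.disj a (Finset.mem_filter.1 ha).1 b (Finset.mem_filter.1 hb).1 hab
  have h2 : ((𝒬.filter fun a => W ⊆ a.2).biUnion Prod.fst) ⊆ S.filter fun t => W ⊆ rs I t := by
    intro t ht
    obtain ⟨a, ha, hta⟩ := Finset.mem_biUnion.1 ht
    rw [Finset.mem_filter] at ha
    exact Finset.mem_filter.2 ⟨h.sub a ha.1 hta, ha.2.trans (h.fix a ha.1 t hta)⟩
  have := Finset.card_le_card h2
  rw [h1] at this
  exact_mod_cast this

lemma IsPart.card_le (h : IsPart θ S I 𝒬) : 𝒬.card ≤ n ^ k := by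
  have h1 : (𝒬.card : ℝ) ≤ ∑ a ∈ 𝒬 with ∅ ⊆ a.2, (a.1.card : ℝ) := by
    rw [Finset.filter_true_of_mem (fun _ _ => Finset.empty_subset _)]
    calc (𝒬.card : ℝ) = ∑ a ∈ 𝒬, 1 := by simp
      _ ≤ _ := Finset.sum_le_sum fun a ha => by exact_mod_cast (h.ne a ha).card_pos
  have h2 := h.sum_filter ∅
  have h3 : ((S.filter fun t => ∅ ⊆ rs I t).card : ℝ) ≤ (n ^ k : ℕ) := by
    have : (S.filter fun t => ∅ ⊆ rs I t).card ≤ Fintype.card (Tup k n) := Finset.card_le_univ _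
    simp only [Fintype.card_fun, Fintype.card_fin] at this
    exact_mod_cast this
  exact_mod_cast h1.trans (h2.trans h3)

lemma IsPart.off (h : IsPart θ S I 𝒬) {a} (ha : a ∈ 𝒬) : ∀ x ∈ a.2, x.1 ∉ I := by
  obtain ⟨t, ht⟩ := h.ne a ha
  exact fun x hx => (mem_rs.1 (h.fix a ha t ht hx)).1

lemma IsPart.inj (h : IsPart θ S I 𝒬) {a} (ha : a ∈ 𝒬) :
    ∀ x ∈ a.2, ∀ y ∈ a.2, x.1 = y.1 → x = y := by
  obtain ⟨t, ht⟩ := h.ne a ha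
  intro x hx y hy hxy
  have h1 := (mem_rs.1 (h.fix a ha t ht hx)).2
  have h2 := (mem_rs.1 (h.fix a ha t ht hy)).2
  exact Prod.ext hxy (by rw [← h1, ← h2, hxy])

lemma IsPart.card_blocks (h : IsPart θ S I 𝒬) {a} (ha : a ∈ 𝒬) :
    (I ∪ a.2.image Prod.fst).card = I.card + a.2.card := by
  rw [Finset.card_union_of_disjoint, Finset.card_image_of_injOn]
  · exact fun x hx y hy hxy => h.inj ha x hx y hy hxy
  · rw [Finset.disjoint_right]
    intro i hi
    obtain ⟨x, hx, rfl⟩ := Finset.mem_image.1 hi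
    exact h.off ha x hx

end Partition
end BC

open Finset

namespace BC

section Tails

variable {k n : ℕ}

lemma inv_pow_le {p z : ℝ} (hp0 : 0 < p) (hp1 : p ≤ 1) {s a : ℕ} (hz : (p ^ s)⁻¹ ≤ z)
    (ha : a ≤ s) : (p ^ a)⁻¹ ≤ z :=
  (inv_anti₀ (by positivity) (pow_le_pow_of_le_one hp0.le hp1 ha)).trans hz

lemma inv_pow_mul_le {p z : ℝ} (hp0 : 0 < p) (hp1 : p ≤ 1) {s e m : ℕ} (hz : (p ^ s)⁻¹ ≤ z)
    (he : e ≤ s * m) : (p ^ e)⁻¹ ≤ z ^ m := by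
  calc (p ^ e)⁻¹ ≤ (p ^ (s * m))⁻¹ :=
        inv_anti₀ (by positivity) (pow_le_pow_of_le_one hp0.le hp1 he)
    _ = ((p ^ s)⁻¹) ^ m := by rw [pow_mul, inv_pow]
    _ ≤ _ := pow_le_pow_left₀ (by positivity) hz _

set_option maxHeartbeats 1000000 in
/-- Simultaneous lower deviations of vertex-disjoint bundles. -/
lemma lower_tail {ι : Type*} [DecidableEq ι] [Fintype ι] [Nonempty ι] {p θ z : ℝ} (hp0 : 0 < p)
    (hp1 : p ≤ 1) (hz1 : 1 ≤ z) (hθ : 0 < θ) {s : ℕ}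
    (A : ι → Finset (Vtx k n)) (I : ι → Finset (Fin k)) (Q : ι → Finset (Tup k n))
    (hAI : ∀ i, ∀ x ∈ A i, x.1 ∈ I i) (hAd : ∀ i j, i ≠ j → Disjoint (A i) (A j))
    (hQ : ∀ i, (Q i).Nonempty) (hS : ∀ i, Spread θ (Q i) (I i))
    (hz : (p ^ s)⁻¹ ≤ z) (hAs : ∀ i, (A i).card ≤ s)
    (hk : k * (z * θ) ≤ 1 / 2) (hs : s * (z * θ) ≤ 1 / 2) {Δ : ℝ} (hΔ0 : 0 < Δ)
    (hΔ : 2 * (k * (z * θ)) / Fintype.card ι + (2 * (s * (z * θ))) ^ 2 ≤ Δ) :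
    Pr (potEdges k n) p (fun G => ∀ i, Xc p (A i) (I i) (Q i) ∅ G ≤ 1 / 2)
      ≤ Real.exp (-(1 / (8 * Δ))) := by
  classical
  have hz0 : 0 < z := by linarith
  set M : ℝ := ((Fintype.card ι : ℕ) : ℝ) with hM
  have hM0 : 0 < M := by rw [hM]; exact_mod_cast Fintype.card_pos
  set T : Finset (Σ _ : ι, Tup k n) := Finset.univ.sigma Q with hT
  set P : (Σ _ : ι, Tup k n) → ℝ := fun a => M⁻¹ * ((Q a.1).card : ℝ)⁻¹ with hP
  set Ei : (Σ _ : ι, Tup k n) → Finset (Sym2 (Vtx k n)) :=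
    fun a => Ed (A a.1) (rs (I a.1) a.2) with hEi
  have hc : ∀ i, (0 : ℝ) < (Q i).card := fun i => by exact_mod_cast (hQ i).card_pos
  have hJX : ∀ G, JX p T P Ei G = M⁻¹ * ∑ i, Xc p (A i) (I i) (Q i) ∅ G := by
    intro G
    unfold JX
    rw [hT, Finset.sum_sigma, Finset.mul_sum]
    refine Finset.sum_congr rfl fun i _ => ?_
    unfold Xc JX
    rw [Finset.filter_true_of_mem (fun _ _ => Finset.empty_subset _), Finset.mul_sum]
    refine Finset.sum_congr rfl fun t _ => ?_
    simp only [hP, hEi]; ring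
  have hPs : ∑ a ∈ T, P a = 1 := by
    rw [hT, Finset.sum_sigma]
    have : ∀ i : ι, ∑ t ∈ Q i, P ⟨i, t⟩ = M⁻¹ := by
      intro i
      simp only [hP, Finset.sum_const, nsmul_eq_mul]
      have := hc i
      field_simp
    simp only [this, Finset.sum_const, nsmul_eq_mul, Finset.card_univ]
    rw [← hM]; field_simp
  have hmono : Pr (potEdges k n) p (fun G => ∀ i, Xc p (A i) (I i) (Q i) ∅ G ≤ 1 / 2) ≤
      Pr (potEdges k n) p (fun G => JX p T P Ei G ≤ 1 / 2) := by
    refine Pr_mono hp0.le hp1 fun G _ hG => ?_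
    rw [hJX]
    have : ∑ i, Xc p (A i) (I i) (Q i) ∅ G ≤ ∑ i : ι, (1 / 2 : ℝ) :=
      Finset.sum_le_sum fun i _ => hG i
    simp only [Finset.sum_const, nsmul_eq_mul, Finset.card_univ] at this
    rw [← hM] at this
    rw [inv_mul_le_iff₀ hM0]; exact this
  refine hmono.trans (janson hp0 hp1 T P (fun a _ => by simp only [hP]; positivity) hPs Ei
    (fun a _ => Ed_subset_pot (hAI a.1) a.2) hΔ0 ?_)
  refine le_trans ?_ hΔ
  -- the crossing weights
  set g : ι → ι → Tup k n → ℝ := fun i j t =>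
    if 1 ≤ (rs (I i) t ∩ A j).card then ((Q i).card : ℝ)⁻¹ * z ^ (rs (I i) t ∩ A j).card else 0
    with hg
  have hg0 : ∀ i j t, 0 ≤ g i j t := by
    intro i j t; simp only [hg]; split_ifs <;> positivity
  have hgs : ∀ i j, ∑ t ∈ Q i, g i j t ≤ 2 * (s * (z * θ)) := by
    intro i j
    simp only [hg]
    rw [← Finset.sum_filter]
    have hAj : ((A j).card : ℝ) ≤ s := by exact_mod_cast hAs j
    have hle : ((A j).card : ℝ) * (z * θ) ≤ s * (z * θ) := by gcongr
    have := spread_sum_pos (Q := Q i) (P := fun _ => ((Q i).card : ℝ)⁻¹)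
      (fun _ _ => by positivity) (R := fun t => rs (I i) t) hz0.le zero_le_one hθ.le
      ((hS i).weights (hQ i)) (A j) (hle.trans hs)
    rw [one_mul] at this
    linarith
  set f : ι → Tup k n → ι → Tup k n → ℝ := fun i t j t' =>
    if ¬ Disjoint (Ei ⟨i, t⟩) (Ei ⟨j, t'⟩) then
      ((Q i).card : ℝ)⁻¹ * ((Q j).card : ℝ)⁻¹ * (p ^ (Ei ⟨i, t⟩ ∩ Ei ⟨j, t'⟩).card)⁻¹ else 0 with hf
  have hsum : ∑ a ∈ T, ∑ b ∈ T with ¬ Disjoint (Ei a) (Ei b),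
      P a * P b * (p ^ (Ei a ∩ Ei b).card)⁻¹ =
      M⁻¹ * M⁻¹ * ∑ i, ∑ j, ∑ t ∈ Q i, ∑ t' ∈ Q j, f i t j t' := by
    simp_rw [Finset.sum_filter]
    rw [hT, Finset.sum_sigma, Finset.mul_sum]
    refine Finset.sum_congr rfl fun i _ => ?_
    rw [Finset.sum_comm, Finset.mul_sum]
    simp_rw [Finset.sum_sigma]
    refine Finset.sum_congr rfl fun j _ => ?_
    rw [Finset.sum_comm]
    simp_rw [Finset.mul_sum]
    refine Finset.sum_congr rfl fun t _ => ?_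
    refine Finset.sum_congr rfl fun t' _ => ?_
    simp only [hf, hP]
    split_ifs <;> ring
  rw [hsum]
  have hdiag : ∀ i, ∑ t ∈ Q i, ∑ t' ∈ Q i, f i t i t' ≤ 2 * (k * (z * θ)) := by
    intro i
    have h1 : ∀ t ∈ Q i, ∑ t' ∈ Q i, f i t i t' ≤ ((Q i).card : ℝ)⁻¹ * (2 * (k * (z * θ))) := by
      intro t _
      have hU : ((rs (I i) t).card : ℝ) ≤ k := by
        rw [card_rs]; exact_mod_cast Nat.sub_le _ _
      have hle : ((rs (I i) t).card : ℝ) * (z * θ) ≤ k * (z * θ) := by gcongr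
      have h2 := spread_sum_pos (Q := Q i) (P := fun _ => ((Q i).card : ℝ)⁻¹)
        (fun _ _ => by positivity) (R := fun t => rs (I i) t) hz0.le zero_le_one hθ.le
        ((hS i).weights (hQ i)) (rs (I i) t) (hle.trans hk)
      rw [one_mul, Finset.sum_filter] at h2
      calc ∑ t' ∈ Q i, f i t i t' ≤ ∑ t' ∈ Q i, ((Q i).card : ℝ)⁻¹ *
            (if 1 ≤ (rs (I i) t' ∩ rs (I i) t).card then
              ((Q i).card : ℝ)⁻¹ * z ^ (rs (I i) t' ∩ rs (I i) t).card else 0) := by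
            refine Finset.sum_le_sum fun t' _ => ?_
            simp only [hf]
            by_cases hd : Disjoint (Ei ⟨i, t⟩) (Ei ⟨i, t'⟩)
            · simp only [hd, not_true_eq_false, if_false]
              split_ifs <;> positivity
            · have hsub : Ei ⟨i, t⟩ ∩ Ei ⟨i, t'⟩ ⊆ Ed (A i) (rs (I i) t' ∩ rs (I i) t) := by
                intro e he
                rw [Finset.mem_inter] at he
                obtain ⟨x, hx, y, hy, rfl⟩ := mem_Ed.1 he.1
                obtain ⟨x', hx', y', hy', he'⟩ := mem_Ed.1 he.2
                simp only at hx hy hx' hy'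
                rw [Sym2.eq_iff] at he'
                rcases he' with ⟨rfl, rfl⟩ | ⟨rfl, rfl⟩
                · exact mem_Ed.2 ⟨_, hx, _, Finset.mem_inter.2 ⟨hy', hy⟩, rfl⟩
                · exact absurd hy (Finset.disjoint_left.1 (disjoint_rs (hAI i) t) hx')
              have hcle := (Finset.card_le_card hsub).trans (card_Ed_le _ _)
              have hpos : 1 ≤ (rs (I i) t' ∩ rs (I i) t).card := by
                rw [Finset.not_disjoint_iff] at hd
                obtain ⟨e, he1, he2⟩ := hd
                obtain ⟨x, hx, y, hy, _⟩ := mem_Ed.1 (hsub (Finset.mem_inter.2 ⟨he1, he2⟩))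
                exact Finset.card_pos.2 ⟨y, hy⟩
              simp only [hd, hpos, not_false_eq_true, if_true, mul_assoc]
              have := inv_pow_mul_le (z := z) hp0 hp1 hz
                (hcle.trans (Nat.mul_le_mul_right _ (hAs i)))
              gcongr
        _ ≤ _ := by
            rw [← Finset.mul_sum]
            refine mul_le_mul_of_nonneg_left ?_ (by positivity)
            linarith
    refine (Finset.sum_le_sum h1).trans (le_of_eq ?_)
    rw [Finset.sum_const, nsmul_eq_mul]
    have := hc i
    field_simp
  have hoff : ∀ i j, i ≠ j → ∑ t ∈ Q i, ∑ t' ∈ Q j, f i t j t' ≤ (2 * (s * (z * θ))) ^ 2 := by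
    intro i j hij
    calc ∑ t ∈ Q i, ∑ t' ∈ Q j, f i t j t' ≤ ∑ t ∈ Q i, ∑ t' ∈ Q j, g i j t * g j i t' := by
          refine Finset.sum_le_sum fun t _ => Finset.sum_le_sum fun t' _ => ?_
          simp only [hf]
          by_cases hd : Disjoint (Ei ⟨i, t⟩) (Ei ⟨j, t'⟩)
          · simp only [hd, not_true_eq_false, if_false]
            exact mul_nonneg (hg0 _ _ _) (hg0 _ _ _)
          · have hsub : Ei ⟨i, t⟩ ∩ Ei ⟨j, t'⟩ ⊆ Ed (rs (I j) t' ∩ A i) (rs (I i) t ∩ A j) := by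
              intro e he
              rw [Finset.mem_inter] at he
              obtain ⟨x, hx, y, hy, rfl⟩ := mem_Ed.1 he.1
              obtain ⟨x', hx', y', hy', he'⟩ := mem_Ed.1 he.2
              simp only at hx hy hx' hy'
              rw [Sym2.eq_iff] at he'
              rcases he' with ⟨rfl, rfl⟩ | ⟨rfl, rfl⟩
              · exact absurd hx' (Finset.disjoint_left.1 (hAd i j hij) hx)
              · exact mem_Ed.2 ⟨_, Finset.mem_inter.2 ⟨hy', hx⟩, _,
                  Finset.mem_inter.2 ⟨hy, hx'⟩, rfl⟩
            have hcle := (Finset.card_le_card hsub).trans (card_Ed_le _ _)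
            have hpos : 1 ≤ (rs (I j) t' ∩ A i).card ∧ 1 ≤ (rs (I i) t ∩ A j).card := by
              rw [Finset.not_disjoint_iff] at hd
              obtain ⟨e, he1, he2⟩ := hd
              obtain ⟨x, hx, y, hy, _⟩ := mem_Ed.1 (hsub (Finset.mem_inter.2 ⟨he1, he2⟩))
              exact ⟨Finset.card_pos.2 ⟨x, hx⟩, Finset.card_pos.2 ⟨y, hy⟩⟩
            have hle2 : (rs (I j) t' ∩ A i).card ≤ s :=
              (Finset.card_le_card Finset.inter_subset_right).trans (hAs i)
            have h3 := inv_pow_mul_le (z := z) hp0 hp1 hz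
                (hcle.trans (Nat.mul_le_mul_right _ hle2))
            simp only [hg, hd, hpos.1, hpos.2, not_false_eq_true, if_true]
            have h4 : (1 : ℝ) ≤ z ^ (rs (I j) t' ∩ A i).card := one_le_pow₀ hz1
            calc ((Q i).card : ℝ)⁻¹ * ((Q j).card : ℝ)⁻¹ * (p ^ (Ei ⟨i, t⟩ ∩ Ei ⟨j, t'⟩).card)⁻¹
                ≤ ((Q i).card : ℝ)⁻¹ * ((Q j).card : ℝ)⁻¹ * (z ^ (rs (I i) t ∩ A j).card *
                  z ^ (rs (I j) t' ∩ A i).card) := by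
                  refine mul_le_mul_of_nonneg_left ?_ (by positivity)
                  refine h3.trans ?_
                  exact le_mul_of_one_le_right (by positivity) h4
              _ = _ := by ring
      _ = (∑ t ∈ Q i, g i j t) * ∑ t' ∈ Q j, g j i t' := by rw [Finset.sum_mul_sum]
      _ ≤ (2 * (s * (z * θ))) * (2 * (s * (z * θ))) := by
          refine mul_le_mul (hgs i j) (hgs j i) (Finset.sum_nonneg fun _ _ => hg0 _ _ _)
            (by positivity)
      _ = _ := by ring
  have hall : ∀ i j, ∑ t ∈ Q i, ∑ t' ∈ Q j, f i t j t' ≤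
      (if i = j then 2 * (k * (z * θ)) else 0) + (2 * (s * (z * θ))) ^ 2 := by
    intro i j
    by_cases hij : i = j
    · subst hij
      simp only [if_true]
      have := hdiag i
      have : 0 ≤ (2 * (s * (z * θ))) ^ 2 := by positivity
      linarith [hdiag i]
    · simp only [hij, if_false, zero_add]
      exact hoff i j hij
  have htot : ∑ i, ∑ j, ∑ t ∈ Q i, ∑ t' ∈ Q j, f i t j t' ≤
      M * (2 * (k * (z * θ))) + M * (M * (2 * (s * (z * θ))) ^ 2) := by
    refine (Finset.sum_le_sum fun i _ => Finset.sum_le_sum fun j _ => hall i j).trans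
      (le_of_eq ?_)
    simp only [Finset.sum_add_distrib, Finset.sum_ite_eq, Finset.mem_univ, if_true,
      Finset.sum_const, nsmul_eq_mul, Finset.card_univ]
    rfl
  calc M⁻¹ * M⁻¹ * ∑ i, ∑ j, ∑ t ∈ Q i, ∑ t' ∈ Q j, f i t j t'
      ≤ M⁻¹ * M⁻¹ * (M * (2 * (k * (z * θ))) + M * (M * (2 * (s * (z * θ))) ^ 2)) := by gcongr
    _ = _ := by field_simp

end Tails
end BC

open Finset

namespace BC

section Cliques

variable {k n : ℕ}

/-- The complete graph on `A`. -/
def cl (A : Finset (Vtx k n)) : Finset (Sym2 (Vtx k n)) := A.offDiag.image fun xy => s(xy.1, xy.2)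

lemma mem_cl {A : Finset (Vtx k n)} {e : Sym2 (Vtx k n)} :
    e ∈ cl A ↔ ∃ x ∈ A, ∃ y ∈ A, x ≠ y ∧ s(x, y) = e := by
  unfold cl
  simp only [Finset.mem_image, Finset.mem_offDiag]
  constructor
  · rintro ⟨⟨x, y⟩, ⟨hx, hy, hxy⟩, h⟩; exact ⟨x, hx, y, hy, hxy, h⟩
  · rintro ⟨x, hx, y, hy, hxy, h⟩; exact ⟨(x, y), ⟨hx, hy, hxy⟩, h⟩

lemma cl_inter (A B : Finset (Vtx k n)) : cl A ∩ cl B ⊆ cl (B ∩ A) := by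
  intro e he
  rw [Finset.mem_inter] at he
  obtain ⟨x, hx, y, hy, hxy, rfl⟩ := mem_cl.1 he.1
  obtain ⟨x', hx', y', hy', _, he'⟩ := mem_cl.1 he.2
  rw [Sym2.eq_iff] at he'
  rcases he' with ⟨rfl, rfl⟩ | ⟨rfl, rfl⟩ <;>
  exact mem_cl.2 ⟨_, Finset.mem_inter.2 ⟨by assumption, hx⟩, _,
    Finset.mem_inter.2 ⟨by assumption, hy⟩, hxy, rfl⟩

set_option maxHeartbeats 1000000 in
lemma clique_tail {p θ θ' z : ℝ} (hp0 : 0 < p) (hp1 : p ≤ 1) (hz1 : 1 ≤ z) (hθ' : 0 < θ')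
    {s b : ℕ} (hz : (p ^ s)⁻¹ ≤ z) (hzθ : z * θ' ≤ 1)
    {S : Finset (Tup k n)} (hSne : S.Nonempty) {I : Finset (Fin k)}
    {𝒬 : Finset (Finset (Tup k n) × Finset (Vtx k n))} (h𝒬 : IsPart θ S I 𝒬)
    (hsp : ∀ W : Finset (Vtx k n), ((S.filter fun t => W ⊆ rs I t).card : ℝ) ≤
      2 * θ' ^ W.card * S.card)
    (hs : ∀ a ∈ 𝒬, a.2.card ≤ s) (B : Finset (Vtx k n)) (hB : B.card ≤ b)
    (hb : (b : ℝ) * (2 * θ') ≤ 1 / 4)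
    {Δ : ℝ} (hΔ0 : 0 < Δ) (hΔ : 8 * (2 ^ s * (z * θ') ^ 2) ≤ Δ) :
    Pr (potEdges k n) p (fun G => ∀ a ∈ 𝒬, Disjoint a.2 B → ¬ cl a.2 ⊆ G)
      ≤ Real.exp (-(1 / (8 * Δ))) := by
  classical
  have hz0 : 0 < z := by linarith
  have hS0 : (0 : ℝ) < S.card := by exact_mod_cast hSne.card_pos
  obtain ⟨T, hT⟩ : ∃ T, T = 𝒬.filter fun a => Disjoint a.2 B := ⟨_, rfl⟩
  obtain ⟨tot, htot⟩ : ∃ tot : ℝ, tot = ∑ a ∈ T, (a.1.card : ℝ) := ⟨_, rfl⟩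
  have hTm : ∀ a ∈ T, a ∈ 𝒬 := fun a ha => by rw [hT] at ha; exact Finset.filter_subset _ _ ha
  have hhit : ∑ a ∈ 𝒬 with ¬ Disjoint a.2 B, (a.1.card : ℝ) ≤ S.card / 4 := by
    calc ∑ a ∈ 𝒬 with ¬ Disjoint a.2 B, (a.1.card : ℝ)
        ≤ ∑ a ∈ 𝒬, ∑ x ∈ B with {x} ⊆ a.2, (a.1.card : ℝ) := by
          rw [Finset.sum_filter]
          refine Finset.sum_le_sum fun a _ => ?_
          by_cases h : Disjoint a.2 B
          · rw [if_neg (not_not.2 h)]; positivity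
          · rw [if_pos h]
            obtain ⟨x, hx, hxB⟩ := Finset.not_disjoint_iff.1 h
            exact Finset.single_le_sum (f := fun _ : Vtx k n => (a.1.card : ℝ))
              (fun _ _ => by positivity)
              (Finset.mem_filter.2 ⟨hxB, Finset.singleton_subset_iff.2 hx⟩)
      _ = ∑ x ∈ B, ∑ a ∈ 𝒬 with {x} ⊆ a.2, (a.1.card : ℝ) := by
          simp_rw [Finset.sum_filter]
          rw [Finset.sum_comm]
      _ ≤ ∑ x ∈ B, 2 * θ' * S.card := by
          refine Finset.sum_le_sum fun x _ => ?_
          have := (h𝒬.sum_filter {x}).trans (hsp {x})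
          simpa using this
      _ = B.card * (2 * θ') * S.card := by rw [Finset.sum_const, nsmul_eq_mul]; ring
      _ ≤ 1 / 4 * S.card := by
          refine mul_le_mul_of_nonneg_right (le_trans ?_ hb) hS0.le
          have : (B.card : ℝ) ≤ b := by exact_mod_cast hB
          gcongr
      _ = _ := by ring
  have htot4 : (S.card : ℝ) / 4 ≤ tot := by
    have h1 := h𝒬.total
    rw [← Finset.sum_filter_add_sum_filter_not 𝒬 (fun a => Disjoint a.2 B),
      ← hT, ← htot] at h1
    linarith
  have htot0 : 0 < tot := by linarith
  obtain ⟨P, hP⟩ : ∃ P : Finset (Tup k n) × Finset (Vtx k n) → ℝ, ∀ a, P a = (a.1.card : ℝ) / tot :=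
    ⟨_, fun _ => rfl⟩
  have hP0 : ∀ a ∈ T, 0 ≤ P a := fun a _ => by rw [hP]; exact div_nonneg (Nat.cast_nonneg _) htot0.le
  have hPs : ∑ a ∈ T, P a = 1 := by
    simp only [hP]; rw [← Finset.sum_div, ← htot, div_self htot0.ne']
  have hw : ∀ W : Finset (Vtx k n), ∑ a ∈ T with W ⊆ a.2, P a ≤ 8 * θ' ^ W.card := by
    intro W
    simp only [hP]
    rw [← Finset.sum_div, div_le_iff₀ htot0]
    calc ∑ a ∈ T with W ⊆ a.2, (a.1.card : ℝ) ≤ ∑ a ∈ 𝒬 with W ⊆ a.2, (a.1.card : ℝ) := by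
          refine Finset.sum_le_sum_of_subset_of_nonneg ?_ fun _ _ _ => by positivity
          exact Finset.filter_subset_filter _ hTm
      _ ≤ 2 * θ' ^ W.card * S.card := (h𝒬.sum_filter W).trans (hsp W)
      _ ≤ 2 * θ' ^ W.card * (4 * tot) := by gcongr; linarith
      _ = _ := by ring
  have hmono : Pr (potEdges k n) p (fun G => ∀ a ∈ 𝒬, Disjoint a.2 B → ¬ cl a.2 ⊆ G) ≤
      Pr (potEdges k n) p (fun G => JX p T P (fun a => cl a.2) G ≤ 1 / 2) := by
    refine Pr_mono hp0.le hp1 fun G _ hG => ?_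
    have : JX p T P (fun a => cl a.2) G = 0 := by
      unfold JX
      refine Finset.sum_eq_zero fun a ha => ?_
      rw [hT, Finset.mem_filter] at ha
      have := hG a ha.1 ha.2
      simp [ind, this]
    rw [this]; norm_num
  refine hmono.trans (janson hp0 hp1 T P hP0 hPs _ ?_ hΔ0 ?_)
  · intro a ha e he
    obtain ⟨x, hx, y, hy, hxy, rfl⟩ := mem_cl.1 he
    rw [mem_potEdges]
    exact fun h => hxy (h𝒬.inj (hTm a ha) x hx y hy h)
  · refine le_trans ?_ hΔ
    have h1 : ∀ a ∈ T, ∑ j ∈ T with ¬ Disjoint (cl a.2) (cl j.2),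
        P a * P j * (p ^ (cl a.2 ∩ cl j.2).card)⁻¹ ≤ P a * (8 * (2 ^ s * (z * θ') ^ 2)) := by
      intro a ha
      have has := hs a (hTm a ha)
      calc ∑ j ∈ T with ¬ Disjoint (cl a.2) (cl j.2), P a * P j * (p ^ (cl a.2 ∩ cl j.2).card)⁻¹
          ≤ ∑ j ∈ T with 2 ≤ (j.2 ∩ a.2).card, P a * (P j * z ^ (j.2 ∩ a.2).card) := by
            rw [Finset.sum_filter, Finset.sum_filter]
            refine Finset.sum_le_sum fun j hj => ?_
            have hPa := hP0 a ha
            have hPj := hP0 j hj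
            by_cases hd : Disjoint (cl a.2) (cl j.2)
            · simp only [hd, not_true_eq_false, if_false]
              split_ifs <;> positivity
            · have hsub := cl_inter a.2 j.2
              have hpos : 2 ≤ (j.2 ∩ a.2).card := by
                rw [Finset.not_disjoint_iff] at hd
                obtain ⟨e, he1, he2⟩ := hd
                obtain ⟨x, hx, y, hy, hxy, _⟩ := mem_cl.1 (hsub (Finset.mem_inter.2 ⟨he1, he2⟩))
                exact Finset.one_lt_card.2 ⟨x, hx, y, hy, hxy⟩
              have hle : (cl a.2 ∩ cl j.2).card ≤ s * (j.2 ∩ a.2).card := by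
                refine (Finset.card_le_card hsub).trans ?_
                unfold cl
                refine Finset.card_image_le.trans ?_
                rw [Finset.offDiag_card]
                refine (Nat.sub_le _ _).trans (Nat.mul_le_mul_right _ ?_)
                exact (Finset.card_le_card Finset.inter_subset_right).trans has
              simp only [hd, hpos, not_false_eq_true, if_true]
              have := inv_pow_mul_le (z := z) hp0 hp1 hz hle
              rw [mul_assoc]
              gcongr
        _ = P a * ∑ j ∈ T with 2 ≤ (j.2 ∩ a.2).card, (P j * z ^ (j.2 ∩ a.2).card) := by
            rw [Finset.mul_sum]
        _ ≤ P a * (8 * ∑ W ∈ a.2.powerset with 2 ≤ W.card, (z * θ') ^ W.card) := by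
            refine mul_le_mul_of_nonneg_left ?_ (hP0 a ha)
            exact spread_sum_ge (R := fun j : Finset (Tup k n) × Finset (Vtx k n) => j.2)
              hP0 hz0.le hw a.2 2
        _ ≤ _ := by
            refine mul_le_mul_of_nonneg_left ?_ (hP0 a ha)
            refine mul_le_mul_of_nonneg_left ?_ (by norm_num)
            calc ∑ W ∈ a.2.powerset with 2 ≤ W.card, (z * θ') ^ W.card
                ≤ ∑ W ∈ a.2.powerset with 2 ≤ W.card, (z * θ') ^ 2 := by
                  refine Finset.sum_le_sum fun W hW => ?_
                  exact pow_le_pow_of_le_one (by positivity) hzθ (Finset.mem_filter.1 hW).2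
              _ = ((a.2.powerset.filter fun W => 2 ≤ W.card).card : ℝ) * (z * θ') ^ 2 := by
                  rw [Finset.sum_const, nsmul_eq_mul]
              _ ≤ _ := by
                  refine mul_le_mul_of_nonneg_right ?_ (by positivity)
                  have h2 : (a.2.powerset.filter fun W => 2 ≤ W.card).card ≤ 2 ^ s := by
                    refine (Finset.card_filter_le _ _).trans ?_
                    rw [Finset.card_powerset]
                    exact Nat.pow_le_pow_right (by norm_num) has
                  exact_mod_cast h2
    refine (Finset.sum_le_sum h1).trans (le_of_eq ?_)
    rw [← Finset.sum_mul, hPs, one_mul]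

end Cliques
end BC

open Finset

namespace BC

section BadEvent

variable {k n : ℕ}

lemma greedy {α β : Type*} [DecidableEq β] (T : Finset α) (A : α → Finset β) {s : ℕ}
    (hs : ∀ a ∈ T, (A a).card ≤ s) (M : ℕ) :
    (∃ f : Fin M → α, (∀ i, f i ∈ T) ∧ ∀ i j, i ≠ j → Disjoint (A (f i)) (A (f j))) ∨
    ∃ B : Finset β, B.card ≤ M * s ∧ ∀ a ∈ T, ¬ Disjoint (A a) B := by
  induction M with
  | zero => exact Or.inl ⟨fun i => i.elim0, fun i => i.elim0, fun i => i.elim0⟩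
  | succ M ih =>
    rcases ih with ⟨f, hf, hd⟩ | ⟨B, hB, h⟩
    · by_cases hex : ∃ a ∈ T, ∀ i, Disjoint (A a) (A (f i))
      · left
        obtain ⟨a, ha, had⟩ := hex
        refine ⟨Fin.cons a f, ?_, ?_⟩
        · intro i
          refine Fin.cases ?_ (fun j => ?_) i
          · simpa using ha
          · simpa using hf j
        · intro i j
          refine Fin.cases ?_ (fun i' => ?_) i
          · refine Fin.cases (fun h => absurd rfl h) (fun j' _ => ?_) j
            simpa using had j'
          · refine Fin.cases (fun _ => ?_) (fun j' h => ?_) j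
            · simpa using (had i').symm
            · have : i' ≠ j' := fun h' => h (by rw [h'])
              simpa using hd i' j' this
      · right
        push Not at hex
        refine ⟨Finset.univ.biUnion fun i => A (f i), ?_, ?_⟩
        · refine Finset.card_biUnion_le.trans ?_
          refine (Finset.sum_le_sum fun i _ => hs _ (hf i)).trans ?_
          simp only [Finset.sum_const, Finset.card_univ, Fintype.card_fin, smul_eq_mul]
          exact Nat.mul_le_mul_right _ (Nat.le_succ M)
        · intro a ha hda
          obtain ⟨i, hi⟩ := hex a ha
          exact hi (Finset.disjoint_of_subset_right
            (Finset.subset_biUnion_of_mem (fun i => A (f i)) (Finset.mem_univ i)) hda)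
    · exact Or.inr ⟨B, hB.trans (Nat.mul_le_mul_right _ (Nat.le_succ M)), h⟩

/-- The blocks fixed after passing to the part `a`. -/
def bl (I : Finset (Fin k)) (a : Finset (Tup k n) × Finset (Vtx k n)) : Finset (Fin k) :=
  I ∪ a.2.image Prod.fst

/-- The part `a` is good. -/
def Good (p θ z : ℝ) (I : Finset (Fin k)) (a : Finset (Tup k n) × Finset (Vtx k n))
    (G : Finset (Sym2 (Vtx k n))) : Prop :=
  cl a.2 ⊆ G ∧ 1 / 2 < Xc p a.2 (bl I a) a.1 ∅ G ∧
    ∀ W, Xc p a.2 (bl I a) a.1 W G ≤ 4 * (z * θ) ^ W.card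

/-- No part is good. -/
def Bad (p θ z : ℝ) (S : Finset (Tup k n)) (I : Finset (Fin k))
    (G : Finset (Sym2 (Vtx k n))) : Prop :=
  ∀ a ∈ parts θ S I, ¬ Good p θ z I a G

/-- All partial transversals. -/
def trs (k n : ℕ) : Finset (Finset (Vtx k n)) :=
  (Finset.univ : Finset (Finset (Fin k) × Tup k n)).image fun x => rs x.1 x.2

lemma card_trs : (trs k n).card ≤ 2 ^ k * n ^ k := by
  refine Finset.card_image_le.trans (le_of_eq ?_)
  simp [Finset.card_univ]

lemma Xc_pos_trs {p : ℝ} {A : Finset (Vtx k n)} {I : Finset (Fin k)} {Q : Finset (Tup k n)}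
    {W : Finset (Vtx k n)} {G : Finset (Sym2 (Vtx k n))} (h : 0 < Xc p A I Q W G) :
    W ∈ trs k n := by
  have hne : (Q.filter fun t => W ⊆ rs I t).Nonempty := by
    by_contra hne
    rw [Finset.not_nonempty_iff_eq_empty] at hne
    unfold Xc JX at h
    rw [hne] at h
    simp at h
  obtain ⟨t, ht⟩ := hne
  have ht := (Finset.mem_filter.1 ht).2
  refine Finset.mem_image.2 ⟨((W.image Prod.fst)ᶜ, t), Finset.mem_univ _, ?_⟩
  ext y
  simp only [mem_rs, Finset.mem_compl, not_not, Finset.mem_image]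
  constructor
  · rintro ⟨⟨x, hx, hxy⟩, h2⟩
    have h3 := (mem_rs.1 (ht hx)).2
    have : x = y := Prod.ext hxy (by rw [← h3, ← h2, hxy])
    rwa [← this]
  · intro hy
    exact ⟨⟨y, hy, rfl⟩, (mem_rs.1 (ht hy)).2⟩

lemma Pr_and_const {α : Type*} [DecidableEq α] {E : Finset α} {p : ℝ} (h0 : 0 ≤ p) (h1 : p ≤ 1)
    (c : Prop) (P : Finset α → Prop) {b : ℝ} (hb0 : 0 ≤ b) (h : c → Pr E p P ≤ b) :
    Pr E p (fun G => c ∧ P G) ≤ b := by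
  by_cases hc : c
  · exact (Pr_mono h0 h1 fun G _ hG => hG.2).trans (h hc)
  · refine le_trans (le_of_eq ?_) hb0
    unfold Pr
    simp only [hc, false_and, if_false]
    have := Ex_mul E p 0 (fun _ => 0)
    simpa using this

set_option maxHeartbeats 1000000 in
lemma bad_bound {p θ θ' z : ℝ} (hp0 : 0 < p) (hp1 : p ≤ 1) (hz1 : 1 ≤ z) (hθ : 0 < θ)
    (hθ' : 0 < θ') {s M r : ℕ} (hM : 1 ≤ M) (hz : (p ^ s)⁻¹ ≤ z) (hzθ : z * θ' ≤ 1)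
    {S : Finset (Tup k n)} (hSne : S.Nonempty) {I : Finset (Fin k)}
    (hsp : ∀ W : Finset (Vtx k n), ((S.filter fun t => W ⊆ rs I t).card : ℝ) ≤
      2 * θ' ^ W.card * S.card)
    (hs : ∀ a ∈ parts θ S I, a.2.card ≤ s)
    (hk : k * (z * θ) ≤ 1 / 2) (hsz : s * (z * θ) ≤ 1 / 2)
    (hb : ((2 * (M * s) : ℕ) : ℝ) * (2 * θ') ≤ 1 / 4)
    (hsmall : ((M * s + k * r : ℕ) : ℝ) * (z * θ) ≤ 1 / 2)
    {Δ₁ Δ₃ : ℝ} (hΔ₁0 : 0 < Δ₁) (hΔ₃0 : 0 < Δ₃)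
    (hΔ₁ : 2 * (k * (z * θ)) / M + (2 * (s * (z * θ))) ^ 2 ≤ Δ₁)
    (hΔ₃ : 8 * (2 ^ s * (z * θ') ^ 2) ≤ Δ₃) :
    Pr (potEdges k n) p (Bad p θ z S I) ≤
      (n ^ k : ℝ) ^ M * Real.exp (-(1 / (8 * Δ₁))) +
      ((n ^ k : ℝ) ^ M * (2 ^ k * n ^ k : ℝ) ^ M * (1 / 2) ^ (r * M) +
      2 ^ (k * n) * Real.exp (-(1 / (8 * Δ₃)))) := by
  classical
  have : NeZero M := ⟨by omega⟩
  obtain ⟨𝒬, h𝒬e⟩ : ∃ 𝒬, 𝒬 = parts θ S I := ⟨_, rfl⟩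
  have h𝒬 : IsPart θ S I 𝒬 := h𝒬e ▸ parts_spec hθ S I
  rw [← h𝒬e] at hs
  have hblk : ∀ a ∈ 𝒬, ∀ x ∈ a.2, x.1 ∈ bl I a := fun a _ x hx =>
    Finset.mem_union_right _ (Finset.mem_image_of_mem _ hx)
  obtain ⟨F, hF⟩ : ∃ F, F = Fintype.piFinset fun _ : Fin M => 𝒬 := ⟨_, rfl⟩
  have hFc : (F.card : ℝ) ≤ (n ^ k : ℝ) ^ M := by
    rw [hF, Fintype.card_piFinset_const, Nat.cast_pow]
    refine pow_le_pow_left₀ (Nat.cast_nonneg _) ?_ M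
    rw [← Nat.cast_pow]
    exact Nat.cast_le.2 h𝒬.card_le
  obtain ⟨Wf, hWf⟩ : ∃ Wf, Wf = Fintype.piFinset fun _ : Fin M => trs k n := ⟨_, rfl⟩
  have hWc : (Wf.card : ℝ) ≤ (2 ^ k * n ^ k : ℝ) ^ M := by
    rw [hWf, Fintype.card_piFinset_const, Nat.cast_pow]
    refine pow_le_pow_left₀ (Nat.cast_nonneg _) ?_ M
    have := card_trs (k := k) (n := n)
    have h2 : ((trs k n).card : ℝ) ≤ ((2 ^ k * n ^ k : ℕ) : ℝ) := Nat.cast_le.2 this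
    rwa [Nat.cast_mul, Nat.cast_pow, Nat.cast_pow, Nat.cast_ofNat] at h2
  -- the three events
  have hE1 : Pr (potEdges k n) p (fun G => ∃ f ∈ F,
      (∀ i j, i ≠ j → Disjoint (f i).2 (f j).2) ∧
        ∀ i, Xc p (f i).2 (bl I (f i)) (f i).1 ∅ G ≤ 1 / 2) ≤
      F.card * Real.exp (-(1 / (8 * Δ₁))) := by
    refine Pr_exists hp0.le hp1 _ _ fun f hf => ?_
    rw [hF, Fintype.mem_piFinset] at hf
    refine Pr_and_const hp0.le hp1 _ _ (Real.exp_pos _).le fun hd => ?_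
    refine lower_tail hp0 hp1 hz1 hθ (fun i => (f i).2) (fun i => bl I (f i)) (fun i => (f i).1)
      (fun i => hblk _ (hf i)) hd (fun i => h𝒬.ne _ (hf i)) (fun i => h𝒬.spread _ (hf i)) hz
      (fun i => hs _ (hf i)) hk hsz hΔ₁0 ?_
    simpa using hΔ₁
  have hE2 : Pr (potEdges k n) p (fun G => ∃ fw ∈ F ×ˢ Wf,
      (∀ i j, i ≠ j → Disjoint (fw.1 i).2 (fw.1 j).2) ∧
        ∀ i, 4 * (z * θ) ^ (fw.2 i).card <
          Xc p (fw.1 i).2 (bl I (fw.1 i)) (fw.1 i).1 (fw.2 i) G) ≤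
      (F ×ˢ Wf).card * (1 / 2) ^ (r * M) := by
    refine Pr_exists hp0.le hp1 _ _ fun fw hfw => ?_
    have hf := (Finset.mem_product.1 hfw).1
    rw [hF, Fintype.mem_piFinset] at hf
    refine Pr_and_const hp0.le hp1 _ _ (by positivity) fun hd => ?_
    have := moment_bound hp0 hp1 hz1 hθ (r := r) (fun i => (fw.1 i).2) (fun i => bl I (fw.1 i))
      (fun i => (fw.1 i).1) fw.2 (Finset.univ.biUnion fun i => (fw.1 i).2)
      (fun i => hblk _ (hf i)) hd
      (fun i => Finset.subset_biUnion_of_mem (fun i => (fw.1 i).2) (Finset.mem_univ i))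
      (fun i => h𝒬.ne _ (hf i)) (fun i => h𝒬.spread _ (hf i))
      (fun i => inv_pow_le hp0 hp1 hz (hs _ (hf i))) ?_
    · simpa using this
    · refine le_trans (mul_le_mul_of_nonneg_right ?_ (by positivity)) hsmall
      have : (Finset.univ.biUnion fun i => (fw.1 i).2).card ≤ M * s := by
        refine Finset.card_biUnion_le.trans ?_
        refine (Finset.sum_le_sum fun i _ => hs _ (hf i)).trans ?_
        simp
      exact_mod_cast Nat.add_le_add_right this _
  have hE3 : Pr (potEdges k n) p (fun G => ∃ B ∈ (Finset.univ : Finset (Finset (Vtx k n))),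
      B.card ≤ 2 * (M * s) ∧ ∀ a ∈ 𝒬, Disjoint a.2 B → ¬ cl a.2 ⊆ G) ≤
      (Finset.univ : Finset (Finset (Vtx k n))).card * Real.exp (-(1 / (8 * Δ₃))) := by
    refine Pr_exists hp0.le hp1 _ _ fun B _ => ?_
    refine Pr_and_const hp0.le hp1 _ _ (Real.exp_pos _).le fun hB => ?_
    exact clique_tail hp0 hp1 hz1 hθ' hz hzθ hSne h𝒬 hsp hs B hB hb hΔ₃0 hΔ₃
  refine le_trans (Pr_mono (Q := fun G => _ ∨ (_ ∨ _)) hp0.le hp1 fun G _ hG => ?_)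
    ((Pr_or hp0.le hp1 _ _).trans (add_le_add (hE1.trans ?_)
      ((Pr_or hp0.le hp1 _ _).trans (add_le_add (hE2.trans ?_) (hE3.trans ?_)))))
  · unfold Bad at hG
    rw [← h𝒬e] at hG
    rcases greedy (𝒬.filter fun a => Xc p a.2 (bl I a) a.1 ∅ G ≤ 1 / 2) (fun a => a.2)
      (fun a ha => hs a (Finset.mem_filter.1 ha).1) M with ⟨f, hf, hd⟩ | ⟨B₁, hB₁, h₁⟩
    · left
      exact ⟨f, hF ▸ Fintype.mem_piFinset.2 fun i => (Finset.mem_filter.1 (hf i)).1, hd,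
        fun i => (Finset.mem_filter.1 (hf i)).2⟩
    right
    rcases greedy (𝒬.filter fun a => ∃ W, 4 * (z * θ) ^ W.card < Xc p a.2 (bl I a) a.1 W G)
      (fun a => a.2) (fun a ha => hs a (Finset.mem_filter.1 ha).1) M with
      ⟨f, hf, hd⟩ | ⟨B₂, hB₂, h₂⟩
    · left
      have hW := fun i => (Finset.mem_filter.1 (hf i)).2
      choose W hW using hW
      refine ⟨(f, W), Finset.mem_product.2 ⟨hF ▸ Fintype.mem_piFinset.2 fun i =>
        (Finset.mem_filter.1 (hf i)).1, hWf ▸ Fintype.mem_piFinset.2 fun i => ?_⟩, hd, hW⟩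
      exact Xc_pos_trs (lt_of_le_of_lt (by positivity) (hW i))
    · right
      refine ⟨B₁ ∪ B₂, Finset.mem_univ _, ?_, ?_⟩
      · refine (Finset.card_union_le _ _).trans ?_
        omega
      · intro a ha hda hcl
        rw [Finset.disjoint_union_right] at hda
        refine hG a ha ⟨hcl, ?_, ?_⟩
        · by_contra hcon
          exact h₁ a (Finset.mem_filter.2 ⟨ha, not_lt.1 hcon⟩) hda.1
        · intro W
          by_contra hcon
          exact h₂ a (Finset.mem_filter.2 ⟨ha, W, not_le.1 hcon⟩) hda.2
  · gcongr
  · rw [Finset.card_product]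
    push_cast
    gcongr
  · simp [Finset.card_univ]

end BadEvent
end BC

open Finset

namespace BC

section Counting

variable {k n : ℕ}

lemma Xc_eq {p : ℝ} {A : Finset (Vtx k n)} {I : Finset (Fin k)} (hA : ∀ x ∈ A, x.1 ∈ I)
    (Q : Finset (Tup k n)) (W : Finset (Vtx k n)) (G : Finset (Sym2 (Vtx k n))) :
    Xc p A I Q W G = ((Q.card : ℝ))⁻¹ * (p ^ (A.card * (k - I.card)))⁻¹ *
      (((Q.filter fun t => Ed A (rs I t) ⊆ G).filter fun t => W ⊆ rs I t).card : ℝ) := by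
  unfold Xc JX ind
  simp only [card_Ed_rs hA]
  rw [← Finset.mul_sum, Finset.filter_filter, Finset.card_filter, Finset.sum_filter]
  push_cast
  congr 1
  refine Finset.sum_congr rfl fun t _ => ?_
  by_cases h1 : Ed A (rs I t) ⊆ G <;> by_cases h2 : W ⊆ rs I t <;> simp [h1, h2]

/-- Tuples agreeing with `t0` on `I`. -/
def Q0 (I : Finset (Fin k)) (t0 : Tup k n) : Finset (Tup k n) :=
  Finset.univ.filter fun t => ∀ i ∈ I, t i = t0 i

lemma card_Q0 (I : Finset (Fin k)) (t0 : Tup k n) : (Q0 I t0).card = n ^ (k - I.card) := by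
  have h : Q0 I t0 = Fintype.piFinset fun i => if i ∈ I then {t0 i} else Finset.univ := by
    ext t
    simp only [Q0, Finset.mem_filter, Finset.mem_univ, true_and, Fintype.mem_piFinset]
    refine forall_congr' fun i => ?_
    by_cases hi : i ∈ I <;> simp [hi]
  rw [h, Fintype.card_piFinset]
  have : ∀ i : Fin k, (if i ∈ I then ({t0 i} : Finset (Fin n)) else Finset.univ).card =
      if i ∈ I then 1 else n := by
    intro i; by_cases hi : i ∈ I <;> simp [hi]
  simp only [this]
  rw [Finset.prod_ite]
  simp only [Finset.prod_const, one_pow, one_mul]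
  congr 1
  have hI : (Finset.univ.filter fun x => x ∉ I) = Iᶜ := by ext; simp
  rw [hI, Finset.card_compl, Fintype.card_fin]

lemma spread_Q0 (hn : 1 ≤ n) {θ : ℝ} (hθ : (n : ℝ)⁻¹ ≤ θ) (I : Finset (Fin k)) (t0 : Tup k n) :
    Spread θ (Q0 I t0) I := by
  intro W
  have hn0 : (0 : ℝ) < n := by exact_mod_cast hn
  by_cases hne : ((Q0 I t0).filter fun t => W ⊆ rs I t).Nonempty
  · obtain ⟨t1, ht1⟩ := hne
    rw [Finset.mem_filter] at ht1
    obtain ⟨h1, h2⟩ := ht1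
    have hcard : (I ∪ W.image Prod.fst).card = I.card + W.card := by
      rw [Finset.card_union_of_disjoint, Finset.card_image_of_injOn]
      · intro x hx y hy hxy
        have h3 := (mem_rs.1 (h2 hx)).2
        have h4 := (mem_rs.1 (h2 hy)).2
        exact Prod.ext hxy (by rw [← h3, ← h4, hxy])
      · rw [Finset.disjoint_right]
        intro i hi
        obtain ⟨x, hx, rfl⟩ := Finset.mem_image.1 hi
        exact (mem_rs.1 (h2 hx)).1
    have hsub : ((Q0 I t0).filter fun t => W ⊆ rs I t) ⊆ Q0 (I ∪ W.image Prod.fst) t1 := by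
      intro t ht
      rw [Finset.mem_filter] at ht
      simp only [Q0, Finset.mem_filter, Finset.mem_univ, true_and] at ht h1 ⊢
      intro i hi
      rcases Finset.mem_union.1 hi with hi | hi
      · rw [ht.1 i hi, h1 i hi]
      · obtain ⟨x, hx, rfl⟩ := Finset.mem_image.1 hi
        rw [(mem_rs.1 (h2 hx)).2, (mem_rs.1 (ht.2 hx)).2]
    have hle : I.card + W.card ≤ k := by
      rw [← hcard]
      exact (Finset.card_le_univ _).trans (by simp)
    have h3 := Finset.card_le_card hsub
    rw [card_Q0, hcard] at h3
    have h4 : (((Q0 I t0).filter fun t => W ⊆ rs I t).card : ℝ) ≤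
        (n : ℝ) ^ (k - (I.card + W.card)) := by exact_mod_cast h3
    refine h4.trans ?_
    rw [card_Q0]
    have h5 : k - I.card = (k - (I.card + W.card)) + W.card := by omega
    rw [h5]
    push_cast
    rw [pow_add]
    have h6 : 1 ≤ θ * n := by
      have := mul_le_mul_of_nonneg_right hθ hn0.le
      rwa [inv_mul_cancel₀ hn0.ne'] at this
    calc (n : ℝ) ^ (k - (I.card + W.card)) = (n : ℝ) ^ (k - (I.card + W.card)) * 1 := by ring
      _ ≤ (n : ℝ) ^ (k - (I.card + W.card)) * (θ * n) ^ W.card := by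
          gcongr; exact one_le_pow₀ h6
      _ = _ := by rw [mul_pow]; ring
  · rw [Finset.not_nonempty_iff_eq_empty.1 hne]
    have : 0 ≤ θ := le_trans (by positivity) hθ
    simp only [Finset.card_empty, Nat.cast_zero]
    positivity

/-- The global upper-deviation event. -/
def E0 (p : ℝ) (s : ℕ) (G : Finset (Sym2 (Vtx k n))) : Prop :=
  ∃ x ∈ (Finset.univ : Finset ((Finset (Fin k) × Finset (Fin k)) × Tup k n)),
    (x.1.1 ⊆ x.1.2 ∧ x.1.1.card ≤ s) ∧
      4 < Xc p (rs x.1.1ᶜ x.2) x.1.2 (Q0 x.1.2 x.2) ∅ G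

lemma E0_bound (hn : 1 ≤ n) {p θ z : ℝ} (hp0 : 0 < p) (hp1 : p ≤ 1) (hz1 : 1 ≤ z) (hθ0 : 0 < θ)
    (hθ : (n : ℝ)⁻¹ ≤ θ) {s r : ℕ} (hz : (p ^ s)⁻¹ ≤ z)
    (hsmall : ((s + k * r : ℕ) : ℝ) * (z * θ) ≤ 1 / 2) :
    Pr (potEdges k n) p (E0 p s) ≤ (2 ^ k * 2 ^ k * n ^ k : ℝ) * (1 / 2) ^ r := by
  have h := Pr_exists (E := potEdges k n) hp0.le hp1
    (Finset.univ : Finset ((Finset (Fin k) × Finset (Fin k)) × Tup k n))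
    (fun x G => (x.1.1 ⊆ x.1.2 ∧ x.1.1.card ≤ s) ∧
      4 < Xc p (rs x.1.1ᶜ x.2) x.1.2 (Q0 x.1.2 x.2) ∅ G) (b := (1 / 2) ^ r) ?_
  · refine h.trans (le_of_eq ?_)
    simp [Finset.card_univ]
  · rintro ⟨⟨K, I⟩, t0⟩ _
    refine Pr_and_const hp0.le hp1 _ _ (by positivity) ?_
    rintro ⟨hKI, hKs⟩
    simp only at hKI hKs ⊢
    have hAc : (rs Kᶜ t0).card = K.card := by
      unfold rs
      rw [compl_compl, Finset.card_image_of_injective _ (fun a b h => (Prod.mk.inj h).1)]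
    have := moment_bound (ι := Unit) hp0 hp1 hz1 hθ0 (r := r) (fun _ => rs Kᶜ t0) (fun _ => I)
      (fun _ => Q0 I t0) (fun _ => ∅) (rs Kᶜ t0)
      (fun _ x hx => by
        have := (mem_rs.1 hx).1
        rw [Finset.mem_compl, not_not] at this
        exact hKI this) (fun i j h => absurd rfl h) (fun _ => subset_rfl)
      (fun _ => ⟨t0, by simp [Q0]⟩) (fun _ => spread_Q0 hn hθ I t0)
      (fun _ => by rw [hAc]; exact inv_pow_le hp0 hp1 hz hKs) ?_
    · simpa using this
    · refine le_trans (mul_le_mul_of_nonneg_right ?_ (by positivity)) hsmall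
      rw [hAc]
      exact_mod_cast Nat.add_le_add_right hKs _

/-- State of the adversary. -/
structure St (p θ θ' : ℝ) (s : ℕ) (G : Finset (Sym2 (Vtx k n))) (i : ℕ) (S : Finset (Tup k n))
    (I : Finset (Fin k)) : Prop where
  ne : S.Nonempty
  agree : ∀ t ∈ S, ∀ t' ∈ S, ∀ a ∈ I, t a = t' a
  spread : Spread θ' S I
  edges : ∀ t ∈ S, ∀ a ∈ I, ∀ b, b ≠ a → s((a, t a), (b, t b)) ∈ G
  card : I.card ≤ s
  size : (n : ℝ) ^ k * θ ^ I.card * p ^ (I.card * k) ≤ 8 ^ i * S.card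

lemma St.not_ruledOut {p θ θ' : ℝ} {s : ℕ} {G : Finset (Sym2 (Vtx k n))} {i : ℕ}
    {S : Finset (Tup k n)} {I : Finset (Fin k)} (h : St p θ θ' s G i S I) (hθ' : θ' < 1) :
    ¬ RuledOut G S := by
  rintro ⟨e, hep, heG, he⟩
  induction e using Sym2.ind with
  | _ u v =>
    rw [mem_potEdges] at hep
    obtain ⟨t, ht⟩ := h.ne
    have hu := he t ht u (by simp)
    have hv := he t ht v (by simp)
    by_cases huI : u.1 ∈ I
    · have := h.edges t ht u.1 huI v.1 (Ne.symm hep)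
      rw [hu, hv] at this
      exact heG this
    by_cases hvI : v.1 ∈ I
    · have := h.edges t ht v.1 hvI u.1 hep
      rw [hu, hv, Sym2.eq_swap] at this
      exact heG this
    have hs := h.spread {u}
    rw [Finset.filter_true_of_mem] at hs
    · have hc : (0 : ℝ) < S.card := by exact_mod_cast h.ne.card_pos
      simp only [Finset.card_singleton, pow_one] at hs
      nlinarith
    · intro t' ht'
      rw [Finset.singleton_subset_iff, mem_rs]
      exact ⟨huI, he t' ht' u (by simp)⟩

/-- The condition on `(S, I)` under which the bad event is improbable. -/
def Cond (θ θ' : ℝ) (s : ℕ) (S : Finset (Tup k n)) (I : Finset (Fin k)) : Prop :=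
  S.Nonempty ∧ (∀ W : Finset (Vtx k n), ((S.filter fun t => W ⊆ rs I t).card : ℝ) ≤
      2 * θ' ^ W.card * S.card) ∧ ∀ a ∈ parts θ S I, a.2.card ≤ s

end Counting
end BC

open Finset

namespace BC

section Step

variable {k n : ℕ}

/-- New set of the adversary. -/
def nx (N : Finset (Vtx k n)) (Q : Finset (Tup k n)) : Finset (Tup k n) :=
  Q.filter fun t => rs ∅ t ⊆ N

lemma exists_nx (A : Finset (Vtx k n)) (I : Finset (Fin k)) (G : Finset (Sym2 (Vtx k n)))
    (Q : Finset (Tup k n)) : ∃ N, nx N Q = Q.filter fun t => Ed A (rs I t) ⊆ G := by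
  classical
  refine ⟨Finset.univ.filter fun y => y.1 ∈ I ∨ ∀ x ∈ A, s(x, y) ∈ G, ?_⟩
  unfold nx
  refine Finset.filter_congr fun t _ => ?_
  constructor
  · intro h e he
    obtain ⟨x, hx, y, hy, rfl⟩ := mem_Ed.1 he
    have hy' := mem_rs.1 hy
    have := h (mem_rs.2 ⟨by simp, hy'.2⟩)
    rw [Finset.mem_filter] at this
    exact (this.2.resolve_left hy'.1) x hx
  · intro h y hy
    rw [Finset.mem_filter]
    refine ⟨Finset.mem_univ _, ?_⟩
    by_cases hyI : y.1 ∈ I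
    · exact Or.inl hyI
    · exact Or.inr fun x hx => h (mem_Ed.2 ⟨x, hx, y, mem_rs.2 ⟨hyI, (mem_rs.1 hy).2⟩, rfl⟩)

lemma real1 {ν θ p cS cS' cA : ℝ} {k m d c i : ℕ} (hθ : 0 < θ) (hm : m = d + c)
    (hS : ν ^ k * θ ^ d * p ^ (d * k) ≤ 8 ^ i * cS) (hbig : cS ≤ 2 * cS')
    (hsz : θ ^ c * cS' ≤ 2 * cA) (hQ : cA ≤ ν ^ (k - m) * p ^ (d * (k - m)) * 4) :
    ν ^ k * θ ^ m * p ^ (d * k) ≤ 16 * 8 ^ i * (ν ^ (k - m) * p ^ (d * (k - m))) := by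
  have hc := pow_pos hθ c
  have h8 : (0 : ℝ) < 8 ^ i := by positivity
  calc ν ^ k * θ ^ m * p ^ (d * k) =
      θ ^ c * (ν ^ k * θ ^ d * p ^ (d * k)) := by rw [hm, pow_add]; ring
    _ ≤ θ ^ c * (8 ^ i * cS) := mul_le_mul_of_nonneg_left hS hc.le
    _ ≤ θ ^ c * (8 ^ i * (2 * cS')) := by gcongr
    _ = 2 * 8 ^ i * (θ ^ c * cS') := by ring
    _ ≤ 2 * 8 ^ i * (2 * cA) := by gcongr
    _ ≤ 2 * 8 ^ i * (2 * (ν ^ (k - m) * p ^ (d * (k - m)) * 4)) := by gcongr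
    _ = _ := by ring

lemma real2 {ν θ p cS cS' cA cT : ℝ} {k m d c i : ℕ} (hθ : 0 < θ) (hp : 0 < p) (hA : 0 < cA)
    (hS : ν ^ k * θ ^ d * p ^ (d * k) ≤ 8 ^ i * cS) (hbig : cS ≤ 2 * cS')
    (hsz : θ ^ c * cS' ≤ 2 * cA) (hmk : p ^ (c * k) ≤ p ^ m)
    (hlo : (cA * p ^ m) * (1 / 2) < cT) :
    ν ^ k * θ ^ (d + c) * p ^ ((d + c) * k) ≤ 8 ^ (i + 1) * cT := by
  have hc := pow_pos hθ c
  have h8 : (0 : ℝ) < 8 ^ i := by positivity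
  have hpc := pow_pos hp (c * k)
  calc ν ^ k * θ ^ (d + c) * p ^ ((d + c) * k)
      = θ ^ c * p ^ (c * k) * (ν ^ k * θ ^ d * p ^ (d * k)) := by
        rw [pow_add, add_mul, pow_add]; ring
    _ ≤ θ ^ c * p ^ (c * k) * (8 ^ i * cS) := by gcongr
    _ ≤ θ ^ c * p ^ (c * k) * (8 ^ i * (2 * cS')) := by gcongr
    _ = 2 * 8 ^ i * p ^ (c * k) * (θ ^ c * cS') := by ring
    _ ≤ 2 * 8 ^ i * p ^ (c * k) * (2 * cA) := by gcongr
    _ ≤ 2 * 8 ^ i * p ^ m * (2 * cA) := by gcongr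
    _ = 8 * 8 ^ i * ((cA * p ^ m) * (1 / 2)) := by ring
    _ ≤ 8 * 8 ^ i * cT := by gcongr
    _ = _ := by rw [pow_succ]; ring

lemma real3 {x θ' A cT cF : ℝ} {w : ℕ} (hx : 0 < x) (hT : 0 < cT) (hw : 0 < w)
    (hxθ : 8 * x ≤ θ') (hlo : A * (1 / 2) < cT) (hup : cF ≤ A * (4 * x ^ w)) :
    cF ≤ θ' ^ w * cT := by
  have h8 : 8 * x ^ w ≤ θ' ^ w := by
    calc 8 * x ^ w ≤ 8 ^ w * x ^ w := by
          gcongr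
          exact le_self_pow₀ (by norm_num) (by omega)
      _ = (8 * x) ^ w := by rw [mul_pow]
      _ ≤ _ := pow_le_pow_left₀ (by positivity) hxθ _
  calc cF ≤ A * (4 * x ^ w) := hup
    _ = 8 * x ^ w * (A * (1 / 2)) := by ring
    _ ≤ 8 * x ^ w * cT := by gcongr
    _ ≤ _ := mul_le_mul_of_nonneg_right h8 hT.le

lemma real4 {θ' cF cF' cS cS' : ℝ} {w : ℕ} (hθ : 0 < θ') (h1 : cF ≤ cF') (h2 : cF' ≤ θ' ^ w * cS)
    (h3 : cS ≤ 2 * cS') : cF ≤ 2 * θ' ^ w * cS' := by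
  have := mul_le_mul_of_nonneg_left h3 (pow_pos hθ w).le
  linarith

lemma real5 {ν θ p z : ℝ} {k m d i : ℕ} (hν : 0 < ν) (hθ : 0 < θ) (hp : 0 < p) (hz : 0 < z)
    (hmk : m ≤ k) (hzp : z⁻¹ ≤ p ^ d)
    (h1 : ν ^ k * θ ^ m * p ^ (d * k) ≤ 16 * 8 ^ i * (ν ^ (k - m) * p ^ (d * (k - m)))) :
    (ν * θ / z) ^ m ≤ 16 * 8 ^ i := by
  have h2 : ν ^ k = ν ^ (k - m) * ν ^ m := by
    rw [← pow_add]; congr 1; omega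
  have h3 : p ^ (d * k) = p ^ (d * (k - m)) * (p ^ d) ^ m := by
    rw [← pow_mul, ← pow_add, ← mul_add]; congr 2; omega
  rw [h2, h3] at h1
  have h4 : ν ^ m * θ ^ m * (p ^ d) ^ m ≤ 16 * 8 ^ i := by
    have hpos : 0 < ν ^ (k - m) * p ^ (d * (k - m)) := by positivity
    refine le_of_mul_le_mul_right ?_ hpos
    refine le_trans (le_of_eq ?_) h1
    ring
  refine le_trans ?_ h4
  rw [← mul_pow, ← mul_pow]
  refine pow_le_pow_left₀ (by positivity) ?_ m
  rw [div_eq_mul_inv]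
  exact mul_le_mul_of_nonneg_left hzp (by positivity)

lemma nx_subset (N : Finset (Vtx k n)) (Q : Finset (Tup k n)) : nx N Q ⊆ Q := by
  unfold nx; exact Finset.filter_subset _ _

set_option maxHeartbeats 1000000 in
lemma part_small {p θ θ' z : ℝ} (hn : 1 ≤ n) (hp0 : 0 < p) (hp1 : p ≤ 1) (hz1 : 1 ≤ z) (hθ : 0 < θ)
    {s i : ℕ} (hz : (p ^ s)⁻¹ ≤ z) {G : Finset (Sym2 (Vtx k n))} {S S' : Finset (Tup k n)}
    {I : Finset (Fin k)} (h : St p θ θ' s G i S I) (hsub : S' ⊆ S)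
    (hbig : (S.card : ℝ) ≤ 2 * S'.card) (hE0 : ¬ E0 p s G)
    (hm : ∀ m : ℕ, (n * θ / z) ^ m ≤ 16 * 8 ^ i → m ≤ s)
    {a} (ha : a ∈ parts θ S' I) : (bl I a).card ≤ s := by
  have hP := parts_spec hθ S' I
  have hcard := hP.card_blocks ha
  have hn0 : (0 : ℝ) < n := by exact_mod_cast hn
  have hz0 : 0 < z := by linarith
  obtain ⟨t0, ht0⟩ := hP.ne a ha
  have ht0S := hsub (hP.sub a ha ht0)
  -- the set of tuples through the fixed part
  have hle : a.1.card ≤ ((Q0 (bl I a) t0).filter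
      fun t => Ed (rs Iᶜ t0) (rs (bl I a) t) ⊆ G).card := by
    refine Finset.card_le_card fun t ht => ?_
    have htS := hsub (hP.sub a ha ht)
    rw [Finset.mem_filter]
    constructor
    · simp only [Q0, Finset.mem_filter, Finset.mem_univ, true_and]
      intro j hj
      rcases Finset.mem_union.1 hj with hj | hj
      · exact h.agree t htS t0 ht0S j hj
      · obtain ⟨x, hx, rfl⟩ := Finset.mem_image.1 hj
        rw [(mem_rs.1 (hP.fix a ha t ht hx)).2, (mem_rs.1 (hP.fix a ha t0 ht0 hx)).2]
    · intro e he
      obtain ⟨x, hx, y, hy, rfl⟩ := mem_Ed.1 he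
      have hx' := mem_rs.1 hx
      have hy' := mem_rs.1 hy
      rw [Finset.mem_compl, not_not] at hx'
      have hxy : y.1 ≠ x.1 := fun hc => hy'.1 (Finset.mem_union_left _ (hc ▸ hx'.1))
      have := h.edges t htS x.1 hx'.1 y.1 hxy
      rwa [hy'.2, h.agree t htS t0 ht0S x.1 hx'.1, hx'.2] at this
  have hblk : (bl I a).card ≤ k := (Finset.card_le_univ _).trans (by simp)
  have hE : Xc p (rs Iᶜ t0) (bl I a) (Q0 (bl I a) t0) ∅ G ≤ 4 := by
    by_contra hc
    exact hE0 ⟨((I, bl I a), t0), Finset.mem_univ _, ⟨Finset.subset_union_left, h.card⟩,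
      not_le.1 hc⟩
  have hAc : (rs Iᶜ t0).card = I.card := by
    unfold rs
    rw [compl_compl, Finset.card_image_of_injective _ (fun a b h => (Prod.mk.inj h).1)]
  rw [Xc_eq (fun x hx => by
        have := (mem_rs.1 hx).1
        rw [Finset.mem_compl, not_not] at this
        exact Finset.mem_union_left _ this),
    Finset.filter_true_of_mem (fun _ _ => Finset.empty_subset _), card_Q0, hAc, ← mul_inv,
    inv_mul_le_iff₀ (by positivity)] at hE
  have hQle : (a.1.card : ℝ) ≤ (n : ℝ) ^ (k - (bl I a).card) *
      p ^ (I.card * (k - (bl I a).card)) * 4 := by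
    refine le_trans ?_ (le_of_le_of_eq hE (by push_cast; ring))
    exact_mod_cast hle
  have hsz := hP.size a ha
  have hS := h.size
  obtain ⟨m, hmdef⟩ : ∃ m, m = (bl I a).card := ⟨_, rfl⟩
  have hmI : m = I.card + a.2.card := by rw [hmdef]; exact hcard
  rw [← hmdef] at hQle hblk ⊢
  refine hm m ?_
  have h1 : (n : ℝ) ^ k * θ ^ m * p ^ (I.card * k) ≤
      16 * 8 ^ i * ((n : ℝ) ^ (k - m) * p ^ (I.card * (k - m))) := 
    real1 hθ hmI hS hbig hsz hQle
  exact real5 (by linarith) hθ hp0 hz0 hblk (inv_le_of_inv_le₀ (pow_pos hp0 _)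
    (inv_pow_le hp0 hp1 hz h.card)) h1

lemma step_aux {p θ θ' z : ℝ} (hp0 : 0 < p) (hp1 : p ≤ 1) (hz1 : 1 ≤ z) (hθ : 0 < θ)
    (hθθ' : 8 * (z * θ) ≤ θ')
    {s i : ℕ} {G : Finset (Sym2 (Vtx k n))} {S S' : Finset (Tup k n)}
    {I : Finset (Fin k)} (h : St p θ θ' s G i S I) (hsub : S' ⊆ S)
    (hbig : (S.card : ℝ) ≤ 2 * S'.card)
    {a} (ha : a ∈ parts θ S' I) (hsm : (bl I a).card ≤ s) (hg : Good p θ z I a G) :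
    St p θ θ' s G (i + 1) (a.1.filter fun t => Ed a.2 (rs (bl I a) t) ⊆ G) (bl I a) := by
  have hP := parts_spec hθ S' I
  have hz0 : 0 < z := by linarith
  obtain ⟨hcl, hlo, hup⟩ := hg
  have hAI : ∀ x ∈ a.2, x.1 ∈ bl I a := fun x hx =>
    Finset.mem_union_right _ (Finset.mem_image_of_mem _ hx)
  have hQ0 : (0 : ℝ) < a.1.card := by exact_mod_cast (hP.ne a ha).card_pos
  obtain ⟨T, hT⟩ : ∃ T, T = a.1.filter fun t => Ed a.2 (rs (bl I a) t) ⊆ G := ⟨_, rfl⟩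
  obtain ⟨m, hm⟩ : ∃ m, m = a.2.card * (k - (bl I a).card) := ⟨_, rfl⟩
  have hX : ∀ W, Xc p a.2 (bl I a) a.1 W G =
      ((a.1.card : ℝ) * p ^ m)⁻¹ * ((T.filter fun t => W ⊆ rs (bl I a) t).card : ℝ) := by
    intro W; rw [Xc_eq hAI, ← hT, ← hm, mul_inv]
  have hpos : 0 < (a.1.card : ℝ) * p ^ m := mul_pos hQ0 (pow_pos hp0 _)
  rw [hX, Finset.filter_true_of_mem (fun _ _ => Finset.empty_subset _),
    lt_inv_mul_iff₀ hpos] at hlo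
  have hup' : ∀ W : Finset (Vtx k n), ((T.filter fun t => W ⊆ rs (bl I a) t).card : ℝ) ≤
      ((a.1.card : ℝ) * p ^ m) * (4 * (z * θ) ^ W.card) := by
    intro W
    have := hup W
    rwa [hX, inv_mul_le_iff₀ hpos] at this
  have hTsub : ∀ t ∈ T, t ∈ a.1 ∧ t ∈ S ∧ Ed a.2 (rs (bl I a) t) ⊆ G := by
    intro t ht
    rw [hT, Finset.mem_filter] at ht
    exact ⟨ht.1, hsub (hP.sub a ha ht.1), ht.2⟩
  rw [← hT]
  have hTpos : (0 : ℝ) < T.card := by linarith [mul_pos hpos (by norm_num : (0 : ℝ) < 1 / 2)]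
  refine ⟨Finset.card_pos.1 (by exact_mod_cast hTpos), ?_, ?_, ?_, hsm, ?_⟩
  · intro t ht t' ht' j hj
    rcases Finset.mem_union.1 hj with hj | hj
    · exact h.agree t (hTsub t ht).2.1 t' (hTsub t' ht').2.1 j hj
    · obtain ⟨x, hx, rfl⟩ := Finset.mem_image.1 hj
      rw [(mem_rs.1 (hP.fix a ha t (hTsub t ht).1 hx)).2,
        (mem_rs.1 (hP.fix a ha t' (hTsub t' ht').1 hx)).2]
  · intro W
    rcases Nat.eq_zero_or_pos W.card with hW | hW
    · rw [hW, pow_zero, one_mul]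
      exact_mod_cast Finset.card_filter_le _ _
    · exact real3 (mul_pos hz0 hθ) hTpos hW hθθ' hlo (hup' W)
  · intro t ht u hu v hvu
    obtain ⟨hta, htS, htE⟩ := hTsub t ht
    have hA : ∀ w ∈ a.2.image Prod.fst, (w, t w) ∈ a.2 := by
      intro w hw
      obtain ⟨x, hx, rfl⟩ := Finset.mem_image.1 hw
      rw [(mem_rs.1 (hP.fix a ha t hta hx)).2]; exact hx
    rcases Finset.mem_union.1 hu with hu | hu
    · exact h.edges t htS u hu v hvu
    · by_cases hv : v ∈ bl I a
      · rcases Finset.mem_union.1 hv with hv | hv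
        · rw [Sym2.eq_swap]; exact h.edges t htS v hv u hvu.symm
        · exact hcl (mem_cl.2 ⟨_, hA u hu, _, hA v hv,
            fun hc => hvu (congrArg Prod.fst hc).symm, rfl⟩)
      · exact htE (mem_Ed.2 ⟨_, hA u hu, (v, t v), mem_rs.2 ⟨hv, rfl⟩, rfl⟩)
  · have hcard : (bl I a).card = I.card + a.2.card := hP.card_blocks ha
    have hsz := hP.size a ha
    have hS := h.size
    have hmk : p ^ (a.2.card * k) ≤ p ^ m :=
      pow_le_pow_of_le_one hp0.le hp1 (by rw [hm]; exact Nat.mul_le_mul_left _ (Nat.sub_le _ _))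
    rw [hcard]
    exact real2 hθ hp0 hQ0 hS hbig hsz hmk hlo

/-- `G`-independent family of possible states. -/
noncomputable def fam (𝓗 : Finset (Finset (Tup k n))) (θ : ℝ) : ℕ → Finset (Finset (Tup k n))
  | 0 => {Finset.univ}
  | i + 1 => (fam 𝓗 θ i).biUnion fun S => 𝓗.biUnion fun h =>
      (Finset.univ : Finset (Finset (Fin k))).biUnion fun I => (parts θ (S ∩ h) I).biUnion fun a =>
        (Finset.univ : Finset (Finset (Vtx k n))).image fun N => nx N a.1

lemma card_fam (𝓗 : Finset (Finset (Tup k n))) {θ : ℝ} (hθ : 0 < θ) (i : ℕ) :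
    (fam 𝓗 θ i).card ≤ (𝓗.card * (2 ^ k * (n ^ k * 2 ^ (k * n)))) ^ i := by
  induction i with
  | zero => simp [fam]
  | succ i ih =>
    rw [fam, pow_succ]
    refine (Finset.card_biUnion_le_card_mul _ _ (𝓗.card * (2 ^ k * (n ^ k * 2 ^ (k * n))))
      fun S _ => ?_).trans (Nat.mul_le_mul_right _ ih)
    refine Finset.card_biUnion_le_card_mul _ _ _ fun h _ => ?_
    have h2k : (Finset.univ : Finset (Finset (Fin k))).card = 2 ^ k := by simp [Finset.card_univ]
    rw [← h2k]
    refine Finset.card_biUnion_le_card_mul _ _ _ fun I _ => ?_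
    refine (Finset.card_biUnion_le_card_mul _ _ (2 ^ (k * n)) fun a _ => ?_).trans
      (Nat.mul_le_mul_right _ (parts_spec hθ _ _).card_le)
    refine Finset.card_image_le.trans ?_
    simp [Finset.card_univ]

/-- Survival of `S` under `j` further queries. -/
def Surv (𝓗 : Finset (Finset (Tup k n))) (G : Finset (Sym2 (Vtx k n))) :
    ℕ → Finset (Tup k n) → Prop
  | 0, S => S.Nonempty ∧ ¬ RuledOut G S
  | j + 1, S => ∀ h ∈ 𝓗, Surv 𝓗 G j (S ∩ h) ∨ Surv 𝓗 G j (S \ h)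

lemma Surv.mono {𝓗 : Finset (Finset (Tup k n))} {G : Finset (Sym2 (Vtx k n))} {j : ℕ} :
    ∀ {S S' : Finset (Tup k n)}, S ⊆ S' → Surv 𝓗 G j S → Surv 𝓗 G j S' := by
  induction j with
  | zero =>
    rintro S S' h ⟨h1, h2⟩
    refine ⟨h1.mono h, ?_⟩
    rintro ⟨e, he, heG, hall⟩
    exact h2 ⟨e, he, heG, fun t ht => hall t (h ht)⟩
  | succ j ih =>
    intro S S' h hS x hx
    rcases hS x hx with h1 | h1
    · exact Or.inl (ih (Finset.inter_subset_inter_right h) h1)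
    · exact Or.inr (ih (Finset.sdiff_subset_sdiff h subset_rfl) h1)

/-- The good event. -/
def OK (p θ θ' z : ℝ) (s q : ℕ) (𝓗 : Finset (Finset (Tup k n))) (G : Finset (Sym2 (Vtx k n))) :
    Prop :=
  ¬ E0 p s G ∧ ∀ i < q, ∀ S ∈ fam 𝓗 θ i, ∀ h ∈ 𝓗, ∀ I, Cond θ θ' s (S ∩ h) I →
    ¬ Bad p θ z (S ∩ h) I G

set_option maxHeartbeats 1000000 in
lemma OK.surv {p θ θ' z : ℝ} (hn : 1 ≤ n) (hp0 : 0 < p) (hp1 : p ≤ 1) (hz1 : 1 ≤ z) (hθ : 0 < θ)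
    (hθ'1 : θ' < 1) (hθθ' : 8 * (z * θ) ≤ θ') {s q : ℕ} (hz : (p ^ s)⁻¹ ≤ z)
    (hm : ∀ i < q, ∀ m : ℕ, (n * θ / z) ^ m ≤ 16 * 8 ^ i → m ≤ s)
    {𝓗 : Finset (Finset (Tup k n))} (hcompl : ∀ h ∈ 𝓗, hᶜ ∈ 𝓗) {G : Finset (Sym2 (Vtx k n))}
    (hOK : OK p θ θ' z s q 𝓗 G) (j : ℕ) :
    ∀ i, i + j = q → ∀ S ∈ fam 𝓗 θ i, ∀ I, St p θ θ' s G i S I → Surv 𝓗 G j S := by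
  induction j with
  | zero => exact fun i _ S _ I h => ⟨h.ne, h.not_ruledOut hθ'1⟩
  | succ j ih =>
    intro i hij S hS I hSt x hx
    have hz0 : 0 < z := by linarith
    have hθ'0 : 0 < θ' := lt_of_lt_of_le (by positivity) hθθ'
    have key : ∀ h ∈ 𝓗, (S.card : ℝ) ≤ 2 * (S ∩ h).card → Surv 𝓗 G j (S ∩ h) := by
      intro h hh hbig
      have hsm : ∀ a ∈ parts θ (S ∩ h) I, (bl I a).card ≤ s := fun a ha =>
        part_small hn hp0 hp1 hz1 hθ hz hSt Finset.inter_subset_left hbig hOK.1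
          (hm i (by omega)) ha
      have hSpos : (0 : ℝ) < S.card := by exact_mod_cast hSt.ne.card_pos
      have hc : Cond θ θ' s (S ∩ h) I := by
        refine ⟨Finset.card_pos.1 ?_, ?_, ?_⟩
        · have : (0 : ℝ) < (S ∩ h).card := by linarith
          exact_mod_cast this
        · intro W
          exact real4 hθ'0 (Nat.cast_le.2 (Finset.card_le_card
            (Finset.filter_subset_filter _ Finset.inter_subset_left))) (hSt.spread W) hbig
        · intro a ha
          have h1 := hsm a ha
          have h2 : (bl I a).card = I.card + a.2.card := (parts_spec hθ (S ∩ h) I).card_blocks ha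
          omega
      have hnb := hOK.2 i (by omega) S hS h hh I hc
      unfold Bad at hnb
      push Not at hnb
      obtain ⟨a, ha, hg⟩ := hnb
      have hnew := step_aux hp0 hp1 hz1 hθ hθθ' hSt Finset.inter_subset_left hbig ha (hsm a ha) hg
      obtain ⟨N, hN⟩ := exists_nx a.2 (bl I a) G a.1
      rw [← hN] at hnew
      have hmem : nx N a.1 ∈ fam 𝓗 θ (i + 1) := by
        rw [fam]
        refine Finset.mem_biUnion.2 ⟨S, hS, Finset.mem_biUnion.2 ⟨h, hh, Finset.mem_biUnion.2
          ⟨I, Finset.mem_univ _, Finset.mem_biUnion.2 ⟨a, ha, Finset.mem_image.2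
          ⟨N, Finset.mem_univ _, rfl⟩⟩⟩⟩⟩
      have := ih (i + 1) (by omega) _ hmem _ hnew
      refine this.mono ?_
      exact (nx_subset _ _).trans ((parts_spec hθ (S ∩ h) I).sub a ha)
    have hsplit := Finset.card_inter_add_card_sdiff S x
    by_cases hb : (S.card : ℝ) ≤ 2 * (S ∩ x).card
    · exact Or.inl (key x hx hb)
    · right
      have h1 : S \ x = S ∩ xᶜ := by rw [Finset.sdiff_eq_inter_compl]
      rw [h1]
      refine key _ (hcompl x hx) ?_
      rw [← h1]
      have : ((S ∩ x).card : ℝ) + (S \ x).card = S.card := by exact_mod_cast hsplit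
      linarith

lemma OK.surv_univ {p θ θ' z : ℝ} (hn : 1 ≤ n) (hp0 : 0 < p) (hp1 : p ≤ 1) (hz1 : 1 ≤ z)
    (hθ : 0 < θ) (hnθ : (n : ℝ)⁻¹ ≤ θ)
    (hθ'1 : θ' < 1) (hθθ' : 8 * (z * θ) ≤ θ') {s q : ℕ} (hz : (p ^ s)⁻¹ ≤ z)
    (hm : ∀ i < q, ∀ m : ℕ, (n * θ / z) ^ m ≤ 16 * 8 ^ i → m ≤ s)
    {𝓗 : Finset (Finset (Tup k n))} (hcompl : ∀ h ∈ 𝓗, hᶜ ∈ 𝓗) {G : Finset (Sym2 (Vtx k n))}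
    (hOK : OK p θ θ' z s q 𝓗 G) : Surv 𝓗 G q Finset.univ := by
  refine hOK.surv hn hp0 hp1 hz1 hθ hθ'1 hθθ' hz hm hcompl q 0 (by omega) _
    (by simp [fam]) ∅ ⟨⟨fun _ => ⟨0, hn⟩, Finset.mem_univ _⟩, by simp, ?_, by simp, by simp, ?_⟩
  · have h1 := spread_Q0 hn (θ := θ') (hnθ.trans ?_) (∅ : Finset (Fin k)) (fun _ => ⟨0, hn⟩)
    · simpa [Q0] using h1
    · nlinarith
  · simp

end Step
end BC

open Finset

namespace BC

section Union

variable {k n : ℕ}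

lemma fam_union_card (hn : 1 ≤ n) (𝓗 : Finset (Finset (Tup k n))) (h𝓗 : 𝓗.Nonempty) {θ : ℝ}
    (hθ : 0 < θ) (q : ℕ) :
    ((Finset.range q).biUnion fun i => fam 𝓗 θ i).card ≤
      q * (𝓗.card * (2 ^ k * (n ^ k * 2 ^ (k * n)))) ^ q := by
  have h1 := Finset.card_biUnion_le_card_mul (Finset.range q) (fun i => fam 𝓗 θ i)
    ((𝓗.card * (2 ^ k * (n ^ k * 2 ^ (k * n)))) ^ q) ?_
  · simpa using h1
  · intro i hi
    refine (card_fam 𝓗 hθ i).trans (Nat.pow_le_pow_right ?_ (Finset.mem_range.1 hi).le)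
    have : 0 < 𝓗.card := h𝓗.card_pos
    have : 0 < n := hn
    positivity

lemma OK_bound (hn : 1 ≤ n) {p θ θ' z : ℝ} (hp0 : 0 ≤ p) (hp1 : p ≤ 1) (hθ : 0 < θ) {s q : ℕ}
    (𝓗 : Finset (Finset (Tup k n))) (h𝓗 : 𝓗.Nonempty) {b e : ℝ} (hb0 : 0 ≤ b)
    (he : Pr (potEdges k n) p (E0 p s) ≤ e)
    (hb : ∀ (S : Finset (Tup k n)) I, Cond θ θ' s S I →
      Pr (potEdges k n) p (Bad p θ z S I) ≤ b) :
    Pr (potEdges k n) p (fun G => ¬ OK p θ θ' z s q 𝓗 G) ≤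
      e + ((q * (𝓗.card * (2 ^ k * (n ^ k * 2 ^ (k * n)))) ^ q * (𝓗.card * 2 ^ k) : ℕ) : ℝ) * b := by
  obtain ⟨F, hF⟩ : ∃ F, F = (Finset.range q).biUnion fun i => fam 𝓗 θ i := ⟨_, rfl⟩
  have hFc := fam_union_card hn 𝓗 h𝓗 hθ q
  rw [← hF] at hFc
  have h1 := Pr_exists (E := potEdges k n) hp0 hp1
    (F ×ˢ (𝓗 ×ˢ (Finset.univ : Finset (Finset (Fin k)))))
    (fun x G => Cond θ θ' s (x.1 ∩ x.2.1) x.2.2 ∧ Bad p θ z (x.1 ∩ x.2.1) x.2.2 G) (b := b)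
    (fun x _ => Pr_and_const hp0 hp1 _ _ hb0 (hb _ _))
  have h2 : (((F ×ˢ (𝓗 ×ˢ (Finset.univ : Finset (Finset (Fin k))))).card : ℕ) : ℝ) ≤
      ((q * (𝓗.card * (2 ^ k * (n ^ k * 2 ^ (k * n)))) ^ q * (𝓗.card * 2 ^ k) : ℕ) : ℝ) := by
    refine Nat.cast_le.2 ?_
    rw [Finset.card_product, Finset.card_product, Finset.card_univ, Fintype.card_finset,
      Fintype.card_fin]
    exact Nat.mul_le_mul_right _ hFc
  refine le_trans ?_ (add_le_add he (h1.trans (mul_le_mul_of_nonneg_right h2 hb0)))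
  refine le_trans (Pr_mono hp0 hp1 ?_) (Pr_or hp0 hp1 _ _)
  intro G _ hG
  by_contra hc
  rw [not_or] at hc
  refine hG ⟨hc.1, fun i hi S hS h hh I hC hB => hc.2 ⟨(S, h, I), ?_, hC, hB⟩⟩
  rw [Finset.mem_product, Finset.mem_product, hF]
  exact ⟨Finset.mem_biUnion.2 ⟨i, Finset.mem_range.2 hi, hS⟩, hh, Finset.mem_univ _⟩

end Union

section Halfspaces

variable {k n : ℕ}

open Classical in
/-- Threshold sets of tuples. -/
noncomputable def HS (k n : ℕ) : Finset (Finset (Tup k n)) :=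
  Finset.univ.filter fun h => ∃ (a : Vtx k n → ℤ) (b : ℤ), ∀ t, t ∈ h ↔ b ≤ ∑ i, a (i, t i)

lemma mem_HS {h : Finset (Tup k n)} :
    h ∈ HS k n ↔ ∃ (a : Vtx k n → ℤ) (b : ℤ), ∀ t, t ∈ h ↔ b ≤ ∑ i, a (i, t i) := by
  simp [HS]

lemma HS_compl {h : Finset (Tup k n)} (hh : h ∈ HS k n) : hᶜ ∈ HS k n := by
  obtain ⟨a, b, hab⟩ := mem_HS.1 hh
  refine mem_HS.2 ⟨fun x => - a x, -b + 1, fun t => ?_⟩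
  rw [Finset.mem_compl, hab, Finset.sum_neg_distrib]
  omega

lemma HS_nonempty : (HS k n).Nonempty :=
  ⟨∅, mem_HS.2 ⟨fun _ => 0, 1, fun t => by simp⟩⟩

lemma HS_shatter {s : Finset (Tup k n)} (hs : (HS k n).Shatters s) : s.card ≤ k * n + 1 := by
  classical
  by_contra hc
  push Not at hc
  let φ : Tup k n → Option (Vtx k n) → ℝ := fun t o =>
    match o with
    | none => 1
    | some x => if t x.1 = x.2 then 1 else 0
  have hli : ¬ LinearIndependent ℝ (fun t : s => φ t) := by
    intro h
    have := h.fintype_card_le_finrank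
    simp at this
    omega
  obtain ⟨g, hg, i0, hi0⟩ := Fintype.not_linearIndependent_iff.1 hli
  have hsum : ∑ t : s, g t = 0 := by
    have := congrFun hg none
    simpa [φ] using this
  have hx : ∀ x : Vtx k n, ∑ t : s, g t * (if (t : Tup k n) x.1 = x.2 then 1 else 0) = 0 := by
    intro x
    have := congrFun hg (some x)
    simpa [φ] using this
  obtain ⟨t1, -, ht1⟩ : ∃ t ∈ (Finset.univ : Finset s), g t < 0 := by
    by_contra hcon
    push Not at hcon
    exact hi0 ((Finset.sum_eq_zero_iff_of_nonneg hcon).1 hsum i0 (Finset.mem_univ _))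
  obtain ⟨h, hh, hsh⟩ := hs (t := s.filter fun t => ∃ ht : t ∈ s, 0 < g ⟨t, ht⟩)
    (Finset.filter_subset _ _)
  obtain ⟨a, b, hab⟩ := mem_HS.1 hh
  have hiff : ∀ t : s, (b ≤ ∑ i, a (i, (t : Tup k n) i)) ↔ 0 < g t := by
    intro t
    rw [← hab]
    have := Finset.ext_iff.1 hsh t
    simp only [Finset.mem_inter, Finset.mem_filter, t.2, true_and, exists_true_left] at this
    exact this
  have hzero : ∑ t : s, g t * ((∑ i, (a (i, (t : Tup k n) i) : ℝ)) - b) = 0 := by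
    have e1 : ∀ t : s, (∑ i, (a (i, (t : Tup k n) i) : ℝ)) =
        ∑ x : Vtx k n, (a x : ℝ) * (if (t : Tup k n) x.1 = x.2 then 1 else 0) := by
      intro t
      rw [Fintype.sum_prod_type]
      refine Finset.sum_congr rfl fun i _ => ?_
      simp
    simp only [mul_sub, Finset.sum_sub_distrib, ← Finset.sum_mul, hsum, zero_mul, sub_zero, e1,
      Finset.mul_sum]
    rw [Finset.sum_comm]
    refine Finset.sum_eq_zero fun x _ => ?_
    have h0 := congrArg (fun y => (a x : ℝ) * y) (hx x)
    simp only [mul_zero, Finset.mul_sum] at h0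
    refine Eq.trans (Finset.sum_congr rfl fun t _ => ?_) h0
    ring
  have hneg : ∀ t : s, 0 ≤ g t * ((∑ i, (a (i, (t : Tup k n) i) : ℝ)) - b) := by
    intro t
    by_cases hb : b ≤ ∑ i, a (i, (t : Tup k n) i)
    · have h1 : (b : ℝ) ≤ ∑ i, (a (i, (t : Tup k n) i) : ℝ) := by exact_mod_cast hb
      exact mul_nonneg ((hiff t).1 hb).le (by linarith)
    · have h1 : (∑ i, (a (i, (t : Tup k n) i) : ℝ)) < b := by exact_mod_cast not_le.1 hb
      have h2 : g t ≤ 0 := not_lt.1 fun h => hb ((hiff t).2 h)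
      exact mul_nonneg_of_nonpos_of_nonpos h2 (by linarith)
  have h1 := (Finset.sum_eq_zero_iff_of_nonneg fun t _ => hneg t).1 hzero t1 (Finset.mem_univ _)
  have hb : ¬ b ≤ ∑ i, a (i, (t1 : Tup k n) i) := fun h => absurd ((hiff t1).1 h) (by linarith)
  have h2 : (∑ i, (a (i, (t1 : Tup k n) i) : ℝ)) < b := by exact_mod_cast not_le.1 hb
  rcases mul_eq_zero.1 h1 with h3 | h3 <;> linarith

lemma sum_choose_le (N d : ℕ) : ∑ j ∈ Finset.Iic d, N.choose j ≤ (N + 1) ^ d := by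
  rw [add_pow]
  have : Finset.Iic d = Finset.range (d + 1) := by ext; simp
  rw [this]
  refine Finset.sum_le_sum fun j hj => ?_
  have hj' := Finset.mem_range.1 hj
  have h1 : 1 ≤ d.choose j := Nat.choose_pos (by omega)
  calc N.choose j ≤ N ^ j := Nat.choose_le_pow _ _
    _ = N ^ j * 1 ^ (d - j) * 1 := by simp
    _ ≤ _ := by gcongr; exact_mod_cast h1

lemma card_HS : (HS k n).card ≤ (n ^ k + 1) ^ (k * n + 1) := by
  refine (Finset.card_le_card_shatterer _).trans (Finset.card_shatterer_le_sum_vcDim.trans ?_)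
  refine (sum_choose_le _ _).trans ?_
  have : Fintype.card (Tup k n) = n ^ k := by simp
  rw [this]
  refine Nat.pow_le_pow_right (by omega) ?_
  exact Finset.sup_le fun s hs => HS_shatter (Finset.mem_shatterer.1 hs)

end Halfspaces
end BC

open Finset

namespace BC

/-- Trees with dead leaves. -/
inductive BT (k n : ℕ) : Type
  | leaf : Finset (Tup k n) → BT k n
  | dead : BT k n
  | node : Finset (Tup k n) → BT k n → BT k n → BT k n

namespace BT

variable {k n : ℕ}

/-- Root set. -/
def rt : BT k n → Finset (Tup k n)
  | leaf Q => Q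
  | dead => ∅
  | node f _ _ => f

/-- Number of live leaves. -/
def sz : BT k n → ℕ
  | leaf _ => 1
  | dead => 0
  | node _ l r => l.sz + r.sz

/-- Validity of the tree on `S`. -/
def Cov (𝓗 : Finset (Finset (Tup k n))) (G : Finset (Sym2 (Vtx k n))) (S : Finset (Tup k n)) :
    BT k n → Prop
  | leaf Q => Q ∈ 𝓗 ∧ (Q = ∅ ∨ RuledOut G Q)
  | dead => True
  | node f l r => f ∈ 𝓗 ∧ S ∩ f ⊆ l.rt ∪ r.rt ∧ Cov 𝓗 G S l ∧ Cov 𝓗 G S r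

variable {𝓗 : Finset (Finset (Tup k n))} {G : Finset (Sym2 (Vtx k n))}

lemma Cov.mono {S S' : Finset (Tup k n)} (h : S' ⊆ S) : ∀ {τ : BT k n}, Cov 𝓗 G S τ → Cov 𝓗 G S' τ
  | leaf _, hτ => hτ
  | dead, _ => trivial
  | node _ _ _, hτ => ⟨hτ.1, (Finset.inter_subset_inter_right h).trans hτ.2.1, hτ.2.2.1.mono h,
      hτ.2.2.2.mono h⟩

lemma Cov.rt_mem {S : Finset (Tup k n)} (h0 : ∅ ∈ 𝓗) : ∀ {τ : BT k n}, Cov 𝓗 G S τ → τ.rt ∈ 𝓗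
  | leaf _, hτ => hτ.1
  | dead, _ => h0
  | node _ _ _, hτ => hτ.1

lemma ruledOut_mono {Q Q' : Finset (Tup k n)} (h : Q ⊆ Q') (hQ : RuledOut G Q') :
    RuledOut G Q := by
  obtain ⟨e, he, heG, hall⟩ := hQ
  exact ⟨e, he, heG, fun t ht => hall t (h ht)⟩

lemma Cov.small {S : Finset (Tup k n)} : ∀ {τ : BT k n}, Cov 𝓗 G S τ →
    (τ.sz = 0 → S ∩ τ.rt = ∅) ∧ (τ.sz ≤ 1 → S ∩ τ.rt = ∅ ∨ RuledOut G (S ∩ τ.rt))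
  | leaf Q, hτ => by
    refine ⟨fun h => by simp [sz] at h, fun _ => ?_⟩
    rcases hτ.2 with h | h
    · left; simp [rt, h]
    · right; exact ruledOut_mono Finset.inter_subset_right h
  | dead, _ => ⟨fun _ => by simp [rt], fun _ => by simp [rt]⟩
  | node f l r, hτ => by
    obtain ⟨-, hs, hl, hr⟩ := hτ
    have hl' := hl.small
    have hr' := hr.small
    have key : ∀ (t u : BT k n), S ∩ f ⊆ t.rt ∪ u.rt → S ∩ u.rt = ∅ → S ∩ f ⊆ S ∩ t.rt := by
      intro t u h1 h2 y hy
      have hyS := (Finset.mem_inter.1 hy).1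
      refine Finset.mem_inter.2 ⟨hyS, ?_⟩
      rcases Finset.mem_union.1 (h1 hy) with h | h
      · exact h
      · exact absurd (Finset.mem_inter.2 ⟨hyS, h⟩) (by simp [h2])
    simp only [sz, rt]
    constructor
    · intro h
      have h1 := key l r hs (hr'.1 (by omega))
      rw [hl'.1 (by omega)] at h1
      exact Finset.subset_empty.1 h1
    · intro h
      rcases Nat.eq_zero_or_pos r.sz with h0 | h0
      · have h1 := key l r hs (hr'.1 h0)
        rcases hl'.2 (by omega) with h2 | h2
        · left; rw [h2] at h1; exact Finset.subset_empty.1 h1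
        · right; exact ruledOut_mono h1 h2
      · have h1 := key r l (by rwa [Finset.union_comm]) (hl'.1 (by omega))
        rcases hr'.2 (by omega) with h2 | h2
        · left; rw [h2] at h1; exact Finset.subset_empty.1 h1
        · right; exact ruledOut_mono h1 h2

lemma Cov.split (h0 : ∅ ∈ 𝓗) {S : Finset (Tup k n)} {B : ℕ} (hB : 1 ≤ B) : ∀ {τ : BT k n},
    Cov 𝓗 G S τ → B < τ.sz → ∃ x τ' : BT k n, Cov 𝓗 G S x ∧ τ.sz = τ'.sz + x.sz ∧ x.sz ≤ B ∧
      B < 2 * x.sz ∧ τ'.rt = τ.rt ∧ ∀ S', S' ⊆ S → S' ∩ x.rt = ∅ → Cov 𝓗 G S' τ'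
  | leaf Q, _, h => by simp only [sz] at h; omega
  | dead, _, h => by simp only [sz] at h; omega
  | node f l r, hτ, h => by
    obtain ⟨hf, hs, hl, hr⟩ := hτ
    simp only [sz] at h
    rcases le_total r.sz l.sz with hlr | hlr
    · by_cases hlB : l.sz ≤ B
      · refine ⟨l, node f dead r, hl, by simp [sz]; omega, hlB, by omega, rfl, ?_⟩
        intro S' hS' hd
        refine ⟨hf, ?_, trivial, hr.mono hS'⟩
        intro y hy
        have hy' := Finset.mem_inter.1 hy
        rcases Finset.mem_union.1 (hs (Finset.mem_inter.2 ⟨hS' hy'.1, hy'.2⟩)) with h1 | h1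
        · exact absurd (Finset.mem_inter.2 ⟨hy'.1, h1⟩) (by simp [hd])
        · exact Finset.mem_union_right _ h1
      · obtain ⟨x, l', hx, hsz, hxB, hxB', hrt, hcov⟩ := hl.split h0 hB (not_le.1 hlB)
        refine ⟨x, node f l' r, hx, by simp [sz]; omega, hxB, hxB', rfl, ?_⟩
        intro S' hS' hd
        refine ⟨hf, ?_, hcov S' hS' hd, hr.mono hS'⟩
        rw [hrt]
        exact (Finset.inter_subset_inter_right hS').trans hs
    · by_cases hlB : r.sz ≤ B
      · refine ⟨r, node f l dead, hr, by simp [sz], hlB, by omega, rfl, ?_⟩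
        intro S' hS' hd
        refine ⟨hf, ?_, hl.mono hS', trivial⟩
        intro y hy
        have hy' := Finset.mem_inter.1 hy
        rcases Finset.mem_union.1 (hs (Finset.mem_inter.2 ⟨hS' hy'.1, hy'.2⟩)) with h1 | h1
        · exact Finset.mem_union_left _ h1
        · exact absurd (Finset.mem_inter.2 ⟨hy'.1, h1⟩) (by simp [hd])
      · obtain ⟨x, r', hx, hsz, hxB, hxB', hrt, hcov⟩ := hr.split h0 hB (not_le.1 hlB)
        refine ⟨x, node f l r', hx, by simp [sz]; omega, hxB, hxB', rfl, ?_⟩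
        intro S' hS' hd
        refine ⟨hf, ?_, hl.mono hS', hcov S' hS' hd⟩
        rw [hrt]
        exact (Finset.inter_subset_inter_right hS').trans hs

lemma surv_zero (h0 : ∅ ∈ 𝓗) {S : Finset (Tup k n)} : ∀ {j : ℕ}, Surv 𝓗 G j S → Surv 𝓗 G 0 S
  | 0, h => h
  | j + 1, h => by
    rcases h ∅ h0 with h | h
    · exact surv_zero h0 (h.mono Finset.inter_subset_left)
    · exact surv_zero h0 (h.mono Finset.sdiff_subset)

lemma not_surv (h0 : ∅ ∈ 𝓗) (j : ℕ) : ∀ (τ : BT k n) (S : Finset (Tup k n)), S ⊆ τ.rt →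
    Cov 𝓗 G S τ → (τ.sz : ℝ) ≤ (3 / 2) ^ j → ¬ Surv 𝓗 G j S := by
  have base : ∀ (j : ℕ) (τ : BT k n) (S : Finset (Tup k n)), S ⊆ τ.rt →
    Cov 𝓗 G S τ → τ.sz ≤ 1 → ¬ Surv 𝓗 G j S := by
    intro j τ S hS hc hsz hsv
    obtain ⟨h1, h2⟩ := surv_zero h0 hsv
    have h3 := hc.small.2 hsz
    rw [Finset.inter_eq_left.2 hS] at h3
    rcases h3 with h3 | h3
    · exact h1.ne_empty h3
    · exact h2 h3
  induction j with
  | zero =>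
    intro τ S hS hc hsz
    exact base 0 τ S hS hc (by simpa using hsz)
  | succ j ih =>
    intro τ S hS hc hsz
    by_cases h1 : τ.sz ≤ 1
    · exact base _ τ S hS hc h1
    · intro hsv
      obtain ⟨x, τ', hx, hsz', hxB, hxB', hrt, hcov⟩ :=
        hc.split h0 (B := 2 * τ.sz / 3) (by omega) (by omega)
      have e1 : 3 * x.sz ≤ 2 * τ.sz := by omega
      have e2 : 3 * τ'.sz ≤ 2 * τ.sz := by omega
      have e1' : (3 : ℝ) * x.sz ≤ 2 * τ.sz := by exact_mod_cast e1
      have e2' : (3 : ℝ) * τ'.sz ≤ 2 * τ.sz := by exact_mod_cast e2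
      rw [pow_succ] at hsz
      rcases hsv x.rt (hx.rt_mem h0) with h | h
      · exact ih x _ Finset.inter_subset_right (hx.mono Finset.inter_subset_left)
          (by linarith) h
      · refine ih τ' _ ?_ (hcov _ Finset.sdiff_subset (by
          rw [Finset.sdiff_inter_self])) (by linarith) h
        rw [hrt]
        exact Finset.sdiff_subset.trans hS

end BT

section Convert

variable {k n : ℕ}

/-- Assignment of a tuple. -/
def asg (t : Tup k n) : Fin (k * n) → Bool := fun w =>
  decide (t (finProdFinEquiv.symm w).1 = (finProdFinEquiv.symm w).2)

lemma asg_vidx (t : Tup k n) (u : Vtx k n) : asg t (vidx u) = decide (t u.1 = u.2) := by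
  simp [asg, vidx]

/-- Tuples ruled out by a line. -/
def Qf (f : BFunc (k * n)) : Finset (Tup k n) := Finset.univ.filter fun t => f (asg t) = true

lemma mem_Qf {f : BFunc (k * n)} {t : Tup k n} : t ∈ Qf f ↔ f (asg t) = true := by simp [Qf]

lemma empty_HS : (∅ : Finset (Tup k n)) ∈ HS k n :=
  mem_HS.2 ⟨fun _ => 0, 1, fun t => by simp⟩

lemma Qf_CP {f : BFunc (k * n)} (hf : f ∈ CPlines (k * n)) : Qf f ∈ HS k n := by
  obtain ⟨a, b, h⟩ := hf
  refine mem_HS.2 ⟨fun x => - a (vidx x), -b + 1, fun t => ?_⟩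
  have h1 : ∑ w, a w * (if asg t w then 1 else 0) = ∑ i, a (vidx (i, t i)) := by
    rw [← Equiv.sum_comp finProdFinEquiv, Fintype.sum_prod_type]
    refine Finset.sum_congr rfl fun i _ => ?_
    have : ∀ v : Fin n, a (finProdFinEquiv (i, v)) *
        (if asg t (finProdFinEquiv (i, v)) = true then (1 : ℤ) else 0) =
        if t i = v then a (finProdFinEquiv (i, v)) else 0 := by
      intro v
      simp [asg]
    simp only [this]
    simp [vidx]
  rw [mem_Qf, h, h1, Finset.sum_neg_distrib]
  simp

lemma Qf_clause {G : Finset (Sym2 (Vtx k n))} {c : Clause (k * n)} (hc : c ∈ bcliqueU k n G) :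
    Qf (falsInd c) ∈ HS k n ∧ (Qf (falsInd c) = ∅ ∨ RuledOut G (Qf (falsInd c))) := by
  classical
  unfold bcliqueU at hc
  rcases Finset.mem_union.1 hc with hc | hc
  · obtain ⟨⟨u, v⟩, huv, rfl⟩ := Finset.mem_image.1 hc
    simp only [Finset.mem_filter, Finset.mem_univ, true_and] at huv
    obtain ⟨huv, hG⟩ := huv
    have hmem : ∀ t, t ∈ Qf (falsInd (fun w => if w = vidx u ∨ w = vidx v then some false else none :
      Clause (k * n))) ↔ t u.1 = u.2 ∧ t v.1 = v.2 := by
      intro t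
      rw [mem_Qf]
      simp only [falsInd, decide_eq_true_eq]
      constructor
      · intro h
        have h1 := h (vidx u) false (by simp)
        have h2 := h (vidx v) false (by simp)
        rw [asg_vidx] at h1 h2
        simpa using And.intro h1 h2
      · rintro ⟨h1, h2⟩ i b hib
        split_ifs at hib with hi
        simp only [Option.some.injEq] at hib
        subst hib
        rcases hi with rfl | rfl <;> simp [asg_vidx, h1, h2]
    constructor
    · refine mem_HS.2 ⟨fun x => (if x = u then 1 else 0) + (if x = v then 1 else 0), 2, fun t => ?_⟩
      rw [hmem, Finset.sum_add_distrib]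
      have e : ∀ u : Vtx k n, ∑ i, (if (i, t i) = u then (1 : ℤ) else 0) =
          if t u.1 = u.2 then 1 else 0 := by
        intro u
        rw [Finset.sum_eq_single u.1]
        · simp [Prod.ext_iff]
        · intro b _ hb
          simp [Prod.ext_iff, hb]
        · simp
      rw [e, e]
      by_cases h1 : t u.1 = u.2 <;> by_cases h2 : t v.1 = v.2 <;> simp [h1, h2]
    · right
      refine ⟨s(u, v), by simpa [potEdges] using huv, hG, fun t ht w hw => ?_⟩
      have := (hmem t).1 ht
      rcases Sym2.mem_iff.1 hw with rfl | rfl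
      · exact this.1
      · exact this.2
  · obtain ⟨i, -, rfl⟩ := Finset.mem_image.1 hc
    have : Qf (falsInd (fun w => if (finProdFinEquiv.symm w).1 = i then some true else none :
      Clause (k * n))) = ∅ := by
      rw [Finset.eq_empty_iff_forall_notMem]
      intro t ht
      rw [mem_Qf] at ht
      simp only [falsInd, decide_eq_true_eq] at ht
      have := ht (vidx (i, t i)) true (by simp [vidx])
      rw [asg_vidx] at this
      simp at this
    rw [this]
    exact ⟨empty_HS, Or.inl rfl⟩

lemma exists_BT {G : Finset (Sym2 (Vtx k n))} : ∀ π : SemProof (k * n),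
    SemProof.Valid (CPlines (k * n)) (bcliqueU k n G) π →
    ∃ τ : BT k n, τ.Cov (HS k n) G Finset.univ ∧ τ.rt = Qf π.root ∧ τ.sz ≤ π.length
  | .leaf f, h => by
    obtain ⟨c, hc, rfl⟩ := h
    exact ⟨.leaf _, Qf_clause hc, rfl, le_refl _⟩
  | .node1 f s, h => by
    obtain ⟨h | ⟨hf, him⟩, hs⟩ := h
    · obtain ⟨c, hc, rfl⟩ := h
      exact ⟨.leaf _, Qf_clause hc, rfl, by simp [BT.sz, SemProof.length]⟩
    · obtain ⟨τ, h1, h2, h3⟩ := exists_BT s hs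
      refine ⟨.node (Qf f) τ .dead, ⟨Qf_CP hf, ?_, h1, trivial⟩, rfl, ?_⟩
      · intro t ht
        refine Finset.mem_union_left _ ?_
        rw [h2]
        exact mem_Qf.2 (him _ (mem_Qf.1 (Finset.mem_inter.1 ht).2))
      · simp only [BT.sz, SemProof.length]; omega
  | .node2 f s t, h => by
    obtain ⟨h | ⟨hf, him⟩, hs, ht⟩ := h
    · obtain ⟨c, hc, rfl⟩ := h
      exact ⟨.leaf _, Qf_clause hc, rfl, by simp [BT.sz, SemProof.length]⟩
    · obtain ⟨τ, h1, h2, h3⟩ := exists_BT s hs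
      obtain ⟨τ', h1', h2', h3'⟩ := exists_BT t ht
      refine ⟨.node (Qf f) τ τ', ⟨Qf_CP hf, ?_, h1, h1'⟩, rfl, ?_⟩
      · intro t ht
        rw [h2, h2']
        rcases him _ (mem_Qf.1 (Finset.mem_inter.1 ht).2) with h | h
        · exact Finset.mem_union_left _ (mem_Qf.2 h)
        · exact Finset.mem_union_right _ (mem_Qf.2 h)
      · simp only [BT.sz, SemProof.length]; omega

lemma refutation_length {G : Finset (Sym2 (Vtx k n))} {q : ℕ}
    (hS : Surv (HS k n) G q Finset.univ) (π : SemProof (k * n))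
    (hπ : IsRefutation (CPlines (k * n)) (bcliqueU k n G) π) :
    ((3 : ℝ) / 2) ^ q ≤ π.length := by
  obtain ⟨τ, h1, h2, h3⟩ := exists_BT π hπ.1
  by_contra hc
  push Not at hc
  refine BT.not_surv empty_HS q τ Finset.univ ?_ h1 ?_ hS
  · intro t _
    rw [h2, mem_Qf]
    exact hπ.2 _
  · have : (τ.sz : ℝ) ≤ π.length := by exact_mod_cast h3
    linarith

end Convert
end BC

open Finset

namespace BC

section Numerics

lemma pow_le_exp {a x : ℝ} (ha : 0 < a) (hx : Real.log a ≤ x) (m : ℕ) :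
    a ^ m ≤ Real.exp (m * x) := by
  rw [← Real.exp_log (pow_pos ha m), Real.log_pow]
  exact Real.exp_le_exp.2 (mul_le_mul_of_nonneg_left hx (Nat.cast_nonneg _))

lemma two_pow_le_exp (m : ℕ) : (2 : ℝ) ^ m ≤ Real.exp m := by
  have := pow_le_exp (a := 2) (x := 1) (by norm_num)
    ((Real.log_two_lt_d9.le).trans (by norm_num)) m
  simpa using this

lemma half_pow_le_exp (m : ℕ) : ((1 : ℝ) / 2) ^ m ≤ Real.exp (-(m / 2)) := by
  have := pow_le_exp (a := 1 / 2) (x := -(1 / 2)) (by norm_num)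
    (by rw [one_div, Real.log_inv]; linarith [Real.log_two_gt_d9]) m
  refine this.trans (Real.exp_le_exp.2 (by linarith))

variable {y : ℝ} {k n s q M r : ℕ}

lemma num_b (hy : 100 ≤ y) (hn : (n : ℝ) = y ^ 100) (hk : (k : ℝ) ≤ y ^ 2)
    (hL : Real.log n ≤ y) (hM : (M : ℝ) ≤ y ^ 50) (hM' : y ^ 50 / 2 ≤ M)
    (hr' : y ^ 70 / 2 ≤ r) :
    (n ^ k : ℝ) ^ M * Real.exp (-(1 / (8 * (8 * (y ^ 136)⁻¹)))) +
      ((n ^ k : ℝ) ^ M * (2 ^ k * n ^ k : ℝ) ^ M * (1 / 2) ^ (r * M) +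
      2 ^ (k * n) * Real.exp (-(1 / (8 * (8 * (y ^ 164)⁻¹))))) ≤
    3 * Real.exp (3 * y ^ 102 - y ^ 120 / 64) := by
  have hy0 : 0 < y := by linarith
  have hn0 : (0 : ℝ) < n := by rw [hn]; positivity
  have hkM : (k : ℝ) * M ≤ y ^ 52 := by
    calc (k : ℝ) * M ≤ y ^ 2 * y ^ 50 := by gcongr
      _ = _ := by ring
  have hkMy : (k : ℝ) * M * y ≤ y ^ 53 := by
    calc (k : ℝ) * M * y ≤ y ^ 52 * y := by gcongr
      _ = _ := by ring
  have hnkM : (n ^ k : ℝ) ^ M ≤ Real.exp (y ^ 53) := by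
    rw [← pow_mul]
    refine (pow_le_exp hn0 hL _).trans (Real.exp_le_exp.2 ?_)
    push_cast; exact hkMy
  have h2kM : ((2 : ℝ) ^ k) ^ M ≤ Real.exp (y ^ 52) := by
    rw [← pow_mul]
    refine (two_pow_le_exp _).trans (Real.exp_le_exp.2 ?_)
    push_cast; exact hkM
  have hrM : ((1 : ℝ) / 2) ^ (r * M) ≤ Real.exp (-(y ^ 120 / 8)) := by
    refine (half_pow_le_exp _).trans (Real.exp_le_exp.2 ?_)
    push_cast
    have : y ^ 70 / 2 * (y ^ 50 / 2) ≤ (r : ℝ) * M := by gcongr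
    have e : y ^ 70 / 2 * (y ^ 50 / 2) = y ^ 120 / 4 := by ring
    linarith
  have hkn : (2 : ℝ) ^ (k * n) ≤ Real.exp (y ^ 102) := by
    refine (two_pow_le_exp _).trans (Real.exp_le_exp.2 ?_)
    push_cast
    calc (k : ℝ) * n ≤ y ^ 2 * y ^ 100 := by rw [hn]; gcongr
      _ = _ := by ring
  have hy1 : 1 ≤ y := by linarith
  have p1 : y ^ 53 ≤ y ^ 102 := pow_le_pow_right₀ hy1 (by norm_num)
  have p2 : y ^ 52 ≤ y ^ 102 := pow_le_pow_right₀ hy1 (by norm_num)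
  have p3 : y ^ 120 ≤ y ^ 136 := pow_le_pow_right₀ hy1 (by norm_num)
  have p4 : y ^ 120 ≤ y ^ 164 := pow_le_pow_right₀ hy1 (by norm_num)
  have p5 : 0 < y ^ 102 := by positivity
  have p6 : 0 < y ^ 120 := by positivity
  have i1 : 1 / (8 * (8 * (y ^ 136)⁻¹)) = y ^ 136 / 64 := by field_simp; norm_num
  have i2 : 1 / (8 * (8 * (y ^ 164)⁻¹)) = y ^ 164 / 64 := by field_simp; norm_num
  have t1 : (n ^ k : ℝ) ^ M * Real.exp (-(1 / (8 * (8 * (y ^ 136)⁻¹)))) ≤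
      Real.exp (3 * y ^ 102 - y ^ 120 / 64) := by
    rw [i1]
    refine (mul_le_mul_of_nonneg_right hnkM (Real.exp_pos _).le).trans ?_
    rw [← Real.exp_add]
    exact Real.exp_le_exp.2 (by linarith)
  have t3 : (2 : ℝ) ^ (k * n) * Real.exp (-(1 / (8 * (8 * (y ^ 164)⁻¹)))) ≤
      Real.exp (3 * y ^ 102 - y ^ 120 / 64) := by
    rw [i2]
    refine (mul_le_mul_of_nonneg_right hkn (Real.exp_pos _).le).trans ?_
    rw [← Real.exp_add]
    exact Real.exp_le_exp.2 (by linarith)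
  have t2 : (n ^ k : ℝ) ^ M * (2 ^ k * n ^ k : ℝ) ^ M * (1 / 2) ^ (r * M) ≤
      Real.exp (3 * y ^ 102 - y ^ 120 / 64) := by
    rw [mul_pow]
    calc (n ^ k : ℝ) ^ M * ((2 ^ k) ^ M * (n ^ k : ℝ) ^ M) * (1 / 2) ^ (r * M)
        ≤ Real.exp (y ^ 53) * (Real.exp (y ^ 52) * Real.exp (y ^ 53)) *
          Real.exp (-(y ^ 120 / 8)) := by gcongr
      _ = Real.exp (y ^ 53 + (y ^ 52 + y ^ 53) + -(y ^ 120 / 8)) := by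
          rw [Real.exp_add, Real.exp_add, Real.exp_add]
      _ ≤ _ := Real.exp_le_exp.2 (by linarith)
  linarith

lemma num_U (hy : 100 ≤ y) (hn : (n : ℝ) = y ^ 100) (hk : (k : ℝ) ≤ y ^ 2)
    (hq : (q : ℝ) ≤ y ^ 2) (hL : Real.log n ≤ y) :
    (((q * ((HS k n).card * (2 ^ k * (n ^ k * 2 ^ (k * n)))) ^ q * ((HS k n).card * 2 ^ k) : ℕ)) : ℝ)
      ≤ Real.exp (13 * y ^ 107) := by
  have hy0 : 0 < y := by linarith
  have hy1 : 1 ≤ y := by linarith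
  have hn0 : (0 : ℝ) < n := by rw [hn]; positivity
  have hn1 : (1 : ℝ) ≤ n := by rw [hn]; exact one_le_pow₀ hy1
  have hkL : (k : ℝ) * y ≤ y ^ 3 := by
    calc (k : ℝ) * y ≤ y ^ 2 * y := by gcongr
      _ = _ := by ring
  have hkn : (k : ℝ) * n ≤ y ^ 102 := by
    calc (k : ℝ) * n ≤ y ^ 2 * y ^ 100 := by rw [hn]; gcongr
      _ = _ := by ring
  have hnk : (n : ℝ) ^ k ≤ Real.exp (y ^ 3) :=
    (pow_le_exp hn0 hL _).trans (Real.exp_le_exp.2 hkL)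
  have h1y3 : 1 ≤ y ^ 3 := one_le_pow₀ hy1
  have h1y102 : 1 ≤ y ^ 102 := one_le_pow₀ hy1
  have hnk1 : (n : ℝ) ^ k + 1 ≤ Real.exp (2 * y ^ 3) := by
    have h1 : 1 ≤ Real.exp (y ^ 3) := Real.one_le_exp (by positivity)
    have h2 : 2 ≤ Real.exp (y ^ 3) := by
      have := Real.add_one_le_exp (y ^ 3); linarith
    have h3 : Real.exp (2 * y ^ 3) = Real.exp (y ^ 3) * Real.exp (y ^ 3) := by
      rw [← Real.exp_add]; congr 1; ring
    rw [h3]; nlinarith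
  have hH : ((HS k n).card : ℝ) ≤ Real.exp (4 * y ^ 105) := by
    have h1 : ((HS k n).card : ℝ) ≤ ((n : ℝ) ^ k + 1) ^ (k * n + 1) := by
      have := Nat.cast_le (α := ℝ).2 (card_HS (k := k) (n := n))
      push_cast at this
      exact this
    refine h1.trans ((pow_le_pow_left₀ (by positivity) hnk1 _).trans ?_)
    rw [← Real.exp_nat_mul]
    refine Real.exp_le_exp.2 ?_
    push_cast
    calc ((k : ℝ) * n + 1) * (2 * y ^ 3) ≤ (2 * y ^ 102) * (2 * y ^ 3) := by
          gcongr; linarith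
      _ = _ := by ring
  have h2k : (2 : ℝ) ^ k ≤ Real.exp (y ^ 2) := (two_pow_le_exp _).trans (Real.exp_le_exp.2 hk)
  have h2kn : (2 : ℝ) ^ (k * n) ≤ Real.exp (y ^ 102) := by
    refine (two_pow_le_exp _).trans (Real.exp_le_exp.2 ?_)
    push_cast; exact hkn
  have hqe : (q : ℝ) ≤ Real.exp (y ^ 2) := by
    have := Real.add_one_le_exp (q : ℝ)
    have := Real.exp_le_exp.2 hq
    linarith
  push_cast
  have p1 : y ^ 2 ≤ y ^ 105 := pow_le_pow_right₀ hy1 (by norm_num)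
  have p2 : y ^ 3 ≤ y ^ 105 := pow_le_pow_right₀ hy1 (by norm_num)
  have p3 : y ^ 102 ≤ y ^ 105 := pow_le_pow_right₀ hy1 (by norm_num)
  have p4 : y ^ 105 ≤ y ^ 107 := pow_le_pow_right₀ hy1 (by norm_num)
  have p5 : 0 < y ^ 105 := by positivity
  have hH0 : (0 : ℝ) ≤ (HS k n).card := Nat.cast_nonneg _
  generalize ((HS k n).card : ℝ) = H at *
  have hK : H * (2 ^ k * ((n : ℝ) ^ k * 2 ^ (k * n))) ≤ Real.exp (7 * y ^ 105) := by
    calc H * (2 ^ k * ((n : ℝ) ^ k * 2 ^ (k * n))) ≤ Real.exp (4 * y ^ 105) *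
          (Real.exp (y ^ 2) * (Real.exp (y ^ 3) * Real.exp (y ^ 102))) := by gcongr
      _ = Real.exp (4 * y ^ 105 + (y ^ 2 + (y ^ 3 + y ^ 102))) := by
          rw [Real.exp_add, Real.exp_add, Real.exp_add]
      _ ≤ _ := Real.exp_le_exp.2 (by linarith)
  have hKq : (H * (2 ^ k * ((n : ℝ) ^ k * 2 ^ (k * n)))) ^ q ≤ Real.exp (7 * y ^ 107) := by
    refine (pow_le_pow_left₀ (by positivity) hK q).trans ?_
    rw [← Real.exp_nat_mul]
    refine Real.exp_le_exp.2 ?_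
    calc (q : ℝ) * (7 * y ^ 105) ≤ y ^ 2 * (7 * y ^ 105) := by gcongr
      _ = _ := by ring
  calc (q : ℝ) * (H * (2 ^ k * ((n : ℝ) ^ k * 2 ^ (k * n)))) ^ q * (H * 2 ^ k)
      ≤ Real.exp (y ^ 2) * Real.exp (7 * y ^ 107) *
        (Real.exp (4 * y ^ 105) * Real.exp (y ^ 2)) := by gcongr
    _ = Real.exp (y ^ 2 + 7 * y ^ 107 + (4 * y ^ 105 + y ^ 2)) := by
        rw [Real.exp_add, Real.exp_add, Real.exp_add]
    _ ≤ _ := Real.exp_le_exp.2 (by linarith)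

lemma num_Ub (hy : 100 ≤ y) : Real.exp (13 * y ^ 107) *
    (3 * Real.exp (3 * y ^ 102 - y ^ 120 / 64)) ≤ 3 * Real.exp (-y) := by
  have hy1 : 1 ≤ y := by linarith
  have h1 : Real.exp (13 * y ^ 107) * Real.exp (3 * y ^ 102 - y ^ 120 / 64) ≤ Real.exp (-y) := by
    rw [← Real.exp_add]
    refine Real.exp_le_exp.2 ?_
    have p1 : y ^ 102 ≤ y ^ 107 := pow_le_pow_right₀ hy1 (by norm_num)
    have p2 : y ≤ y ^ 107 := le_self_pow₀ hy1 (by norm_num)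
    have p3 : 100 ^ 13 * y ^ 107 ≤ y ^ 120 := by
      calc 100 ^ 13 * y ^ 107 ≤ y ^ 13 * y ^ 107 := by gcongr
        _ = _ := by ring
    have p4 : 0 < y ^ 107 := by positivity
    norm_num at p3
    linarith
  linarith

lemma num_e (hy : 100 ≤ y) (hn : (n : ℝ) = y ^ 100) (hk : (k : ℝ) ≤ y ^ 2)
    (hL : Real.log n ≤ y) (hr' : y ^ 70 / 2 ≤ r) :
    (2 ^ k * 2 ^ k * n ^ k : ℝ) * (1 / 2) ^ r ≤ Real.exp (-y) := by
  have hy0 : 0 < y := by linarith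
  have hy1 : 1 ≤ y := by linarith
  have hn0 : (0 : ℝ) < n := by rw [hn]; positivity
  have hkL : (k : ℝ) * y ≤ y ^ 3 := by
    calc (k : ℝ) * y ≤ y ^ 2 * y := by gcongr
      _ = _ := by ring
  have hnk : (n : ℝ) ^ k ≤ Real.exp (y ^ 3) :=
    (pow_le_exp hn0 hL _).trans (Real.exp_le_exp.2 hkL)
  have h2k : (2 : ℝ) ^ k ≤ Real.exp (y ^ 2) := (two_pow_le_exp _).trans (Real.exp_le_exp.2 hk)
  have hrr : ((1 : ℝ) / 2) ^ r ≤ Real.exp (-(y ^ 70 / 4)) :=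
    (half_pow_le_exp _).trans (Real.exp_le_exp.2 (by linarith))
  calc (2 ^ k * 2 ^ k * n ^ k : ℝ) * (1 / 2) ^ r ≤ Real.exp (y ^ 2) * Real.exp (y ^ 2) *
        Real.exp (y ^ 3) * Real.exp (-(y ^ 70 / 4)) := by gcongr
    _ = Real.exp (y ^ 2 + y ^ 2 + y ^ 3 + -(y ^ 70 / 4)) := by
        rw [Real.exp_add, Real.exp_add, Real.exp_add]
    _ ≤ _ := by
        refine Real.exp_le_exp.2 ?_
        have p1 : y ^ 2 ≤ y ^ 3 := pow_le_pow_right₀ hy1 (by norm_num)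
        have p2 : y ≤ y ^ 3 := le_self_pow₀ hy1 (by norm_num)
        have p3 : 100 ^ 67 * y ^ 3 ≤ y ^ 70 := by
          calc 100 ^ 67 * y ^ 3 ≤ y ^ 67 * y ^ 3 := by gcongr
            _ = _ := by ring
        have p4 : 0 < y ^ 3 := by positivity
        norm_num at p3
        linarith

lemma inv_aux (hy : 100 ≤ y) {a b : ℕ} {C : ℝ} (hC0 : 0 ≤ C) (hC : C ≤ 50) (hab : a + 1 ≤ b) :
    C * (y ^ a * (y ^ b)⁻¹) ≤ 1 / 2 := by
  have hy0 : 0 < y := by linarith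
  have hy1 : 1 ≤ y := by linarith
  have h1 : y ^ a * 100 ≤ y ^ b := by
    calc y ^ a * 100 ≤ y ^ a * y := by gcongr
      _ = y ^ (a + 1) := by ring
      _ ≤ _ := pow_le_pow_right₀ hy1 hab
  have h2 : y ^ a * (y ^ b)⁻¹ ≤ 1 / 100 := by
    rw [← div_eq_mul_inv, div_le_iff₀ (by positivity)]; linarith
  have h3 : 0 ≤ y ^ a * (y ^ b)⁻¹ := by positivity
  nlinarith

end Numerics

section Core

variable {y p : ℝ} {k n s q : ℕ}

lemma core (hy : 100 ≤ y) (hn : (n : ℝ) = y ^ 100) (hk : (k : ℝ) ≤ y ^ 2) (hs : (s : ℝ) ≤ y)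
    (hq : (q : ℝ) ≤ y ^ 2) (hL : Real.log n ≤ y) (h2s : (2 : ℝ) ^ s ≤ y ^ 2)
    (hp0 : 0 < p) (hp1 : p ≤ 1) (hz : (p ^ s)⁻¹ ≤ y ^ 2)
    (hm : ∀ i < q, ∀ m : ℕ, (y ^ 8) ^ m ≤ 16 * 8 ^ i → m ≤ s) :
    Pr (potEdges k n) p (fun G => ¬ Surv (HS k n) G q Finset.univ) ≤ 4 * Real.exp (-y) := by
  have hy0 : 0 < y := by linarith
  have hy1 : 1 ≤ y := by linarith
  have hnR : (1 : ℝ) ≤ n := by rw [hn]; exact one_le_pow₀ hy1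
  have hn1 : 1 ≤ n := by exact_mod_cast hnR
  obtain ⟨M, hM⟩ : ∃ M, M = ⌊y ^ 50⌋₊ := ⟨_, rfl⟩
  obtain ⟨r, hr⟩ : ∃ r, r = ⌊y ^ 70⌋₊ := ⟨_, rfl⟩
  have hMu : (M : ℝ) ≤ y ^ 50 := by rw [hM]; exact Nat.floor_le (by positivity)
  have hru : (r : ℝ) ≤ y ^ 70 := by rw [hr]; exact Nat.floor_le (by positivity)
  have h100 : ∀ a : ℕ, 1 ≤ a → 100 ≤ y ^ a := fun a ha =>
    hy.trans (le_self_pow₀ hy1 (by omega))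
  have hMl : y ^ 50 / 2 ≤ M := by
    have := Nat.lt_floor_add_one (y ^ 50)
    rw [← hM] at this
    linarith [h100 50 (by norm_num)]
  have hrl : y ^ 70 / 2 ≤ r := by
    have := Nat.lt_floor_add_one (y ^ 70)
    rw [← hr] at this
    linarith [h100 70 (by norm_num)]
  have hMR : (1 : ℝ) ≤ M := by linarith [h100 50 (by norm_num)]
  have hM1 : 1 ≤ M := by exact_mod_cast hMR
  have hz1 : 1 ≤ y ^ 2 := one_le_pow₀ hy1
  obtain ⟨θ, hθ⟩ : ∃ θ, θ = (y ^ 90)⁻¹ := ⟨_, rfl⟩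
  obtain ⟨θ', hθ'⟩ : ∃ θ', θ' = (y ^ 85)⁻¹ := ⟨_, rfl⟩
  have hθ0 : 0 < θ := by rw [hθ]; positivity
  have hθ'0 : 0 < θ' := by rw [hθ']; positivity
  have hzt : y ^ 2 * θ = (y ^ 88)⁻¹ := by rw [hθ]; field_simp
  have hzt' : y ^ 2 * θ' = (y ^ 83)⁻¹ := by rw [hθ']; field_simp
  have hnθ : (n : ℝ)⁻¹ ≤ θ := by
    rw [hn, hθ]
    exact inv_anti₀ (by positivity) (pow_le_pow_right₀ hy1 (by norm_num))
  have hθ'1 : θ' < 1 := by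
    rw [hθ']
    exact inv_lt_one_of_one_lt₀ (by linarith [h100 85 (by norm_num)])
  have hθθ' : 8 * (y ^ 2 * θ) ≤ θ' := by
    rw [hzt, hθ', ← div_eq_mul_inv, div_le_iff₀ (by positivity)]
    have e : (y ^ 85)⁻¹ * y ^ 88 = y ^ 3 := by field_simp
    rw [e]; linarith [h100 3 (by norm_num)]
  have hMs : (M : ℝ) * s ≤ y ^ 51 := by
    calc (M : ℝ) * s ≤ y ^ 50 * y := by gcongr
      _ = _ := by ring
  have hkr : (k : ℝ) * r ≤ y ^ 72 := by
    calc (k : ℝ) * r ≤ y ^ 2 * y ^ 70 := by gcongr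
      _ = _ := by ring
  have p51 : y ^ 51 ≤ y ^ 72 := pow_le_pow_right₀ hy1 (by norm_num)
  have hsmall : ((M * s + k * r : ℕ) : ℝ) * (y ^ 2 * θ) ≤ 1 / 2 := by
    rw [hzt]
    refine le_trans ?_ (inv_aux (a := 72) (b := 88) hy (C := 2) (by norm_num) (by norm_num)
      (by norm_num))
    rw [← mul_assoc]
    refine mul_le_mul_of_nonneg_right ?_ (by positivity)
    push_cast; linarith
  have hsmall0 : ((s + k * r : ℕ) : ℝ) * (y ^ 2 * θ) ≤ 1 / 2 := by
    refine le_trans (mul_le_mul_of_nonneg_right (Nat.cast_le.2 ?_) (by positivity)) hsmall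
    exact Nat.add_le_add_right (Nat.le_mul_of_pos_left _ hM1) _
  have he := (E0_bound (k := k) hn1 hp0 hp1 hz1 hθ0 hnθ hz hsmall0).trans (num_e hy hn hk hL hrl)
  have hb : ∀ (S : Finset (Tup k n)) I, Cond θ θ' s S I →
      Pr (potEdges k n) p (Bad p θ (y ^ 2) S I) ≤ 3 * Real.exp (3 * y ^ 102 - y ^ 120 / 64) := by
    rintro S I ⟨h1, h2, h3⟩
    refine (bad_bound hp0 hp1 hz1 hθ0 hθ'0 hM1 hz ?_ h1 h2 h3 ?_ ?_ ?_ hsmall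
      (Δ₁ := 8 * (y ^ 136)⁻¹) (Δ₃ := 8 * (y ^ 164)⁻¹) (by positivity) (by positivity) ?_ ?_).trans
      (num_b hy hn hk hL hMu hMl hrl)
    · rw [hzt']; exact inv_le_one_of_one_le₀ (one_le_pow₀ hy1)
    · rw [hzt]
      refine le_trans ?_ (inv_aux (a := 2) (b := 88) hy (C := 1) (by norm_num) (by norm_num)
        (by norm_num))
      rw [one_mul]
      exact mul_le_mul_of_nonneg_right hk (by positivity)
    · rw [hzt]
      refine le_trans ?_ (inv_aux (a := 1) (b := 88) hy (C := 1) (by norm_num) (by norm_num)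
        (by norm_num))
      rw [one_mul, pow_one]
      exact mul_le_mul_of_nonneg_right hs (by positivity)
    · have := inv_aux (a := 51) (b := 85) hy (C := 8) (by norm_num) (by norm_num) (by norm_num)
      have h4 : (M : ℝ) * s * (y ^ 85)⁻¹ ≤ y ^ 51 * (y ^ 85)⁻¹ :=
        mul_le_mul_of_nonneg_right hMs (by positivity)
      rw [hθ']
      push_cast
      linarith
    · rw [hzt]
      have a1 : 2 * (k * (y ^ 88)⁻¹) / M ≤ 4 * (y ^ 136)⁻¹ := by
        calc 2 * (k * (y ^ 88)⁻¹) / M ≤ 2 * (y ^ 2 * (y ^ 88)⁻¹) / (y ^ 50 / 2) := by gcongr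
          _ = _ := by field_simp; ring
      have a2 : (2 * (s * (y ^ 88)⁻¹)) ^ 2 ≤ 4 * (y ^ 136)⁻¹ := by
        calc (2 * (s * (y ^ 88)⁻¹)) ^ 2 ≤ (2 * (y * (y ^ 88)⁻¹)) ^ 2 := by gcongr
          _ = 4 * (y ^ 174)⁻¹ := by field_simp; ring
          _ ≤ _ := by
            refine mul_le_mul_of_nonneg_left ?_ (by norm_num)
            exact inv_anti₀ (by positivity) (pow_le_pow_right₀ hy1 (by norm_num))
      linarith
    · rw [hzt']
      calc 8 * (2 ^ s * ((y ^ 83)⁻¹) ^ 2) ≤ 8 * (y ^ 2 * ((y ^ 83)⁻¹) ^ 2) := by gcongr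
        _ = _ := by field_simp
  have hfin := OK_bound (q := q) hn1 hp0.le hp1 hθ0 (HS k n) HS_nonempty
    (b := 3 * Real.exp (3 * y ^ 102 - y ^ 120 / 64)) (by positivity) he hb
  refine (Pr_mono hp0.le hp1 ?_).trans (hfin.trans ?_)
  · intro G _ hG hOK
    refine hG (hOK.surv_univ hn1 hp0 hp1 hz1 hθ0 hnθ hθ'1 hθθ' hz ?_ (fun h hh => HS_compl hh))
    intro i hi m hle
    refine hm i hi m ?_
    have e : (n : ℝ) * θ / y ^ 2 = y ^ 8 := by rw [hn, hθ]; field_simp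
    rwa [e] at hle
  · have h1 := mul_le_mul_of_nonneg_right (num_U hy hn hk hq hL)
      (by positivity : 0 ≤ 3 * Real.exp (3 * y ^ 102 - y ^ 120 / 64))
    have h2 := num_Ub hy
    linarith

end Core
end BC

open Finset

namespace BC

lemma probG_eq_Pr (k n : ℕ) (p : ℝ) (P : Finset (Sym2 (Vtx k n)) → Prop) :
    probG k n p P = Pr (potEdges k n) p P := by
  unfold probG Pr Ex
  refine Finset.sum_congr rfl fun G _ => ?_
  by_cases h : P G <;> simp [h]

lemma large_n (γ : ℝ) (hγ : 0 < γ) : ∃ n₀ : ℕ, ∀ n ≥ n₀, 1 ≤ n ∧ 10000 ≤ Real.log n ∧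
    100 ≤ (n : ℝ) ^ ((1 : ℝ) / 100) ∧ Real.log n ≤ (n : ℝ) ^ ((1 : ℝ) / 100) ∧
    4 * Real.exp (-((n : ℝ) ^ ((1 : ℝ) / 100))) ≤ γ := by
  have hcast : Filter.Tendsto (fun n : ℕ => (n : ℝ)) Filter.atTop Filter.atTop :=
    tendsto_natCast_atTop_atTop
  have hy : Filter.Tendsto (fun n : ℕ => (n : ℝ) ^ ((1 : ℝ) / 100)) Filter.atTop Filter.atTop :=
    (tendsto_rpow_atTop (by norm_num)).comp hcast
  have h1 : ∀ᶠ n : ℕ in Filter.atTop, 10000 ≤ Real.log n :=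
    (Real.tendsto_log_atTop.comp hcast).eventually_ge_atTop _
  have h2 := hy.eventually_ge_atTop 100
  have h3 : ∀ᶠ n : ℕ in Filter.atTop, Real.log n ≤ (n : ℝ) ^ ((1 : ℝ) / 100) := by
    have := (isLittleO_log_rpow_atTop (r := (1 : ℝ) / 100) (by norm_num)).bound
      (c := 1) (by norm_num)
    filter_upwards [hcast.eventually this] with n hn
    rw [one_mul, Real.norm_of_nonneg (by positivity : (0 : ℝ) ≤ (n : ℝ) ^ ((1 : ℝ) / 100))] at hn
    exact (le_abs_self _).trans hn
  have h4 := hy.eventually_ge_atTop (4 / γ)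
  obtain ⟨n₀, h⟩ := Filter.eventually_atTop.1
    ((Filter.eventually_ge_atTop 1).and (h1.and (h2.and (h3.and h4))))
  refine ⟨n₀, fun n hn => ?_⟩
  obtain ⟨a1, a2, a3, a4, a5⟩ := h n hn
  refine ⟨a1, a2, a3, a4, ?_⟩
  rw [Real.exp_neg, ← div_eq_mul_inv, div_le_iff₀ (Real.exp_pos _)]
  rw [div_le_iff₀ hγ] at a5
  have := Real.add_one_le_exp ((n : ℝ) ^ ((1 : ℝ) / 100))
  nlinarith

end BC
set_option maxHeartbeats 2000000 in
/-- Corollary 4.4: there is an absolute constant `c > 0` such that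
for all integers `D, k, n` with `k ≤ n^{1/64}` and `D ≤ 2 log n`: if
`G ∼ G(n,k,n^{−2/D})`, then with probability tending to `1` as `n → ∞` every tree-like
semantic cutting planes refutation of `bclique_u(G,k)` has length at least `n^{cD}`. -/
theorem treelike_cutting_planes_lower_bound :
    ∃ c > (0 : ℝ), ∀ γ > (0 : ℝ), ∃ n₀ : ℕ, ∀ n ≥ n₀, ∀ k D : ℕ,
      1 ≤ D → (k : ℝ) ≤ (n : ℝ) ^ ((1 : ℝ) / 64) → (D : ℝ) ≤ 2 * Real.logb 2 n →
      1 - γ ≤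
        probG k n ((n : ℝ) ^ (-(2 : ℝ) / (D : ℝ))) (fun G =>
          ∀ π : SemProof (k * n), IsRefutation (CPlines (k * n)) (bcliqueU k n G) π →
            (n : ℝ) ^ (c * (D : ℝ)) ≤ (π.length : ℝ)) := by
  refine ⟨1 / 20000, by norm_num, fun γ hγ => ?_⟩
  obtain ⟨n₀, hn₀⟩ := BC.large_n γ hγ
  refine ⟨n₀, fun n hn k D hD hk hDn => ?_⟩
  obtain ⟨hn1, hL, hy, hLy, hγy⟩ := hn₀ n hn
  have hn0 : (0 : ℝ) < n := by exact_mod_cast hn1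
  have hn1' : (1 : ℝ) ≤ n := by exact_mod_cast hn1
  obtain ⟨L, hLdef⟩ : ∃ L, L = Real.log n := ⟨_, rfl⟩
  have hrp : ∀ a : ℝ, (n : ℝ) ^ a = Real.exp (L * a) := fun a => by
    rw [hLdef, Real.rpow_def_of_pos hn0]
  obtain ⟨y, hydef⟩ : ∃ y, y = (n : ℝ) ^ ((1 : ℝ) / 100) := ⟨_, rfl⟩
  have hyexp : y = Real.exp (L * (1 / 100)) := by rw [hydef, hrp]
  have hy2 : y ^ 2 = Real.exp (L / 50) := by
    rw [hyexp, ← Real.exp_nat_mul]; congr 1; push_cast; ring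
  have hy8 : y ^ 8 = Real.exp (L * 8 / 100) := by
    rw [hyexp, ← Real.exp_nat_mul]; congr 1; push_cast; ring
  rw [← hydef] at hy hLy hγy
  have hLy' : L ≤ y := by rw [hLdef]; exact hLy
  rw [← hLdef] at hL
  have hD1 : (1 : ℝ) ≤ D := by exact_mod_cast hD
  have hD0 : (0 : ℝ) < D := by linarith
  have hl2 := Real.log_two_gt_d9
  have hl2' := Real.log_two_lt_d9
  obtain ⟨ℓ, hℓ⟩ : ∃ ℓ, ℓ = Real.log 2 := ⟨_, rfl⟩
  rw [← hℓ] at hl2 hl2'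
  have hℓ0 : 0 < ℓ := by linarith
  have hlogb : Real.logb 2 n = L / ℓ := by rw [hLdef, hℓ]; rfl
  rw [hlogb] at hDn
  have hDℓ : D * ℓ ≤ 2 * L := by
    have : (D : ℝ) * ℓ ≤ 2 * (L / ℓ) * ℓ := mul_le_mul_of_nonneg_right hDn hℓ0.le
    rwa [mul_assoc, div_mul_cancel₀ _ hℓ0.ne'] at this
  obtain ⟨s, hs⟩ : ∃ s : ℕ, s = D / 100 := ⟨_, rfl⟩
  have hs1 : (100 : ℝ) * s ≤ D := by
    have : 100 * s ≤ D := by omega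
    exact_mod_cast this
  have hs2 : (D : ℝ) ≤ 100 * (s + 1) := by
    have : D ≤ 100 * (s + 1) := by omega
    exact_mod_cast this
  have hs0 : (0 : ℝ) ≤ s := Nat.cast_nonneg _
  obtain ⟨x, hx⟩ : ∃ x, x = D * L / (5000 * ℓ) := ⟨_, rfl⟩
  have hx0 : 0 ≤ x := by rw [hx]; positivity
  have hxℓ : x * ℓ = D * L / 5000 := by rw [hx]; field_simp
  obtain ⟨q, hq⟩ : ∃ q, q = ⌊x⌋₊ := ⟨_, rfl⟩
  have hq1 : (q : ℝ) ≤ x := by rw [hq]; exact Nat.floor_le hx0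
  have hq2 : x < q + 1 := by rw [hq]; exact Nat.lt_floor_add_one x
  have hDL : L ≤ D * L := by nlinarith
  obtain ⟨p, hp⟩ : ∃ p, p = (n : ℝ) ^ (-(2 : ℝ) / (D : ℝ)) := ⟨_, rfl⟩
  have hpexp : p = Real.exp (-(2 * L / D)) := by
    rw [hp, hrp]; congr 1; ring
  have hp0 : 0 < p := by rw [hpexp]; exact Real.exp_pos _
  have hp1 : p ≤ 1 := by
    rw [hpexp]
    refine Real.exp_le_one_iff.2 ?_
    have : 0 ≤ 2 * L / D := by positivity
    linarith
  have hDL4 : (D : ℝ) ≤ 4 * L := by nlinarith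
  have key := BC.core (k := k) (n := n) (s := s) (q := q) (p := p) hy ?_ ?_ ?_ ?_ hLy ?_ hp0 hp1 ?_ ?_
  · rw [← hp, BC.probG_eq_Pr]
    have h1 := BC.Pr_not (potEdges k n) p (fun G => BC.Surv (BC.HS k n) G q Finset.univ)
    have h2 : BC.Pr (potEdges k n) p (fun G => BC.Surv (BC.HS k n) G q Finset.univ) ≤
      BC.Pr (potEdges k n) p (fun G =>
          ∀ π : SemProof (k * n), IsRefutation (CPlines (k * n)) (bcliqueU k n G) π →
            (n : ℝ) ^ (1 / 20000 * (D : ℝ)) ≤ (π.length : ℝ)) := by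
      refine BC.Pr_mono hp0.le hp1 fun G _ hG π hπ => ?_
      refine le_trans ?_ (BC.refutation_length hG π hπ)
      have h32 : ℓ / 2 ≤ Real.log (3 / 2) := by
        have h3 : Real.log 2 ≤ Real.log ((3 / 2) ^ 2) :=
          Real.log_le_log (by norm_num) (by norm_num)
        rw [Real.log_pow] at h3
        push_cast at h3
        rw [hℓ]; linarith
      have h4 : ((3 : ℝ) / 2) ^ q = Real.exp (q * Real.log (3 / 2)) := by
        rw [Real.exp_nat_mul, Real.exp_log (by norm_num)]
      rw [h4, hrp]
      refine Real.exp_le_exp.2 ?_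
      have h5 : (q : ℝ) * (ℓ / 2) ≤ q * Real.log (3 / 2) :=
        mul_le_mul_of_nonneg_left h32 (Nat.cast_nonneg _)
      have h6 : x * ℓ ≤ (q + 1) * ℓ := mul_le_mul_of_nonneg_right hq2.le hℓ0.le
      linarith
    linarith
  · rw [hydef, ← Real.rpow_natCast, ← Real.rpow_mul hn0.le]; norm_num
  · refine hk.trans ?_
    rw [hrp, hy2]
    exact Real.exp_le_exp.2 (by linarith)
  · linarith
  · refine hq1.trans ?_
    have h1 : x ≤ L * L := by
      rw [hx, div_le_iff₀ (by positivity)]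
      have : (D : ℝ) * L ≤ 4 * L * L := mul_le_mul_of_nonneg_right hDL4 (by linarith)
      nlinarith
    nlinarith
  · have h1 : (2 : ℝ) ^ s = Real.exp (s * ℓ) := by
      rw [Real.exp_nat_mul, hℓ, Real.exp_log (by norm_num)]
    rw [h1, hy2]
    refine Real.exp_le_exp.2 ?_
    have : 100 * (s : ℝ) * ℓ ≤ D * ℓ := mul_le_mul_of_nonneg_right hs1 hℓ0.le
    linarith
  · rw [hpexp, ← Real.exp_nat_mul, ← Real.exp_neg, hy2]
    refine Real.exp_le_exp.2 ?_
    rw [mul_neg, neg_neg, mul_div_assoc', div_le_iff₀ hD0]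
    have : 100 * (s : ℝ) * L ≤ D * L := mul_le_mul_of_nonneg_right hs1 (by linarith)
    linarith
  · intro i hi m hle
    by_contra hc
    rw [not_le] at hc
    have h1 : (s : ℝ) + 1 ≤ m := by exact_mod_cast hc
    have h2 : (D : ℝ) ≤ 100 * m := by linarith
    rw [hy8, ← Real.exp_nat_mul] at hle
    have h3 : (16 : ℝ) * 8 ^ i ≤ 2 * 8 ^ q := by
      have : (8 : ℝ) ^ (i + 1) ≤ 8 ^ q := pow_le_pow_right₀ (by norm_num) hi
      rw [pow_succ] at this
      linarith
    have h4 : (2 : ℝ) * 8 ^ q = Real.exp (ℓ + q * (3 * ℓ)) := by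
      rw [Real.exp_add, Real.exp_nat_mul, hℓ, Real.exp_log (by norm_num)]
      congr 2
      have : (3 : ℝ) * Real.log 2 = Real.log (2 ^ 3) := by rw [Real.log_pow]; norm_num
      rw [this, Real.exp_log (by norm_num)]; norm_num
    have h5 := Real.exp_le_exp.1 (hle.trans (h3.trans_eq h4))
    have h6 : (q : ℝ) * ℓ ≤ x * ℓ := mul_le_mul_of_nonneg_right hq1 hℓ0.le
    have h7 : (D : ℝ) * L ≤ 100 * m * L := mul_le_mul_of_nonneg_right h2 (by linarith)
    linarith
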